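/- arXiv:2605.18620 — 3 statements merged into one kernel-verified Lean document; each statement's English description precedes it below -/
import Mathlib

section
/- Under the GOE model, the probability that some global minimizer of the quadratic form x ↦ xᵀQx over the standard simplex Δ^{n-1} has support of cardinality exactly 2 satisfies lim_{n→∞} (n/√(log n)) · μ_n{Q : ∃ x ∈ Δ^{n-1}, x is a global minimizer of y ↦ yᵀQy over Δ^{n-1} and |{i : x_i > 0}| = 2} = 2√(2π). -/
open MeasureTheory ProbabilityTheory Filter Matrix

/-- Build a symmetric matrix from diagonal coordinates and strictly
upper-triangular coordinates. -/
noncomputable def goeMatrix (n : ℕ)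
    (d : Fin n → ℝ) (o : {p : Fin n × Fin n // p.1 < p.2} → ℝ) :
    Matrix (Fin n) (Fin n) ℝ :=
  fun i j =>
    if h : i = j then d i
    else if h' : i < j then o ⟨(i, j), h'⟩
    else o ⟨(j, i), lt_of_le_of_ne (not_lt.mp h') (Ne.symm h)⟩

instance matrixMeasurableSpace (n : ℕ) :
    MeasurableSpace (Matrix (Fin n) (Fin n) ℝ) := by
  unfold Matrix; infer_instance

/-- The GOE model: the pushforward, under the symmetric-matrix assembly map, of
the product Gaussian measure with `N(0,1)` diagonal coordinates and `N(0,1/2)`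
strictly upper-triangular coordinates. -/
noncomputable def goeMeasure (n : ℕ) : Measure (Matrix (Fin n) (Fin n) ℝ) :=
  ((Measure.pi fun _ : Fin n => gaussianReal 0 1).prod
      (Measure.pi fun _ : {p : Fin n × Fin n // p.1 < p.2} =>
        gaussianReal 0 (1 / 2))).map
    (fun dq => goeMatrix n dq.1 dq.2)

namespace GoeAux
open Set Topology
open scoped NNReal ENNReal

/-- cdf of the centered Gaussian with variance `v`. -/
noncomputable def gcdf (v : ℝ≥0) (t : ℝ) : ℝ := (gaussianReal 0 v).real (Iic t)

lemma gcdf_nonneg (v : ℝ≥0) (t : ℝ) : 0 ≤ gcdf v t := measureReal_nonneg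
lemma gcdf_le_one (v : ℝ≥0) (t : ℝ) : gcdf v t ≤ 1 := measureReal_le_one
lemma gcdf_mono (v : ℝ≥0) : Monotone (gcdf v) := fun _ _ h =>
  measureReal_mono (Iic_subset_Iic.2 h)
lemma gcdf_eq_cdf (v : ℝ≥0) : gcdf v = cdf (gaussianReal 0 v) := by
  ext t; rw [cdf_eq_real]; rfl
lemma gcdf_tendsto_atBot (v : ℝ≥0) : Tendsto (gcdf v) atBot (𝓝 0) := by
  rw [gcdf_eq_cdf]; exact tendsto_cdf_atBot _
lemma gcdf_tendsto_atTop (v : ℝ≥0) : Tendsto (gcdf v) atTop (𝓝 1) := by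
  rw [gcdf_eq_cdf]; exact tendsto_cdf_atTop _

lemma continuous_pdf (v : ℝ≥0) : Continuous (gaussianPDFReal 0 v) := by
  rw [gaussianPDFReal_def]; fun_prop

lemma real_eq_integral {v : ℝ≥0} (hv : v ≠ 0) (s : Set ℝ) :
    (gaussianReal 0 v).real s = ∫ x in s, gaussianPDFReal 0 v x := by
  rw [measureReal_def, gaussianReal_apply_eq_integral 0 hv, ENNReal.toReal_ofReal]
  exact integral_nonneg fun x => gaussianPDFReal_nonneg _ _ _

lemma gcdf_hasDerivAt {v : ℝ≥0} (hv : v ≠ 0) (t : ℝ) :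
    HasDerivAt (gcdf v) (gaussianPDFReal 0 v t) t := by
  have h : gcdf v = fun t => gcdf v 0 + ∫ x in (0:ℝ)..t, gaussianPDFReal 0 v x := by
    ext t
    have := intervalIntegral.integral_Iic_sub_Iic (μ := volume) (f := gaussianPDFReal 0 v)
      (a := 0) (b := t) (integrable_gaussianPDFReal 0 v).integrableOn
      (integrable_gaussianPDFReal 0 v).integrableOn
    rw [← this]; simp only [gcdf, real_eq_integral hv]; ring
  rw [h]
  refine HasDerivAt.const_add _ ?_
  exact intervalIntegral.integral_hasDerivAt_right
    ((continuous_pdf v).intervalIntegrable _ _)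
    ((continuous_pdf v).stronglyMeasurableAtFilter _ _) (continuous_pdf v).continuousAt

lemma gcdf_continuous {v : ℝ≥0} (hv : v ≠ 0) : Continuous (gcdf v) :=
  continuous_iff_continuousAt.2 fun t => (gcdf_hasDerivAt hv t).continuousAt

lemma gcdf_pos {v : ℝ≥0} (hv : v ≠ 0) (t : ℝ) : 0 < gcdf v t := by
  unfold gcdf
  rw [measureReal_def]
  refine ENNReal.toReal_pos ?_ (measure_ne_top _ _)
  intro h
  have := gaussianReal_absolutelyContinuous' 0 hv h
  simp at this

lemma pdf_hasDerivAt {v : ℝ≥0} (hv : v ≠ 0) (t : ℝ) :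
    HasDerivAt (gaussianPDFReal 0 v) (-(t / v) * gaussianPDFReal 0 v t) t := by
  have hv' : (v:ℝ) ≠ 0 := by exact_mod_cast hv
  rw [gaussianPDFReal_def]
  have h1 : HasDerivAt (fun x : ℝ => -(x - 0) ^ 2 / (2 * (v:ℝ))) (-(t / v)) t := by
    have : HasDerivAt (fun x : ℝ => -(x - 0) ^ 2 / (2 * (v:ℝ)))
      (-((2:ℕ) * (t - 0) ^ (2 - 1) * 1) / (2 * (v:ℝ))) t :=
      ((((hasDerivAt_id t).sub_const 0).pow 2).neg).div_const _
    refine this.congr_deriv ?_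
    field_simp; norm_num; ring
  refine ((h1.exp).const_mul ((√(2 * Real.pi * v))⁻¹)).congr_deriv ?_
  ring

lemma pdf_tendsto_atBot {v : ℝ≥0} (hv : v ≠ 0) :
    Tendsto (gaussianPDFReal 0 v) atBot (𝓝 0) := by
  have hv' : (0:ℝ) < v := by exact_mod_cast pos_iff_ne_zero.2 hv
  rw [gaussianPDFReal_def]
  rw [← mul_zero ((√(2 * Real.pi * v))⁻¹)]
  refine Tendsto.const_mul _ ?_
  refine Real.tendsto_exp_atBot.comp ?_
  have : Tendsto (fun x : ℝ => x ^ 2) atBot atTop := by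
    have := (tendsto_pow_atTop (α := ℝ) (two_ne_zero)).comp tendsto_neg_atBot_atTop
    refine this.congr fun x => by simp
  have h2 := (this.atTop_div_const (r := 2 * (v:ℝ)) (by positivity))
  refine (tendsto_neg_atTop_atBot.comp h2).congr fun x => by simp; ring

/-- Mills ratio asymptotics. -/
lemma mills {v : ℝ≥0} (hv : v ≠ 0) :
    Tendsto (fun t => gcdf v t / (v * gaussianPDFReal 0 v t / (-t))) atBot (𝓝 1) := by
  have hv' : (0:ℝ) < v := by exact_mod_cast pos_iff_ne_zero.2 hv
  have hpos := fun t => gaussianPDFReal_pos 0 v t hv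
  refine HasDerivAt.lhopital_zero_atBot (f' := gaussianPDFReal 0 v)
    (g' := fun t => gaussianPDFReal 0 v t * (1 + v / t ^ 2))
    (Eventually.of_forall fun t => gcdf_hasDerivAt hv t) ?_ ?_ (gcdf_tendsto_atBot v) ?_ ?_
  · filter_upwards [eventually_lt_atBot 0] with t ht
    have := ((pdf_hasDerivAt hv t).const_mul (v:ℝ)).fun_div (hasDerivAt_neg t) (by linarith)
    refine this.congr_deriv ?_
    have : t ≠ 0 := ht.ne
    field_simp
    ring
  · filter_upwards [eventually_lt_atBot 0] with t ht
    have : 0 < t ^ 2 := by nlinarith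
    have := hpos t
    positivity
  · have h1 := (pdf_tendsto_atBot hv).const_mul (v:ℝ)
    have h2 : Tendsto (fun t : ℝ => (-t)⁻¹) atBot (𝓝 0) :=
      tendsto_inv_atTop_zero.comp tendsto_neg_atBot_atTop
    simpa [div_eq_mul_inv] using h1.mul h2
  · have h2 : Tendsto (fun t : ℝ => (-t)⁻¹) atBot (𝓝 0) :=
      tendsto_inv_atTop_zero.comp tendsto_neg_atBot_atTop
    have h3 : Tendsto (fun t : ℝ => 1 / (1 + v * ((-t)⁻¹ * (-t)⁻¹))) atBot
        (𝓝 (1 / (1 + v * (0 * 0)))) := by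
      refine Tendsto.div tendsto_const_nhds ?_ (by simp)
      exact tendsto_const_nhds.add ((h2.mul h2).const_mul _)
    simp only [mul_zero, add_zero, div_one] at h3
    refine h3.congr' ?_
    filter_upwards [eventually_lt_atBot 0] with t ht
    have : t ≠ 0 := ht.ne
    have := (hpos t).ne'
    have : t ^ 2 + v ≠ 0 := by positivity
    field_simp

/-- change of variables `u = Φ(t)` -/
lemma integral_comp_gcdf (g : ℝ → ℝ) (hg : Continuous g) :
    ∫ t, g (gcdf 1 t) ∂(gaussianReal 0 1) = ∫ u in (0:ℝ)..1, g u := by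
  have h1 : (1:ℝ≥0) ≠ 0 := one_ne_zero
  rw [integral_gaussianReal_eq_integral_smul h1]
  set G : ℝ → ℝ := fun x => ∫ u in (0:ℝ)..x, g u with hG
  have hGd : ∀ x, HasDerivAt G (g x) x := fun x =>
    intervalIntegral.integral_hasDerivAt_right (hg.intervalIntegrable _ _)
      (hg.stronglyMeasurableAtFilter _ _) hg.continuousAt
  have hGc : Continuous G := continuous_iff_continuousAt.2 fun t => (hGd t).continuousAt
  obtain ⟨C, hC⟩ := (isCompact_Icc (a := (0:ℝ)) (b := 1)).exists_bound_of_continuousOn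
    hg.continuousOn
  have key := integral_of_hasDerivAt_of_tendsto (f := fun t => G (gcdf 1 t))
    (f' := fun t => gaussianPDFReal 0 1 t • g (gcdf 1 t)) (m := G 0) (n := G 1)
    (fun t => by
      have := (hGd (gcdf 1 t)).comp t (gcdf_hasDerivAt h1 t)
      rw [smul_eq_mul, mul_comm]; exact this)
    (by
      refine (integrable_gaussianPDFReal 0 1).mul_bdd (c := C) ?_ ?_
      · exact (hg.comp (gcdf_continuous h1)).aestronglyMeasurable
      · exact Eventually.of_forall fun t => hC _ ⟨gcdf_nonneg _ _, gcdf_le_one _ _⟩)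
    ((hGc.tendsto 0).comp (gcdf_tendsto_atBot 1))
    ((hGc.tendsto 1).comp (gcdf_tendsto_atTop 1))
  rw [key]
  simp [hG]

lemma poly_int (N : ℕ) : (∫ u in (0:ℝ)..1, (1 - u) ^ N) = 1 / ((N:ℝ) + 1) := by
  have := intervalIntegral.integral_comp_sub_left (fun u : ℝ => u ^ N) (a := 0) (b := 1) 1
  rw [this]; simp [integral_pow]

lemma poly_int2 (N : ℕ) : (∫ u in (0:ℝ)..1, u ^ 2 * (1 - u) ^ N)
    = 2 / (((N:ℝ) + 1) * (N + 2) * (N + 3)) := by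
  have := intervalIntegral.integral_comp_sub_left (fun u : ℝ => (1 - u) ^ 2 * u ^ N)
    (a := 0) (b := 1) 1
  simp only [sub_sub_cancel] at this
  rw [this]
  have h : ∀ u : ℝ, (1 - u) ^ 2 * u ^ N = u ^ N - 2 * u ^ (N + 1) + u ^ (N + 2) := by
    intro u; ring
  simp only [h]
  rw [intervalIntegral.integral_add (by apply Continuous.intervalIntegrable; fun_prop)
    (by apply Continuous.intervalIntegrable; fun_prop),
    intervalIntegral.integral_sub (by apply Continuous.intervalIntegrable; fun_prop)
    (by apply Continuous.intervalIntegrable; fun_prop), intervalIntegral.integral_const_mul]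
  simp [integral_pow]
  field_simp
  ring

lemma poly_int3 (N : ℕ) : (∫ u in (0:ℝ)..1, u ^ 3 * (1 - u) ^ N)
    = 6 / (((N:ℝ) + 1) * (N + 2) * (N + 3) * (N + 4)) := by
  have := intervalIntegral.integral_comp_sub_left (fun u : ℝ => (1 - u) ^ 3 * u ^ N)
    (a := 0) (b := 1) 1
  simp only [sub_sub_cancel] at this
  rw [this]
  have h : ∀ u : ℝ, (1 - u) ^ 3 * u ^ N =
      (u ^ N - 3 * u ^ (N + 1)) + (3 * u ^ (N + 2) - u ^ (N + 3)) := by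
    intro u; ring
  simp only [h]
  rw [intervalIntegral.integral_add (by apply Continuous.intervalIntegrable; fun_prop)
    (by apply Continuous.intervalIntegrable; fun_prop),
    intervalIntegral.integral_sub (by apply Continuous.intervalIntegrable; fun_prop)
    (by apply Continuous.intervalIntegrable; fun_prop),
    intervalIntegral.integral_sub (by apply Continuous.intervalIntegrable; fun_prop)
    (by apply Continuous.intervalIntegrable; fun_prop),
    intervalIntegral.integral_const_mul, intervalIntegral.integral_const_mul]
  simp [integral_pow]
  field_simp
  ring

end GoeAux

namespace GoeAux
open Set Topology
open scoped NNReal ENNReal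

section Deterministic
variable {n : ℕ} (Q : Matrix (Fin n) (Fin n) ℝ) (x : Fin n → ℝ)

/-- `x` is a global minimizer over the simplex. -/
def IsMinim : Prop := x ∈ stdSimplex ℝ (Fin n) ∧
  ∀ y ∈ stdSimplex ℝ (Fin n), x ⬝ᵥ Q.mulVec x ≤ y ⬝ᵥ Q.mulVec y

variable {Q x}

lemma quad_ge (h : IsMinim Q x) (z : Fin n → ℝ) (hz : ∀ i, 0 ≤ z i) :
    (x ⬝ᵥ Q.mulVec x) * (∑ i, z i) ^ 2 ≤ z ⬝ᵥ Q.mulVec z := by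
  set s := ∑ i, z i with hs
  have hs0 : 0 ≤ s := Finset.sum_nonneg fun i _ => hz i
  rcases hs0.eq_or_lt with h0 | h0
  · have hz0 : z = 0 := by
      funext i
      exact (Finset.sum_eq_zero_iff_of_nonneg (fun i _ => hz i)).1 h0.symm i (Finset.mem_univ _)
    rw [← h0, hz0]; simp
  · have := h.2 (s⁻¹ • z) ⟨fun i => by
        simp only [Pi.smul_apply, smul_eq_mul]; have := hz i; positivity, by
        simp only [Pi.smul_apply, smul_eq_mul, ← Finset.mul_sum, ← hs]
        exact inv_mul_cancel₀ h0.ne'⟩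
    rw [mulVec_smul, dotProduct_smul, smul_dotProduct, smul_eq_mul, smul_eq_mul] at this
    calc _ ≤ (s⁻¹ * (s⁻¹ * (z ⬝ᵥ Q.mulVec z))) * s ^ 2 := by gcongr
      _ = _ := by field_simp

lemma diag_ge (h : IsMinim Q x) (k : Fin n) : x ⬝ᵥ Q.mulVec x ≤ Q k k := by
  have := quad_ge h (Pi.single k 1) (fun i => by
    by_cases hi : i = k
    · subst hi; simp
    · simp [hi])
  simpa using this

lemma symm_dot (hs : ∀ i j, Q i j = Q j i) (y z : Fin n → ℝ) :
    y ⬝ᵥ Q.mulVec z = z ⬝ᵥ Q.mulVec y := by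
  rw [dotProduct_mulVec, dotProduct_comm, ← mulVec_transpose]
  have : Qᵀ = Q := by ext i j; exact hs j i
  rw [this]

lemma grad_ge (hs : ∀ i j, Q i j = Q j i) (h : IsMinim Q x) (k : Fin n) :
    x ⬝ᵥ Q.mulVec x ≤ Q.mulVec x k := by
  set lam := x ⬝ᵥ Q.mulVec x with hl
  have key : ∀ s : ℝ, 0 < s → 0 ≤ 2 * (Q.mulVec x k - lam) + s * (Q k k - lam) := by
    intro s hspos
    have h1 := quad_ge h (x + s • Pi.single k 1) (fun i => by
      have := h.1.1 i
      by_cases hi : i = k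
      · subst hi; simp; linarith
      · simpa [hi] using this)
    have h2 : ∑ i, (x + s • Pi.single k 1 : Fin n → ℝ) i = 1 + s := by
      simp only [Pi.add_apply, Finset.sum_add_distrib, h.1.2]
      simp [← Finset.mul_sum]
    have h3 : (x + s • Pi.single k 1) ⬝ᵥ Q.mulVec (x + s • Pi.single k 1)
        = lam + 2 * s * Q.mulVec x k + s ^ 2 * Q k k := by
      rw [mulVec_add, add_dotProduct, dotProduct_add, dotProduct_add, mulVec_smul, dotProduct_smul,
        symm_dot hs x (Pi.single k 1)]
      simp [smul_dotProduct, dotProduct_smul]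
      ring
    rw [h2, h3, ← hl] at h1
    have : 0 ≤ s * (2 * (Q.mulVec x k - lam) + s * (Q k k - lam)) := by nlinarith
    exact nonneg_of_mul_nonneg_right this hspos
  by_contra hcon
  push Not at hcon
  have hd := diag_ge h k
  rw [← hl] at hd
  have := key ((lam - Q.mulVec x k) / (Q k k - lam + 1)) (by
    apply div_pos <;> linarith)
  have h4 : (lam - Q.mulVec x k) / (Q k k - lam + 1) * (Q k k - lam) ≤ lam - Q.mulVec x k := by
    rw [div_mul_eq_mul_div, div_le_iff₀ (by linarith)]
    nlinarith
  linarith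

lemma grad_eq (hs : ∀ i j, Q i j = Q j i) (h : IsMinim Q x) (k : Fin n) (hk : 0 < x k) :
    Q.mulVec x k = x ⬝ᵥ Q.mulVec x := by
  set lam := x ⬝ᵥ Q.mulVec x with hl
  have h0 : ∑ i, x i * (Q.mulVec x i - lam) = 0 := by
    simp only [mul_sub, Finset.sum_sub_distrib, ← Finset.sum_mul, h.1.2]
    rw [one_mul, hl]; simp [dotProduct]
  have := (Finset.sum_eq_zero_iff_of_nonneg (fun i _ =>
    mul_nonneg (h.1.1 i) (sub_nonneg.2 (grad_ge hs h i)))).1 h0 k (Finset.mem_univ _)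
  rcases mul_eq_zero.1 this with h1 | h1
  · linarith
  · linarith

lemma row_eq (hs : ∀ i j, Q i j = Q j i) (h : IsMinim Q x) (k : Fin n) (hk : 0 < x k) :
    ∑ j, (Q k j - x ⬝ᵥ Q.mulVec x) * x j = 0 := by
  have h1 := grad_eq hs h k hk
  simp only [sub_mul, Finset.sum_sub_distrib, ← Finset.mul_sum, h.1.2]
  have : ∑ j, Q k j * x j = Q.mulVec x k := rfl
  rw [this]; linarith

lemma size_one (hs : ∀ i j, Q i j = Q j i) (h : IsMinim Q x) (hc : {i | 0 < x i}.ncard = 1) :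
    ∃ i, ∀ j, j ≠ i → Q i i ≤ Q j j ∧ Q i i ≤ Q i j := by
  obtain ⟨i, hi⟩ := Set.ncard_eq_one.1 hc
  have hx0 : ∀ j, j ≠ i → x j = 0 := by
    intro j hj
    have : j ∉ {i | 0 < x i} := by rw [hi]; simpa using hj
    exact le_antisymm (not_lt.1 this) (h.1.1 j)
  have hx1 : x i = 1 := by
    rw [← h.1.2, Finset.sum_eq_single i (fun j _ hj => hx0 j hj) (by simp)]
  have hx : x = Pi.single i 1 := by
    funext j
    by_cases hj : j = i
    · subst hj; simp [hx1]
    · simp [hj, hx0 j hj]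
  have hl : x ⬝ᵥ Q.mulVec x = Q i i := by rw [hx]; simp
  refine ⟨i, fun j hj => ⟨?_, ?_⟩⟩
  · rw [← hl]; exact diag_ge h j
  · have := grad_ge hs h j
    rw [hl] at this
    rw [hs i j]
    rw [hx] at this
    simpa using this

/-- Structure at a maximal coordinate. -/
lemma size_ge_two (hs : ∀ i j, Q i j = Q j i) (h : IsMinim Q x)
    (hc : 2 ≤ {i | 0 < x i}.ncard) :
    ∃ i, 0 < x i ∧ ∃ N : Finset (Fin n), N.Nonempty ∧
      (∀ j ∈ N, j ≠ i ∧ 0 < x j ∧ Q i j ≤ x ⬝ᵥ Q.mulVec x) ∧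
      Q i i - x ⬝ᵥ Q.mulVec x ≤ ∑ j ∈ N, (x ⬝ᵥ Q.mulVec x - Q i j) := by
  classical
  set lam := x ⬝ᵥ Q.mulVec x with hl
  obtain ⟨a, b, ha, hb, hab⟩ := (Set.one_lt_ncard_iff (Set.toFinite _)).1 hc
  obtain ⟨i, -, hi⟩ := Finset.exists_max_image Finset.univ x ⟨a, Finset.mem_univ _⟩
  have hxi : 0 < x i := lt_of_lt_of_le ha (hi a (Finset.mem_univ _))
  have hrow := row_eq hs h i hxi
  rw [← hl] at hrow
  have hdiag := diag_ge h i
  rw [← hl] at hdiag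
  refine ⟨i, hxi, Finset.univ.filter (fun j => j ≠ i ∧ 0 < x j ∧ Q i j ≤ lam), ?_, ?_, ?_⟩
  · by_contra hne
    rw [Finset.not_nonempty_iff_eq_empty, Finset.filter_eq_empty_iff] at hne
    obtain ⟨c, hc0, hci⟩ : ∃ c, 0 < x c ∧ c ≠ i := by
      by_cases hai : a = i
      · exact ⟨b, hb, fun hbi => hab (hai.trans hbi.symm)⟩
      · exact ⟨a, ha, hai⟩
    have hnn : ∀ j ∈ Finset.univ, 0 ≤ (Q i j - lam) * x j := by
      intro j _
      by_cases hji : j = i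
      · subst hji; exact mul_nonneg (by linarith) hxi.le
      · rcases (h.1.1 j).eq_or_lt with h0 | h0
        · rw [← h0]; simp
        · have : ¬ Q i j ≤ lam := fun hq => hne (Finset.mem_univ j) ⟨hji, h0, hq⟩
          exact mul_nonneg (by linarith) h0.le
    have := (Finset.sum_eq_zero_iff_of_nonneg hnn).1 hrow c (Finset.mem_univ _)
    have h2 : ¬ Q i c ≤ lam := fun hq => hne (Finset.mem_univ c) ⟨hci, hc0, hq⟩
    rcases mul_eq_zero.1 this with h3 | h3 <;> linarith
  · intro j hj; simpa using hj
  · rw [← Finset.add_sum_erase _ _ (Finset.mem_univ i)] at hrow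
    have h1 : (Q i i - lam) * x i = ∑ j ∈ Finset.univ.erase i, (lam - Q i j) * x j := by
      have : ∑ j ∈ Finset.univ.erase i, (lam - Q i j) * x j
          = - ∑ j ∈ Finset.univ.erase i, (Q i j - lam) * x j := by
        rw [← Finset.sum_neg_distrib]; exact Finset.sum_congr rfl fun j _ => by ring
      rw [this]; linarith
    have h2 : ∑ j ∈ Finset.univ.erase i, (lam - Q i j) * x j ≤
        ∑ j ∈ Finset.univ.filter (fun j => j ≠ i ∧ 0 < x j ∧ Q i j ≤ lam),
          (lam - Q i j) * x i := by
      rw [← Finset.sum_filter_add_sum_filter_not (Finset.univ.erase i)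
        (fun j => 0 < x j ∧ Q i j ≤ lam)]
      have e : (Finset.univ.erase i).filter (fun j => 0 < x j ∧ Q i j ≤ lam) =
        Finset.univ.filter (fun j => j ≠ i ∧ 0 < x j ∧ Q i j ≤ lam) := by
        ext j; simp
      rw [e]
      have h3 : ∑ j ∈ (Finset.univ.erase i).filter (fun j => ¬ (0 < x j ∧ Q i j ≤ lam)),
          (lam - Q i j) * x j ≤ 0 := by
        refine Finset.sum_nonpos fun j hj => ?_
        rw [Finset.mem_filter] at hj
        rcases (h.1.1 j).eq_or_lt with h0 | h0
        · rw [← h0]; simp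
        · have : ¬ Q i j ≤ lam := fun hq => hj.2 ⟨h0, hq⟩
          exact mul_nonpos_of_nonpos_of_nonneg (by linarith) h0.le
      have h4 : ∑ j ∈ Finset.univ.filter (fun j => j ≠ i ∧ 0 < x j ∧ Q i j ≤ lam),
          (lam - Q i j) * x j ≤ ∑ j ∈ Finset.univ.filter
            (fun j => j ≠ i ∧ 0 < x j ∧ Q i j ≤ lam), (lam - Q i j) * x i := by
        refine Finset.sum_le_sum fun j hj => ?_
        rw [Finset.mem_filter] at hj
        exact mul_le_mul_of_nonneg_left (hi j (Finset.mem_univ _)) (by linarith [hj.2.2.2])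
      linarith
    rw [← Finset.sum_mul] at h2
    exact le_of_mul_le_mul_right (h1.trans_le h2) hxi

lemma size_ge_three (hs : ∀ i j, Q i j = Q j i) (h : IsMinim Q x)
    (hc : 3 ≤ {i | 0 < x i}.ncard) :
    (∃ i j k l, i ≠ j ∧ i ≠ k ∧ i ≠ l ∧ j ≠ k ∧ j ≠ l ∧ k ≠ l ∧
      Q i j ≤ x ⬝ᵥ Q.mulVec x ∧ Q i k ≤ x ⬝ᵥ Q.mulVec x ∧ Q i l ≤ x ⬝ᵥ Q.mulVec x) ∨
    (∃ i j k, i ≠ j ∧ i ≠ k ∧ j ≠ k ∧ Q i i + 2 * Q i j ≤ 3 * (x ⬝ᵥ Q.mulVec x) ∧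
      (Q i k ≤ x ⬝ᵥ Q.mulVec x ∨ Q j k ≤ x ⬝ᵥ Q.mulVec x)) := by
  classical
  obtain ⟨i, hxi, N, hN, hNp, hsum⟩ := size_ge_two hs h (by omega)
  set lam := x ⬝ᵥ Q.mulVec x with hl
  rcases Nat.lt_or_ge 2 N.card with h3 | h3
  · left
    obtain ⟨j, k, l, hj, hk, hl', hjk, hjl, hkl⟩ := Finset.two_lt_card_iff.1 h3
    exact ⟨i, j, k, l, (hNp j hj).1.symm, (hNp k hk).1.symm, (hNp l hl').1.symm, hjk, hjl, hkl,
      (hNp j hj).2.2, (hNp k hk).2.2, (hNp l hl').2.2⟩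
  right
  have hpos := hN.card_pos
  have h12 : N.card = 1 ∨ N.card = 2 := by omega
  rcases h12 with h1 | h2
  · obtain ⟨j, rfl⟩ := Finset.card_eq_one.1 h1
    have hj := hNp j (by simp)
    rw [Finset.sum_singleton] at hsum
    suffices ∃ k, i ≠ k ∧ j ≠ k ∧ (Q i k ≤ lam ∨ Q j k ≤ lam) by
      obtain ⟨k, h1, h2, h3⟩ := this
      exact ⟨i, j, k, hj.1.symm, h1, h2, by linarith [hj.2.2], h3⟩
    by_contra hcon
    push Not at hcon
    have hri := row_eq hs h i hxi
    have hrj := row_eq hs h j hj.2.1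
    rw [← hl] at hri hrj
    have hij : i ≠ j := hj.1.symm
    have hq := quad_ge h (Pi.single i (x i) + Pi.single j (x j)) (fun k => by
      by_cases h1 : k = i
      · subst h1; simp [hij, hxi.le]
      · by_cases h2 : k = j
        · subst h2; simp [Pi.single_eq_of_ne hij.symm, hj.2.1.le]
        · simp [h1, h2])
    have hq1 : ∑ k, (Pi.single i (x i) + Pi.single j (x j) : Fin n → ℝ) k = x i + x j := by
      simp [Finset.sum_add_distrib]
    have hq2 : (Pi.single i (x i) + Pi.single j (x j)) ⬝ᵥ Q.mulVec
        (Pi.single i (x i) + Pi.single j (x j)) =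
        Q i i * x i ^ 2 + 2 * Q i j * x i * x j + Q j j * x j ^ 2 := by
      simp [mulVec_add, add_dotProduct, dotProduct_add]
      rw [hs j i]; ring
    rw [hq1, hq2, ← hl] at hq
    obtain ⟨k, hk, hki, hkj⟩ : ∃ k, 0 < x k ∧ k ≠ i ∧ k ≠ j := by
      by_contra hno
      push Not at hno
      have hsub : {k | 0 < x k} ⊆ ({i, j} : Set (Fin n)) := by
        intro k hk
        by_cases hki : k = i
        · simp [hki]
        · simp [hno k hk hki]
      have := Set.ncard_le_ncard hsub
      rw [Set.ncard_pair hij] at this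
      omega
    rw [← Finset.add_sum_erase _ _ (Finset.mem_univ i),
      ← Finset.add_sum_erase _ _ (Finset.mem_erase.2 ⟨hij.symm, Finset.mem_univ j⟩)] at hri hrj
    have hpi : 0 < ∑ l ∈ (Finset.univ.erase i).erase j, (Q i l - lam) * x l := by
      refine Finset.sum_pos' (fun l hl' => ?_) ⟨k, by simp [hki, hkj], ?_⟩
      · simp only [Finset.mem_erase, Finset.mem_univ, and_true] at hl'
        exact mul_nonneg (by linarith [(hcon l hl'.2.symm hl'.1.symm).1]) (h.1.1 l)
      · exact mul_pos (by linarith [(hcon k hki.symm hkj.symm).1]) hk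
    have hpj : 0 < ∑ l ∈ (Finset.univ.erase i).erase j, (Q j l - lam) * x l := by
      refine Finset.sum_pos' (fun l hl' => ?_) ⟨k, by simp [hki, hkj], ?_⟩
      · simp only [Finset.mem_erase, Finset.mem_univ, and_true] at hl'
        exact mul_nonneg (by linarith [(hcon l hl'.2.symm hl'.1.symm).2]) (h.1.1 l)
      · exact mul_pos (by linarith [(hcon k hki.symm hkj.symm).2]) hk
    have e1 := mul_pos hxi hpi
    have e2 := mul_pos hj.2.1 hpj
    rw [hs j i] at hrj
    have f1 : x i * ((Q i i - lam) * x i + ((Q i j - lam) * x j +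
      ∑ l ∈ (Finset.univ.erase i).erase j, (Q i l - lam) * x l)) = 0 := by rw [hri]; ring
    have f2 : x j * ((Q i j - lam) * x i + ((Q j j - lam) * x j +
      ∑ l ∈ (Finset.univ.erase i).erase j, (Q j l - lam) * x l)) = 0 := by rw [hrj]; ring
    nlinarith
  · obtain ⟨j, k, hjk, rfl⟩ := Finset.card_eq_two.1 h2
    have hj := hNp j (by simp)
    have hk := hNp k (by simp)
    rw [Finset.sum_pair hjk] at hsum
    rcases le_total (Q i j) (Q i k) with hle | hle
    · exact ⟨i, j, k, hj.1.symm, hk.1.symm, hjk, by linarith, Or.inl hk.2.2⟩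
    · exact ⟨i, k, j, hk.1.symm, hj.1.symm, hjk.symm, by linarith, Or.inl hj.2.2⟩

lemma size_two (hs : ∀ i j, Q i j = Q j i) (h : IsMinim Q x)
    (hc : {i | 0 < x i}.ncard = 2) :
    ∃ i j, i ≠ j ∧ Q i j ≤ x ⬝ᵥ Q.mulVec x ∧ Q i i + Q i j ≤ 2 * (x ⬝ᵥ Q.mulVec x) ∧
      (Q i i - x ⬝ᵥ Q.mulVec x) * (Q j j - x ⬝ᵥ Q.mulVec x) = (x ⬝ᵥ Q.mulVec x - Q i j) ^ 2 := by
  classical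
  obtain ⟨i, hxi, N, hN, hNp, hsum⟩ := size_ge_two hs h (by omega)
  set lam := x ⬝ᵥ Q.mulVec x with hl
  obtain ⟨j, hjN⟩ := hN
  have hj := hNp j hjN
  have hij := hj.1.symm
  have hsupp : {k | 0 < x k} = {i, j} := by
    symm
    apply Set.eq_of_subset_of_ncard_le
    · intro k hk
      rcases hk with rfl | rfl
      · exact hxi
      · exact hj.2.1
    · rw [hc, Set.ncard_pair hij]
    · exact Set.toFinite _
  have hx0 : ∀ k, k ≠ i → k ≠ j → x k = 0 := by
    intro k h1 h2
    have : k ∉ {k | 0 < x k} := by rw [hsupp]; simp [h1, h2]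
    exact le_antisymm (not_lt.1 this) (h.1.1 k)
  have hN1 : N = {j} := by
    ext k
    simp only [Finset.mem_singleton]
    constructor
    · intro hk
      by_contra hkj
      have := hNp k hk
      have h0 := hx0 k this.1 hkj
      linarith [this.2.1]
    · rintro rfl; exact hjN
  rw [hN1, Finset.sum_singleton] at hsum
  have row : ∀ u, ∑ l, (Q u l - lam) * x l = (Q u i - lam) * x i + (Q u j - lam) * x j := by
    intro u
    rw [← Finset.sum_pair (f := fun l => (Q u l - lam) * x l) hij]
    symm
    refine Finset.sum_subset (Finset.subset_univ _) fun l _ hl' => ?_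
    simp only [Finset.mem_insert, Finset.mem_singleton, not_or] at hl'
    rw [hx0 l hl'.1 hl'.2, mul_zero]
  have hri := row_eq hs h i hxi
  have hrj := row_eq hs h j hj.2.1
  rw [← hl, row] at hri hrj
  rw [hs j i] at hrj
  refine ⟨i, j, hij, hj.2.2, by linarith, ?_⟩
  have hpp : 0 < x i * x j := mul_pos hxi hj.2.1
  have e : (x i * x j) * ((Q i i - lam) * (Q j j - lam)) = (x i * x j) * (lam - Q i j) ^ 2 := by
    have e1 : (Q i i - lam) * x i = (lam - Q i j) * x j := by linarith
    have e2 : (Q j j - lam) * x j = (lam - Q i j) * x i := by linarith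
    calc _ = ((Q i i - lam) * x i) * ((Q j j - lam) * x j) := by ring
      _ = _ := by rw [e1, e2]; ring
  exact mul_left_cancel₀ hpp.ne' e

lemma exists_min (hn : 0 < n) (Q : Matrix (Fin n) (Fin n) ℝ) : ∃ x, IsMinim Q x := by
  have hne : (stdSimplex ℝ (Fin n)).Nonempty := ⟨Pi.single ⟨0, hn⟩ 1, single_mem_stdSimplex _ _⟩
  obtain ⟨x, hx, hm⟩ := (isCompact_stdSimplex ℝ (Fin n)).exists_isMinOn hne
    (f := fun x => x ⬝ᵥ Q.mulVec x) (by
      apply Continuous.continuousOn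
      simp only [dotProduct, mulVec]
      fun_prop)
  exact ⟨x, hx, fun y hy => hm hy⟩

lemma supp_pos (h : IsMinim Q x) : 1 ≤ {i | 0 < x i}.ncard := by
  rw [Nat.one_le_iff_ne_zero, Ne, Set.ncard_eq_zero (Set.toFinite _)]
  intro he
  have h0 : ∀ i, x i = 0 := by
    intro i
    have : i ∉ {i | 0 < x i} := by rw [he]; simp
    exact le_antisymm (not_lt.1 this) (h.1.1 i)
  have := h.1.2
  simp [h0] at this

/-- Case analysis for size two minimizers; `l` is an argmin of the diagonal. -/
lemma size_two_cases (hs : ∀ i j, Q i j = Q j i) (h : IsMinim Q x)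
    (hc : {i | 0 < x i}.ncard = 2) (m : ℝ) (hm : 1 ≤ m) (hmin : ∃ k, Q k k < -m) :
    (∃ i j, i ≠ j ∧ (∀ k, Q i i ≤ Q k k) ∧ Q i j ≤ Q i i) ∨
    (∃ i j, i ≠ j ∧ Q i j ≤ -m ∧ Q i i + Q i j ≤ - 2 * m ∧ Q j j ≤ - m / 2) ∨
    (∃ i j, i ≠ j ∧ Q i j ≤ -m - 1 / √(m + 1) ∧ Q i i + Q i j ≤ - 2 * m) ∨
    (∃ l i j, l ≠ i ∧ l ≠ j ∧ i ≠ j ∧ (∀ k, Q l l ≤ Q k k) ∧ Q l l ≤ -m ∧ Q i j ≤ Q l l ∧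
      Q i i ≤ Q l l + 2 / Q l l ^ 2) := by
  obtain ⟨i, j, hij, hcl, hac, hdet⟩ := size_two hs h hc
  have hdiag := diag_ge h
  set lam := x ⬝ᵥ Q.mulVec x with hlam
  obtain ⟨l, -, hl⟩ := Finset.exists_min_image Finset.univ (fun k => Q k k) ⟨i, Finset.mem_univ _⟩
  have hl' : ∀ k, Q l l ≤ Q k k := fun k => hl k (Finset.mem_univ _)
  by_cases hli : l = i
  · subst hli
    exact Or.inl ⟨l, j, hij, hl', hcl.trans (hdiag l)⟩
  by_cases hlj : l = j
  · subst hlj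
    exact Or.inl ⟨l, i, hij.symm, hl', by rw [hs l i]; exact hcl.trans (hdiag l)⟩
  right
  have htm : Q l l ≤ -m := by
    obtain ⟨k, hk⟩ := hmin
    linarith [hl' k]
  have hlt := hdiag l
  have ha := hl' i
  have hb := hl' j
  have hal := hdiag i
  have hbl := hdiag j
  set t := Q l l
  set a := Q i i
  set b := Q j j
  set c := Q i j
  by_cases hb2 : b ≤ -m / 2
  · left
    exact ⟨i, j, hij, by linarith, by linarith, hb2⟩
  right
  push Not at hb2
  by_cases hc2 : c ≤ -m - 1 / √(m + 1)
  · left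
    exact ⟨i, j, hij, hc2, by linarith⟩
  right
  push Not at hc2
  refine ⟨l, i, j, hli, hlj, hij, hl', htm, by linarith, ?_⟩
  have hdet2 : (a - t) * (b - t) ≤ (t - c) ^ 2 := by nlinarith
  have hsq : 1 ≤ √(m + 1) := by rw [Real.one_le_sqrt]; linarith
  have hsq2 : √(m + 1) ^ 2 = m + 1 := Real.sq_sqrt (by linarith)
  have hw1 : 1 / √(m + 1) ≤ 1 := by rw [div_le_one (by linarith)]; exact hsq
  have hw0 : 0 < 1 / √(m + 1) := by positivity
  have hw2 : (1 / √(m + 1)) ^ 2 = 1 / (m + 1) := by rw [div_pow, hsq2, one_pow]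
  have hT : -t < m + 1 := by
    by_contra hcon
    push Not at hcon
    linarith
  have h1 : (t - c) ^ 2 ≤ 1 / (m + 1) := by
    rw [← hw2]
    exact pow_le_pow_left₀ (by linarith) (by linarith) 2
  have h2 : 1 / (m + 1) ≤ 1 / (-t) := one_div_le_one_div_of_le (by linarith) hT.le
  have h3 : (a - t) * (-t / 2) ≤ (a - t) * (b - t) :=
    mul_le_mul_of_nonneg_left (by linarith) (by linarith)
  have h4 : (a - t) * (-t / 2) ≤ 1 / (-t) := by linarith
  have hTpos : 0 < -t := by linarith
  rw [le_div_iff₀ hTpos] at h4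
  have h5 : a - t ≤ 2 / t ^ 2 := by
    rw [le_div_iff₀ (by nlinarith)]
    nlinarith
  linarith

end Deterministic
end GoeAux

namespace GoeAux
open Set Topology
open scoped NNReal ENNReal

/-- index type for off-diagonal coordinates -/
abbrev Pr (n : ℕ) := {p : Fin n × Fin n // p.1 < p.2}

/-- product Gaussian measure on coordinates -/
noncomputable def mu (n : ℕ) : Measure ((Fin n → ℝ) × (Pr n → ℝ)) :=
  (Measure.pi fun _ : Fin n => gaussianReal 0 1).prod
      (Measure.pi fun _ : Pr n => gaussianReal 0 (1 / 2))

instance (n : ℕ) : IsProbabilityMeasure (mu n) := by unfold mu; infer_instance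

/-- unordered pair index -/
def pr {n : ℕ} (i j : Fin n) (h : i ≠ j) : Pr n :=
  if h' : i < j then ⟨(i, j), h'⟩ else ⟨(j, i), lt_of_le_of_ne (not_lt.mp h') (Ne.symm h)⟩

lemma pr_spec {n : ℕ} (i j : Fin n) (h : i ≠ j) :
    (pr i j h).1 = (i, j) ∨ (pr i j h).1 = (j, i) := by
  unfold pr; split_ifs <;> simp

lemma pr_ne_left {n : ℕ} {i j k : Fin n} (h : i ≠ j) (h' : i ≠ k) (hjk : j ≠ k) :
    pr i j h ≠ pr i k h' := by
  intro he
  have he' := congrArg Subtype.val he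
  rcases pr_spec i j h with h1 | h1 <;> rcases pr_spec i k h' with h2 | h2 <;>
    rw [h1, h2] at he' <;> simp only [Prod.mk.injEq] at he'
  · exact hjk he'.2
  · exact h' he'.1
  · exact h he'.1.symm
  · exact hjk he'.1

lemma pr_comm {n : ℕ} {i j : Fin n} (h : i ≠ j) : pr i j h = pr j i h.symm := by
  unfold pr
  rcases lt_trichotomy i j with h1 | h1 | h1
  · simp [h1, h1.le.not_gt]
  · exact absurd h1 h
  · simp [h1, h1.le.not_gt]

lemma pr_ne_right {n : ℕ} {i j k : Fin n} (h : i ≠ j) (h' : j ≠ k) (hik : i ≠ k) :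
    pr i j h ≠ pr j k h' := by
  rw [pr_comm h]; exact pr_ne_left _ _ hik

lemma goe_diag {n : ℕ} (d : Fin n → ℝ) (o : Pr n → ℝ) (i : Fin n) :
    goeMatrix n d o i i = d i := by simp [goeMatrix]

lemma goe_off {n : ℕ} (d : Fin n → ℝ) (o : Pr n → ℝ) (i j : Fin n) (h : i ≠ j) :
    goeMatrix n d o i j = o (pr i j h) := by
  unfold goeMatrix pr
  simp only [dif_neg h]
  split_ifs <;> rfl

lemma goe_symm {n : ℕ} (d : Fin n → ℝ) (o : Pr n → ℝ) (i j : Fin n) :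
    goeMatrix n d o i j = goeMatrix n d o j i := by
  by_cases h : i = j
  · subst h; rfl
  · rw [goe_off d o i j h, goe_off d o j i (Ne.symm h), pr_comm h]

lemma goe_measurable (n : ℕ) : Measurable
    (fun dq : (Fin n → ℝ) × (Pr n → ℝ) => goeMatrix n dq.1 dq.2) := by
  refine measurable_pi_iff.2 fun i => measurable_pi_iff.2 fun j => ?_
  by_cases h : i = j
  · subst h
    simp only [goe_diag]
    fun_prop
  · simp only [goe_off _ _ i j h]
    fun_prop

lemma goe_embedding (n : ℕ) : MeasurableEmbedding
    (fun dq : (Fin n → ℝ) × (Pr n → ℝ) => goeMatrix n dq.1 dq.2) := by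
  set g : Matrix (Fin n) (Fin n) ℝ → (Fin n → ℝ) × (Pr n → ℝ) :=
    fun Q => (fun i => Q i i, fun p => Q p.1.1 p.1.2) with hg
  have hent : ∀ i j, Measurable (fun Q : Matrix (Fin n) (Fin n) ℝ => Q i j) := by
    intro i j
    exact (measurable_pi_apply j).comp (measurable_pi_apply (X := fun _ : Fin n => Fin n → ℝ) i)
  have hgm : Measurable g := by
    refine Measurable.prodMk ?_ ?_
    · exact measurable_pi_iff.2 fun i => hent i i
    · exact measurable_pi_iff.2 fun p => hent _ _
  have hinv : ∀ ω : (Fin n → ℝ) × (Pr n → ℝ), g (goeMatrix n ω.1 ω.2) = ω := by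
    rintro ⟨d, o⟩
    refine Prod.ext ?_ ?_
    · funext i; exact goe_diag d o i
    · funext p
      change goeMatrix n d o p.1.1 p.1.2 = o p
      rw [goe_off d o _ _ p.2.ne]
      congr 1
      unfold pr
      rw [dif_pos p.2]
  refine MeasurableEmbedding.of_measurable_inverse (goe_measurable n) ?_ hgm hinv
  have : range (fun dq : (Fin n → ℝ) × (Pr n → ℝ) => goeMatrix n dq.1 dq.2) =
      ⋂ i, ⋂ j, {Q : Matrix (Fin n) (Fin n) ℝ | Q i j = Q j i} := by
    ext Q
    simp only [mem_range, mem_iInter, mem_ofPred_eq]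
    constructor
    · rintro ⟨ω, rfl⟩ i j
      exact goe_symm _ _ i j
    · intro hQ
      refine ⟨g Q, ?_⟩
      ext i j
      by_cases h : i = j
      · subst h; rw [goe_diag]
      · rw [goe_off _ _ i j h]
        change Q (pr i j h).1.1 (pr i j h).1.2 = Q i j
        rcases pr_spec i j h with h1 | h1 <;> rw [h1]
        exact hQ _ _
  rw [this]
  exact MeasurableSet.iInter fun i => MeasurableSet.iInter fun j =>
    measurableSet_eq_fun (hent i j) (hent j i)

lemma goeMeasure_apply (n : ℕ) (s : Set (Matrix (Fin n) (Fin n) ℝ)) :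
    goeMeasure n s = mu n {ω | goeMatrix n ω.1 ω.2 ∈ s} :=
  (goe_embedding n).map_apply _ _

/-- Chernoff bound for linear forms of the coordinates. -/
lemma chernoff (n : ℕ) (θ : Fin n → ℝ) (η : Pr n → ℝ) (r : ℝ) :
    (mu n).real {ω | ∑ i, θ i * ω.1 i + ∑ p, η p * ω.2 p ≤ -r} ≤
      Real.exp (-r + (∑ i, θ i ^ 2) / 2 + (∑ p, η p ^ 2) / 4) := by
  have hfac : ∀ ω : (Fin n → ℝ) × (Pr n → ℝ),
      Real.exp (-1 * (∑ i, θ i * ω.1 i + ∑ p, η p * ω.2 p)) =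
      (∏ i, Real.exp (-θ i * ω.1 i)) * ∏ p, Real.exp (-η p * ω.2 p) := by
    intro ω
    rw [← Real.exp_sum, ← Real.exp_sum, ← Real.exp_add]
    congr 1
    simp only [neg_mul, Finset.sum_neg_distrib]
    ring
  have h_intg : Integrable (fun ω : (Fin n → ℝ) × (Pr n → ℝ) =>
      Real.exp (-1 * (∑ i, θ i * ω.1 i + ∑ p, η p * ω.2 p))) (mu n) := by
    simp only [hfac]
    unfold mu
    refine Integrable.mul_prod (f := fun d : Fin n → ℝ => ∏ i, Real.exp (-θ i * d i))
      (g := fun o : Pr n → ℝ => ∏ p, Real.exp (-η p * o p)) ?_ ?_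
    · exact Integrable.fintype_prod (f := fun i x => Real.exp (-θ i * x))
        (fun i => integrable_exp_mul_gaussianReal _)
    · exact Integrable.fintype_prod (f := fun i x => Real.exp (-η i * x))
        (fun i => integrable_exp_mul_gaussianReal _)
  have h := measure_le_le_exp_mul_mgf (μ := mu n)
    (X := fun ω => ∑ i, θ i * ω.1 i + ∑ p, η p * ω.2 p) (-r) (t := -1) (by norm_num) h_intg
  refine h.trans (le_of_eq ?_)
  have hm : mgf (fun ω : (Fin n → ℝ) × (Pr n → ℝ) => ∑ i, θ i * ω.1 i + ∑ p, η p * ω.2 p)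
      (mu n) (-1) = Real.exp ((∑ i, θ i ^ 2) / 2 + (∑ p, η p ^ 2) / 4) := by
    unfold mgf
    simp only [hfac]
    unfold mu
    rw [integral_prod_mul (fun d : Fin n → ℝ => ∏ i, Real.exp (-θ i * d i))
      (fun o : Pr n → ℝ => ∏ p, Real.exp (-η p * o p)),
      integral_fintype_prod_eq_prod (fun i x => Real.exp (-θ i * x)),
      integral_fintype_prod_eq_prod (fun i x => Real.exp (-η i * x))]
    have hg : ∀ (v : ℝ≥0) (a : ℝ), ∫ x, Real.exp (a * x) ∂(gaussianReal 0 v) =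
        Real.exp (v * a ^ 2 / 2) := by
      intro v a
      have := congrFun (mgf_id_gaussianReal (μ := 0) (v := v)) a
      simpa [mgf] using this
    simp only [hg]
    rw [← Real.exp_sum, ← Real.exp_sum, ← Real.exp_add]
    congr 1
    rw [Finset.sum_div, Finset.sum_div]
    congr 1
    · exact Finset.sum_congr rfl fun i _ => by simp
    · exact Finset.sum_congr rfl fun i _ => by simp; ring
  rw [hm, ← Real.exp_add]
  congr 1
  ring

lemma box (n : ℕ) (i : Fin (n + 1)) (R : Set ℝ) (hR : MeasurableSet R)
    (S : ℝ → Fin n → Set ℝ) (T : ℝ → Pr (n + 1) → Set ℝ)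
    (hmeas : MeasurableSet {ω : (Fin (n + 1) → ℝ) × (Pr (n + 1) → ℝ) | ω.1 i ∈ R ∧
      (∀ k, ω.1 (i.succAbove k) ∈ S (ω.1 i) k) ∧ ∀ p, ω.2 p ∈ T (ω.1 i) p})
    (g : ℝ → ℝ) (hg0 : ∀ t, 0 ≤ g t) (hgi : IntegrableOn g R (gaussianReal 0 1))
    (hle : ∀ t ∈ R, (∏ k, (gaussianReal 0 1).real (S t k)) *
      (∏ p, (gaussianReal 0 (1 / 2)).real (T t p)) ≤ g t) :
    (mu (n + 1)).real {ω | ω.1 i ∈ R ∧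
      (∀ k, ω.1 (i.succAbove k) ∈ S (ω.1 i) k) ∧ ∀ p, ω.2 p ∈ T (ω.1 i) p} ≤
      ∫ t in R, g t ∂(gaussianReal 0 1) := by
  set E := {ω : (Fin (n + 1) → ℝ) × (Pr (n + 1) → ℝ) | ω.1 i ∈ R ∧
      (∀ k, ω.1 (i.succAbove k) ∈ S (ω.1 i) k) ∧ ∀ p, ω.2 p ∈ T (ω.1 i) p} with hE
  have mp1 := (measurePreserving_piFinSuccAbove (fun _ : Fin (n + 1) => gaussianReal 0 1) i).symm
  have mp2 := mp1.prod (MeasurePreserving.id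
    (Measure.pi fun _ : Pr (n + 1) => gaussianReal 0 (1 / 2)))
  have mp3 := (measurePreserving_prodAssoc (gaussianReal 0 1)
    (Measure.pi fun _ : Fin n => gaussianReal 0 1)
    (Measure.pi fun _ : Pr (n + 1) => gaussianReal 0 (1 / 2))).symm
  have mp := mp2.comp mp3
  have h1 : mu (n + 1) E = _ := (mp.measure_preimage hmeas.nullMeasurableSet).symm
  have hm2 := mp.measurable hmeas
  rw [Measure.prod_apply hm2] at h1
  have h2 : mu (n + 1) E ≤ ENNReal.ofReal (∫ t in R, g t ∂(gaussianReal 0 1)) := by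
    rw [h1, ofReal_integral_eq_lintegral_ofReal hgi (Eventually.of_forall hg0),
      ← lintegral_indicator hR]
    refine lintegral_mono fun t => ?_
    by_cases ht : t ∈ R
    · rw [indicator_of_mem ht]
      have hsub : (Prod.mk t ⁻¹' ((Prod.map (MeasurableEquiv.piFinSuccAbove (fun _ => ℝ) i).symm id ∘
          MeasurableEquiv.prodAssoc.symm) ⁻¹' E)) ⊆
          (Set.univ.pi (S t)) ×ˢ (Set.univ.pi (T t)) := by
        rintro ⟨y, o⟩ hy
        simp only [mem_preimage] at hy
        have hy' : ((i.insertNth t y : Fin (n + 1) → ℝ), o) ∈ E := hy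
        simp only [hE, mem_ofPred_eq, Fin.insertNth_apply_same, Fin.insertNth_apply_succAbove] at hy'
        exact ⟨fun k _ => hy'.2.1 k, fun p _ => hy'.2.2 p⟩
      refine (measure_mono hsub).trans ?_
      rw [Measure.prod_prod, Measure.pi_pi, Measure.pi_pi]
      refine le_trans (le_of_eq ?_) (ENNReal.ofReal_le_ofReal (hle t ht))
      rw [ENNReal.ofReal_mul (Finset.prod_nonneg fun k _ => measureReal_nonneg),
        ENNReal.ofReal_prod_of_nonneg (fun k _ => measureReal_nonneg),
        ENNReal.ofReal_prod_of_nonneg (fun k _ => measureReal_nonneg)]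
      congr 1 <;> exact Finset.prod_congr rfl fun k _ => (ofReal_measureReal (measure_ne_top _ _)).symm
    · have hempty : (Prod.mk t ⁻¹' ((Prod.map (MeasurableEquiv.piFinSuccAbove (fun _ => ℝ) i).symm
          id ∘ MeasurableEquiv.prodAssoc.symm) ⁻¹' E)) ⊆ ∅ := by
        rintro ⟨y, o⟩ hy
        have hy' : ((i.insertNth t y : Fin (n + 1) → ℝ), o) ∈ E := hy
        simp only [hE, mem_ofPred_eq, Fin.insertNth_apply_same] at hy'
        exact ht hy'.1
      refine (measure_mono hempty).trans ?_
      simp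
  rw [measureReal_def]
  exact ENNReal.toReal_le_of_le_ofReal (setIntegral_nonneg hR fun t _ => hg0 t) h2

end GoeAux

namespace GoeAux
open Set Topology
open scoped NNReal ENNReal

lemma union_bound {α ι : Type*} [MeasurableSpace α] [Fintype ι] (μ : Measure α)
    [IsProbabilityMeasure μ] (A : ι → Set α) (b : ℝ) (h : ∀ i, μ.real (A i) ≤ b) :
    μ.real {ω | ∃ i, ω ∈ A i} ≤ Fintype.card ι * b := by
  have : {ω | ∃ i, ω ∈ A i} = ⋃ i, A i := by ext; simp
  rw [this]
  refine (measureReal_iUnion_fintype_le A).trans ?_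
  refine (Finset.sum_le_sum fun i _ => h i).trans ?_
  simp

lemma sum_single_mul {ι : Type*} [Fintype ι] [DecidableEq ι] (i : ι) (a : ℝ) (f : ι → ℝ) :
    ∑ k, (if k = i then a else 0) * f k = a * f i := by simp

lemma two_lin {ι : Type*} [Fintype ι] [DecidableEq ι] (i j : ι) (a b : ℝ) (f : ι → ℝ) :
    ∑ k, ((if k = i then a else 0) + (if k = j then b else 0)) * f k = a * f i + b * f j := by
  simp [add_mul, Finset.sum_add_distrib]

lemma two_sq {ι : Type*} [Fintype ι] [DecidableEq ι] (i j : ι) (hij : i ≠ j) (a b : ℝ) :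
    ∑ k, ((if k = i then a else 0) + (if k = j then b else 0)) ^ 2 = a ^ 2 + b ^ 2 := by
  simp_rw [pow_two]
  rw [two_lin]
  simp [hij, hij.symm]

lemma three_lin {ι : Type*} [Fintype ι] [DecidableEq ι] (i j l : ι) (a b c : ℝ) (f : ι → ℝ) :
    ∑ k, ((if k = i then a else 0) + (if k = j then b else 0) + (if k = l then c else 0)) * f k
      = a * f i + b * f j + c * f l := by
  simp [add_mul, Finset.sum_add_distrib]

lemma three_sq {ι : Type*} [Fintype ι] [DecidableEq ι] (i j l : ι) (hij : i ≠ j) (hil : i ≠ l)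
    (hjl : j ≠ l) (a b c : ℝ) :
    ∑ k, ((if k = i then a else 0) + (if k = j then b else 0) + (if k = l then c else 0)) ^ 2
      = a ^ 2 + b ^ 2 + c ^ 2 := by
  simp_rw [pow_two]
  rw [three_lin]
  simp [hij, hij.symm, hil, hil.symm, hjl, hjl.symm]

lemma chernA {n : ℕ} (i j : Fin n) (hij : i ≠ j) (α β : ℝ) (p : Pr n) (κ r : ℝ) :
    (mu n).real {ω | α * ω.1 i + β * ω.1 j + κ * ω.2 p ≤ -r} ≤
      Real.exp (-r + (α ^ 2 + β ^ 2) / 2 + κ ^ 2 / 4) := by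
  have := chernoff n (fun k => (if k = i then α else 0) + (if k = j then β else 0))
    (fun k => if k = p then κ else 0) r
  simp only [two_lin, two_sq i j hij, sum_single_mul] at this
  simpa using this

lemma chernB {n : ℕ} (i : Fin n) (α : ℝ) (p q : Pr n) (hpq : p ≠ q) (κ κ' r : ℝ) :
    (mu n).real {ω | α * ω.1 i + (κ * ω.2 p + κ' * ω.2 q) ≤ -r} ≤
      Real.exp (-r + α ^ 2 / 2 + (κ ^ 2 + κ' ^ 2) / 4) := by
  have := chernoff n (fun k => if k = i then α else 0)
    (fun k => (if k = p then κ else 0) + (if k = q then κ' else 0)) r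
  simp only [two_lin, two_sq p q hpq, sum_single_mul] at this
  simpa using this

lemma chernC {n : ℕ} (p q s : Pr n) (hpq : p ≠ q) (hps : p ≠ s) (hqs : q ≠ s) (a b c r : ℝ) :
    (mu n).real {ω | a * ω.2 p + b * ω.2 q + c * ω.2 s ≤ -r} ≤
      Real.exp (-r + (a ^ 2 + b ^ 2 + c ^ 2) / 4) := by
  have := chernoff n (fun k => 0)
    (fun k => (if k = p then a else 0) + (if k = q then b else 0) + (if k = s then c else 0)) r
  simp only [three_lin, three_sq p q s hpq hps hqs] at this
  simpa using this

lemma real_Ici {v : ℝ≥0} (hv : v ≠ 0) (t : ℝ) : (gaussianReal 0 v).real (Ici t) = 1 - gcdf v t := by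
  have : NullSingletonClass (gaussianReal 0 v) := nullSingletonClass_gaussianReal hv
  rw [← compl_Iio, probReal_compl_eq_one_sub measurableSet_Iio, gcdf,
    measureReal_congr Iio_ae_eq_Iic]

section
variable {n : ℕ}

lemma bound_P4 (m : ℝ) : (mu n).real {ω | ∀ k, -m ≤ goeMatrix n ω.1 ω.2 k k} ≤
    (1 - gcdf 1 (-m)) ^ n := by
  have : {ω : (Fin n → ℝ) × (Pr n → ℝ) | ∀ k, -m ≤ goeMatrix n ω.1 ω.2 k k} =
      (Set.univ.pi fun _ => Ici (-m)) ×ˢ Set.univ := by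
    ext ω; simp [goe_diag, Pi.le_def]
  rw [this, measureReal_def, mu, Measure.prod_prod, Measure.pi_pi]
  simp only [measure_univ, mul_one, Finset.prod_const, ENNReal.toReal_pow, Finset.card_univ,
    Fintype.card_fin]
  rw [← measureReal_def, real_Ici one_ne_zero]

lemma bound_F1 (m : ℝ) (hm : 0 ≤ m) : (mu n).real {ω | ∃ i j k l, i ≠ j ∧ i ≠ k ∧ i ≠ l ∧ j ≠ k ∧
    j ≠ l ∧ k ≠ l ∧ goeMatrix n ω.1 ω.2 i j ≤ -m ∧ goeMatrix n ω.1 ω.2 i k ≤ -m ∧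
    goeMatrix n ω.1 ω.2 i l ≤ -m} ≤ (n:ℝ) ^ 4 * Real.exp (- 3 * m ^ 2) := by
  have h := union_bound (mu n) (ι := Fin n × Fin n × Fin n × Fin n) (fun x => {ω |
    x.1 ≠ x.2.1 ∧ x.1 ≠ x.2.2.1 ∧ x.1 ≠ x.2.2.2 ∧ x.2.1 ≠ x.2.2.1 ∧
    x.2.1 ≠ x.2.2.2 ∧ x.2.2.1 ≠ x.2.2.2 ∧ goeMatrix n ω.1 ω.2 x.1 x.2.1 ≤ -m ∧
    goeMatrix n ω.1 ω.2 x.1 x.2.2.1 ≤ -m ∧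
    goeMatrix n ω.1 ω.2 x.1 x.2.2.2 ≤ -m}) (Real.exp (- 3 * m ^ 2)) ?_
  · refine (measureReal_mono ?_).trans (h.trans (le_of_eq ?_))
    · rintro ω ⟨i, j, k, l, h⟩
      exact ⟨(i, j, k, l), h⟩
    · simp; ring
  · rintro ⟨i, j, k, l⟩
    by_cases hd : i ≠ j ∧ i ≠ k ∧ i ≠ l ∧ j ≠ k ∧ j ≠ l ∧ k ≠ l
    · obtain ⟨h1, h2, h3, h4, h5, h6⟩ := hd
      refine (measureReal_mono ?_).trans ((chernC (pr i j h1) (pr i k h2) (pr i l h3)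
        (pr_ne_left _ _ h4) (pr_ne_left _ _ h5) (pr_ne_left _ _ h6)
        (2 * m) (2 * m) (2 * m) (6 * m ^ 2)).trans (le_of_eq ?_))
      · rintro ω ⟨-, -, -, -, -, -, a, b, c⟩
        rw [goe_off _ _ _ _ h1] at a
        rw [goe_off _ _ _ _ h2] at b
        rw [goe_off _ _ _ _ h3] at c
        simp only [mem_ofPred_eq]
        nlinarith
      · congr 1; ring
    · have : {ω : (Fin n → ℝ) × (Pr n → ℝ) | i ≠ j ∧ i ≠ k ∧ i ≠ l ∧ j ≠ k ∧
        j ≠ l ∧ k ≠ l ∧ goeMatrix n ω.1 ω.2 i j ≤ -m ∧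
        goeMatrix n ω.1 ω.2 i k ≤ -m ∧ goeMatrix n ω.1 ω.2 i l ≤ -m} ⊆ ∅ := by
        rintro ω ⟨h1, h2, h3, h4, h5, h6, -⟩
        exact hd ⟨h1, h2, h3, h4, h5, h6⟩
      refine (measureReal_mono this).trans ?_
      simp [Real.exp_nonneg]

lemma bound_F2a (m : ℝ) (hm : 0 ≤ m) : (mu n).real {ω | ∃ i j k, i ≠ j ∧ i ≠ k ∧ j ≠ k ∧
    goeMatrix n ω.1 ω.2 i i + 2 * goeMatrix n ω.1 ω.2 i j ≤ - 3 * m ∧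
    (goeMatrix n ω.1 ω.2 i k ≤ -m ∨ goeMatrix n ω.1 ω.2 j k ≤ -m)} ≤
      (n:ℝ) ^ 3 * (2 * Real.exp (- (5 / 2) * m ^ 2)) := by
  have h := union_bound (mu n) (ι := Fin n × Fin n × Fin n) (fun x => {ω |
    x.1 ≠ x.2.1 ∧ x.1 ≠ x.2.2 ∧ x.2.1 ≠ x.2.2 ∧
    goeMatrix n ω.1 ω.2 x.1 x.1 + 2 * goeMatrix n ω.1 ω.2 x.1 x.2.1 ≤ - 3 * m ∧
    (goeMatrix n ω.1 ω.2 x.1 x.2.2 ≤ -m ∨ goeMatrix n ω.1 ω.2 x.2.1 x.2.2 ≤ -m)})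
    (2 * Real.exp (- (5 / 2) * m ^ 2)) ?_
  · refine (measureReal_mono ?_).trans (h.trans (le_of_eq ?_))
    · rintro ω ⟨i, j, k, h⟩
      exact ⟨(i, j, k), h⟩
    · simp; ring
  · rintro ⟨i, j, k⟩
    by_cases hd : i ≠ j ∧ i ≠ k ∧ j ≠ k
    · obtain ⟨h1, h2, h3⟩ := hd
      have e1 := chernB i m (pr i j h1) (pr i k h2) (pr_ne_left _ _ h3) (2 * m) (2 * m) (5 * m ^ 2)
      have e2 := chernB i m (pr i j h1) (pr j k h3) (pr_ne_right _ _ h2) (2 * m) (2 * m) (5 * m ^ 2)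
      have e3 : -(5 * m ^ 2) + m ^ 2 / 2 + ((2 * m) ^ 2 + (2 * m) ^ 2) / 4 = - (5 / 2) * m ^ 2 := by
        ring
      rw [e3] at e1 e2
      refine (measureReal_mono ?_).trans ((measureReal_union_le _ _).trans
        ((add_le_add e1 e2).trans (le_of_eq (by ring))))
      rintro ω ⟨-, -, -, a, b⟩
      rw [goe_off _ _ _ _ h1, goe_diag] at a
      rw [goe_off _ _ _ _ h2, goe_off _ _ _ _ h3] at b
      rcases b with b | b
      · left; simp only [mem_ofPred_eq]; nlinarith
      · right; simp only [mem_ofPred_eq]; nlinarith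
    · have : {ω : (Fin n → ℝ) × (Pr n → ℝ) | i ≠ j ∧ i ≠ k ∧ j ≠ k ∧
        goeMatrix n ω.1 ω.2 i i + 2 * goeMatrix n ω.1 ω.2 i j ≤ - 3 * m ∧
        (goeMatrix n ω.1 ω.2 i k ≤ -m ∨ goeMatrix n ω.1 ω.2 j k ≤ -m)} ⊆ ∅ := by
        rintro ω ⟨h1, h2, h3, -⟩
        exact hd ⟨h1, h2, h3⟩
      refine (measureReal_mono this).trans ?_
      simp [Real.exp_nonneg]

lemma bound_G1 (m : ℝ) (hm : 0 ≤ m) : (mu n).real {ω | ∃ i j, i ≠ j ∧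
    goeMatrix n ω.1 ω.2 i j ≤ -m ∧
    goeMatrix n ω.1 ω.2 i i + goeMatrix n ω.1 ω.2 i j ≤ - 2 * m ∧
    goeMatrix n ω.1 ω.2 j j ≤ -m / 2} ≤
      (n:ℝ) ^ 2 * (Real.exp (- (13 / 8) * m ^ 2)) := by
  have h := union_bound (mu n) (ι := Fin n × Fin n) (fun x => {ω |
    x.1 ≠ x.2 ∧ goeMatrix n ω.1 ω.2 x.1 x.2 ≤ -m ∧
    goeMatrix n ω.1 ω.2 x.1 x.1 + goeMatrix n ω.1 ω.2 x.1 x.2 ≤ - 2 * m ∧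
    goeMatrix n ω.1 ω.2 x.2 x.2 ≤ -m / 2})
    (Real.exp (- (13 / 8) * m ^ 2)) ?_
  · refine (measureReal_mono ?_).trans (h.trans (le_of_eq ?_))
    · rintro ω ⟨i, j, h⟩
      exact ⟨(i, j), h⟩
    · simp; ring
  · rintro ⟨i, j⟩
    by_cases h1 : i ≠ j
    · refine (measureReal_mono ?_).trans ((chernA i j h1 m (m / 2) (pr i j h1) (2 * m)
        (13 / 4 * m ^ 2)).trans (le_of_eq ?_))
      · rintro ω ⟨-, a, b, c⟩
        simp only [goe_off _ _ _ _ h1, goe_diag] at a b c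
        simp only [mem_ofPred_eq]
        nlinarith
      · congr 1; ring
    · have : {ω : (Fin n → ℝ) × (Pr n → ℝ) | i ≠ j ∧
        goeMatrix n ω.1 ω.2 i j ≤ -m ∧
        goeMatrix n ω.1 ω.2 i i + goeMatrix n ω.1 ω.2 i j ≤ - 2 * m ∧
        goeMatrix n ω.1 ω.2 j j ≤ -m / 2} ⊆ ∅ := by
        rintro ω ⟨h, -⟩
        exact h1 h
      refine (measureReal_mono this).trans ?_
      simp [Real.exp_nonneg]

lemma bound_G2 (m w : ℝ) (hm : 0 ≤ m) : (mu n).real {ω | ∃ i j, i ≠ j ∧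
    goeMatrix n ω.1 ω.2 i j ≤ -m - w ∧
    goeMatrix n ω.1 ω.2 i i + goeMatrix n ω.1 ω.2 i j ≤ - 2 * m} ≤
      (n:ℝ) ^ 2 * (Real.exp (- (3 / 2) * m ^ 2 - m * w)) := by
  have h := union_bound (mu n) (ι := Fin n × Fin n) (fun x => {ω |
    x.1 ≠ x.2 ∧ goeMatrix n ω.1 ω.2 x.1 x.2 ≤ -m - w ∧
    goeMatrix n ω.1 ω.2 x.1 x.1 + goeMatrix n ω.1 ω.2 x.1 x.2 ≤ - 2 * m})
    (Real.exp (- (3 / 2) * m ^ 2 - m * w)) ?_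
  · refine (measureReal_mono ?_).trans (h.trans (le_of_eq ?_))
    · rintro ω ⟨i, j, h⟩
      exact ⟨(i, j), h⟩
    · simp; ring
  · rintro ⟨i, j⟩
    by_cases h1 : i ≠ j
    · refine (measureReal_mono ?_).trans ((chernA i j h1 m 0 (pr i j h1) (2 * m)
        (3 * m ^ 2 + m * w)).trans (le_of_eq ?_))
      · rintro ω ⟨-, a, b⟩
        simp only [goe_off _ _ _ _ h1, goe_diag] at a b
        simp only [mem_ofPred_eq]
        nlinarith
      · congr 1; ring
    · have : {ω : (Fin n → ℝ) × (Pr n → ℝ) | i ≠ j ∧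
        goeMatrix n ω.1 ω.2 i j ≤ -m - w ∧
        goeMatrix n ω.1 ω.2 i i + goeMatrix n ω.1 ω.2 i j ≤ - 2 * m} ⊆ ∅ := by
        rintro ω ⟨h, -⟩
        exact h1 h
      refine (measureReal_mono this).trans ?_
      simp [Real.exp_nonneg]

/-- support at least three is unlikely -/
lemma bound_three (m : ℝ) (hm : 0 ≤ m) : (mu n).real {ω | ∃ x, IsMinim (goeMatrix n ω.1 ω.2) x ∧
    3 ≤ {i | 0 < x i}.ncard} ≤ (1 - gcdf 1 (-m)) ^ n + ((n:ℝ) ^ 4 * Real.exp (- 3 * m ^ 2) +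
      (n:ℝ) ^ 3 * (2 * Real.exp (- (5 / 2) * m ^ 2))) := by
  refine (measureReal_mono ?_).trans ((measureReal_union_le _ _).trans
    (add_le_add (bound_P4 m) ((measureReal_union_le _ _).trans
      (add_le_add (bound_F1 m hm) (bound_F2a m hm)))))
  rintro ω ⟨x, hx, hc⟩
  by_cases h0 : ∀ k, -m ≤ goeMatrix n ω.1 ω.2 k k
  · left; exact h0
  right
  push Not at h0
  obtain ⟨k, hk⟩ := h0
  have hlam := diag_ge hx k
  rcases size_ge_three (goe_symm ω.1 ω.2) hx hc with
    ⟨i, j, k, l, h1, h2, h3, h4, h5, h6, a, b, c⟩ | ⟨i, j, k, h1, h2, h3, a, b⟩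
  · left
    exact ⟨i, j, k, l, h1, h2, h3, h4, h5, h6, by linarith, by linarith, by linarith⟩
  · right
    exact ⟨i, j, k, h1, h2, h3, by linarith, b.imp (fun h => by linarith) (fun h => by linarith)⟩

end

end GoeAux

namespace GoeAux
open Set Topology
open scoped NNReal ENNReal

lemma box_meas (n : ℕ) (i : Fin (n + 1)) (R : Set ℝ) (hR : MeasurableSet R)
    (S : ℝ → Fin n → Set ℝ) (T : ℝ → Pr (n + 1) → Set ℝ)
    (hS : ∀ k, MeasurableSet {z : ℝ × ℝ | z.2 ∈ S z.1 k})
    (hT : ∀ p, MeasurableSet {z : ℝ × ℝ | z.2 ∈ T z.1 p}) :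
    MeasurableSet {ω : (Fin (n + 1) → ℝ) × (Pr (n + 1) → ℝ) | ω.1 i ∈ R ∧
      (∀ k, ω.1 (i.succAbove k) ∈ S (ω.1 i) k) ∧ ∀ p, ω.2 p ∈ T (ω.1 i) p} := by
  have e1 : Measurable fun ω : (Fin (n + 1) → ℝ) × (Pr (n + 1) → ℝ) => ω.1 i := by fun_prop
  have e2 : ∀ k, Measurable fun ω : (Fin (n + 1) → ℝ) × (Pr (n + 1) → ℝ) =>
    (ω.1 i, ω.1 (i.succAbove k)) := by intro k; fun_prop
  have e3 : ∀ p, Measurable fun ω : (Fin (n + 1) → ℝ) × (Pr (n + 1) → ℝ) =>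
    (ω.1 i, ω.2 p) := by intro k; fun_prop
  refine (e1 hR).inter (MeasurableSet.inter ?_ ?_)
  · have h2 := MeasurableSet.iInter fun k => e2 k (hS k)
    have h3 : (⋂ k, (fun ω : (Fin (n + 1) → ℝ) × (Pr (n + 1) → ℝ) => (ω.1 i, ω.1 (i.succAbove k))) ⁻¹'
      {z : ℝ × ℝ | z.2 ∈ S z.1 k}) = {ω | ∀ k, ω.1 (i.succAbove k) ∈ S (ω.1 i) k} := by
      ext; simp
    rw [h3] at h2
    exact h2
  · have h2 := MeasurableSet.iInter fun k => e3 k (hT k)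
    have h3 : (⋂ k, (fun ω : (Fin (n + 1) → ℝ) × (Pr (n + 1) → ℝ) => (ω.1 i, ω.2 k)) ⁻¹'
      {z : ℝ × ℝ | z.2 ∈ T z.1 k}) = {ω | ∀ p, ω.2 p ∈ T (ω.1 i) p} := by
      ext; simp
    rw [h3] at h2
    exact h2

lemma boxx (n : ℕ) (i : Fin (n + 1)) (R : Set ℝ) (hR : MeasurableSet R)
    (S : ℝ → Fin n → Set ℝ) (T : ℝ → Pr (n + 1) → Set ℝ)
    (hS : ∀ k, MeasurableSet {z : ℝ × ℝ | z.2 ∈ S z.1 k})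
    (hT : ∀ p, MeasurableSet {z : ℝ × ℝ | z.2 ∈ T z.1 p})
    (g : ℝ → ℝ) (hg0 : ∀ t, 0 ≤ g t) (hgi : IntegrableOn g R (gaussianReal 0 1))
    (hle : ∀ t ∈ R, (∏ k, (gaussianReal 0 1).real (S t k)) *
      (∏ p, (gaussianReal 0 (1 / 2)).real (T t p)) ≤ g t) :
    (mu (n + 1)).real {ω | ω.1 i ∈ R ∧
      (∀ k, ω.1 (i.succAbove k) ∈ S (ω.1 i) k) ∧ ∀ p, ω.2 p ∈ T (ω.1 i) p} ≤
      ∫ t in R, g t ∂(gaussianReal 0 1) :=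
  box n i R hR S T (box_meas n i R hR S T hS hT) g hg0 hgi hle

lemma meas_Ici : MeasurableSet {z : ℝ × ℝ | z.2 ∈ Ici z.1} :=
  measurableSet_le measurable_fst measurable_snd
lemma meas_Iic : MeasurableSet {z : ℝ × ℝ | z.2 ∈ Iic z.1} :=
  measurableSet_le measurable_snd measurable_fst

lemma half_ne : (1 / 2 : ℝ≥0) ≠ 0 := by norm_num

lemma one_sub_gcdf_nonneg (v : ℝ≥0) (t : ℝ) : 0 ≤ 1 - gcdf v t := by
  linarith [gcdf_le_one v t]
lemma one_sub_gcdf_le (v : ℝ≥0) (t : ℝ) : 1 - gcdf v t ≤ 1 := by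
  linarith [gcdf_nonneg v t]

lemma int_bdd (g : ℝ → ℝ) (hc : Continuous g) (C : ℝ) (h : ∀ t, |g t| ≤ C) :
    Integrable g (gaussianReal 0 1) :=
  Integrable.of_bound hc.aestronglyMeasurable C (Eventually.of_forall h)

lemma cont1 : Continuous (gcdf 1) := gcdf_continuous one_ne_zero
lemma cont2 : Continuous (gcdf (1 / 2)) := gcdf_continuous half_ne

lemma bound_E1 (n : ℕ) : (mu (n + 1)).real {ω | ∃ i, ∀ j, j ≠ i →
      goeMatrix (n + 1) ω.1 ω.2 i i ≤ goeMatrix (n + 1) ω.1 ω.2 j j ∧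
      goeMatrix (n + 1) ω.1 ω.2 i i ≤ goeMatrix (n + 1) ω.1 ω.2 i j} ≤
    ((n : ℝ) + 1) * ∫ t, (1 - gcdf 1 t) ^ n * (1 - gcdf (1 / 2) t) ^ n ∂(gaussianReal 0 1) := by
  classical
  have h := union_bound (mu (n + 1)) (ι := Fin (n + 1)) (fun i => {ω | ∀ j, j ≠ i →
      goeMatrix (n + 1) ω.1 ω.2 i i ≤ goeMatrix (n + 1) ω.1 ω.2 j j ∧
      goeMatrix (n + 1) ω.1 ω.2 i i ≤ goeMatrix (n + 1) ω.1 ω.2 i j})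
      (∫ t, (1 - gcdf 1 t) ^ n * (1 - gcdf (1 / 2) t) ^ n ∂(gaussianReal 0 1)) ?_
  · refine (measureReal_mono ?_).trans (h.trans (le_of_eq ?_))
    · rintro ω ⟨i, h⟩
      exact ⟨i, h⟩
    · simp
  · intro i
    set F : Finset (Pr (n + 1)) := Finset.univ.image
      (fun k : Fin n => pr i (i.succAbove k) (Fin.succAbove_ne i k).symm) with hF
    have hcard : F.card = n := by
      rw [hF, Finset.card_image_of_injective, Finset.card_univ, Fintype.card_fin]
      intro k k' hk
      by_contra hne
      exact pr_ne_left _ _ (fun h => hne (Fin.succAbove_right_injective h)) hk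
    have hb := boxx n i univ MeasurableSet.univ (fun t _ => Ici t)
      (fun t p => if p ∈ F then Ici t else univ)
      (fun k => meas_Ici) (fun p => by
        split_ifs
        · exact meas_Ici
        · simp) (fun t => (1 - gcdf 1 t) ^ n * (1 - gcdf (1 / 2) t) ^ n)
      (fun t => mul_nonneg (pow_nonneg (one_sub_gcdf_nonneg _ _) _)
        (pow_nonneg (one_sub_gcdf_nonneg _ _) _))
      (by
        refine (int_bdd _ ?_ 1 ?_).integrableOn
        · have := cont1; have := cont2; fun_prop
        · intro t
          rw [abs_of_nonneg (mul_nonneg (pow_nonneg (one_sub_gcdf_nonneg _ _) _)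
            (pow_nonneg (one_sub_gcdf_nonneg _ _) _))]
          exact mul_le_one₀ (pow_le_one₀ (one_sub_gcdf_nonneg _ _) (one_sub_gcdf_le _ _))
            (pow_nonneg (one_sub_gcdf_nonneg _ _) _)
            (pow_le_one₀ (one_sub_gcdf_nonneg _ _) (one_sub_gcdf_le _ _)))
      (by
        intro t _
        refine le_of_eq ?_
        congr 1
        · rw [Finset.prod_const, real_Ici one_ne_zero]; simp
        · have : ∀ p : Pr (n + 1), (gaussianReal 0 (1 / 2)).real (if p ∈ F then Ici t else univ) =
            if p ∈ F then 1 - gcdf (1 / 2) t else 1 := by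
            intro p; split_ifs
            · rw [real_Ici half_ne]
            · simp
          simp_rw [this]
          rw [Finset.prod_ite_mem, Finset.univ_inter, Finset.prod_const, hcard])
    rw [setIntegral_univ] at hb
    refine (measureReal_mono ?_).trans hb
    intro ω hω
    refine ⟨trivial, fun k => ?_, fun p => ?_⟩
    · have := (hω (i.succAbove k) (Fin.succAbove_ne i k)).1
      simpa [goe_diag] using this
    · split_ifs with hp
      · obtain ⟨k, -, rfl⟩ := Finset.mem_image.1 hp
        have := (hω (i.succAbove k) (Fin.succAbove_ne i k)).2
        rw [goe_diag, goe_off _ _ _ _ (Fin.succAbove_ne i k).symm] at this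
        exact this
      · trivial

lemma bound_P2 (n : ℕ) : (mu (n + 1)).real {ω | ∃ i j, i ≠ j ∧
      (∀ k, goeMatrix (n + 1) ω.1 ω.2 i i ≤ goeMatrix (n + 1) ω.1 ω.2 k k) ∧
      goeMatrix (n + 1) ω.1 ω.2 i j ≤ goeMatrix (n + 1) ω.1 ω.2 i i} ≤
    ((n : ℝ) + 1) ^ 2 * ∫ t, (1 - gcdf 1 t) ^ n * gcdf (1 / 2) t ∂(gaussianReal 0 1) := by
  classical
  have hnn : 0 ≤ ∫ t, (1 - gcdf 1 t) ^ n * gcdf (1 / 2) t ∂(gaussianReal 0 1) :=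
    integral_nonneg fun t => mul_nonneg (pow_nonneg (one_sub_gcdf_nonneg _ _) _) (gcdf_nonneg _ _)
  have h := union_bound (mu (n + 1)) (ι := Fin (n + 1) × Fin (n + 1)) (fun x => {ω | x.1 ≠ x.2 ∧
      (∀ k, goeMatrix (n + 1) ω.1 ω.2 x.1 x.1 ≤ goeMatrix (n + 1) ω.1 ω.2 k k) ∧
      goeMatrix (n + 1) ω.1 ω.2 x.1 x.2 ≤ goeMatrix (n + 1) ω.1 ω.2 x.1 x.1})
      (∫ t, (1 - gcdf 1 t) ^ n * gcdf (1 / 2) t ∂(gaussianReal 0 1)) ?_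
  · refine (measureReal_mono ?_).trans (h.trans (le_of_eq ?_))
    · rintro ω ⟨i, j, h⟩
      exact ⟨(i, j), h⟩
    · simp only [Fintype.card_prod, Fintype.card_fin]; push_cast; ring
  · rintro ⟨i, j⟩
    by_cases hij : i = j
    · refine le_trans (le_of_eq ?_) hnn
      simp [hij]
    have hb := boxx n i univ MeasurableSet.univ (fun t _ => Ici t)
      (fun t p => if p = pr i j hij then Iic t else univ)
      (fun k => meas_Ici) (fun p => by
        split_ifs
        · exact meas_Iic
        · simp) (fun t => (1 - gcdf 1 t) ^ n * gcdf (1 / 2) t)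
      (fun t => mul_nonneg (pow_nonneg (one_sub_gcdf_nonneg _ _) _) (gcdf_nonneg _ _))
      (by
        refine (int_bdd _ ?_ 1 ?_).integrableOn
        · have := cont1; have := cont2; fun_prop
        · intro t
          rw [abs_of_nonneg (mul_nonneg (pow_nonneg (one_sub_gcdf_nonneg _ _) _)
            (gcdf_nonneg _ _))]
          exact mul_le_one₀ (pow_le_one₀ (one_sub_gcdf_nonneg _ _) (one_sub_gcdf_le _ _))
            (gcdf_nonneg _ _) (gcdf_le_one _ _))
      (by
        intro t _
        refine le_of_eq ?_
        congr 1
        · rw [Finset.prod_const, real_Ici one_ne_zero]; simp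
        · have : ∀ p : Pr (n + 1), (gaussianReal 0 (1 / 2)).real
              (if p = pr i j hij then Iic t else univ) =
            if p = pr i j hij then gcdf (1 / 2) t else 1 := by
            intro p; split_ifs
            · rfl
            · simp
          simp_rw [this]
          rw [Finset.prod_ite_eq']; simp)
    rw [setIntegral_univ] at hb
    refine (measureReal_mono ?_).trans hb
    rintro ω ⟨-, h1, h2⟩
    refine ⟨trivial, fun k => ?_, fun p => ?_⟩
    · have := h1 (i.succAbove k)
      simpa [goe_diag] using this
    · split_ifs with hp
      · subst hp
        simp only at h2
        rw [goe_diag, goe_off _ _ _ _ hij] at h2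
        exact h2
      · trivial

lemma bound_P3 (n : ℕ) (m C : ℝ) (hm : 0 < m) (hC0 : 0 ≤ C) (hC : ∀ t ≤ -m,
      (gaussianReal 0 1).real (Icc t (t + 2 / t ^ 2)) * gcdf (1 / 2) t ≤ C * gcdf 1 t ^ 3) :
    (mu (n + 1)).real {ω | ∃ l i j, l ≠ i ∧ l ≠ j ∧ i ≠ j ∧
      (∀ k, goeMatrix (n + 1) ω.1 ω.2 l l ≤ goeMatrix (n + 1) ω.1 ω.2 k k) ∧
      goeMatrix (n + 1) ω.1 ω.2 l l ≤ -m ∧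
      goeMatrix (n + 1) ω.1 ω.2 i j ≤ goeMatrix (n + 1) ω.1 ω.2 l l ∧
      goeMatrix (n + 1) ω.1 ω.2 i i ≤ goeMatrix (n + 1) ω.1 ω.2 l l +
        2 / goeMatrix (n + 1) ω.1 ω.2 l l ^ 2} ≤
    ((n : ℝ) + 1) ^ 3 * (C * ∫ t, gcdf 1 t ^ 3 * (1 - gcdf 1 t) ^ (n - 1) ∂(gaussianReal 0 1)) := by
  classical
  have hg0 : ∀ t, 0 ≤ gcdf 1 t ^ 3 * (1 - gcdf 1 t) ^ (n - 1) := fun t =>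
    mul_nonneg (pow_nonneg (gcdf_nonneg _ _) _) (pow_nonneg (one_sub_gcdf_nonneg _ _) _)
  have hgi : Integrable (fun t => gcdf 1 t ^ 3 * (1 - gcdf 1 t) ^ (n - 1)) (gaussianReal 0 1) := by
    refine int_bdd _ ?_ 1 ?_
    · have := cont1; fun_prop
    · intro t
      rw [abs_of_nonneg (hg0 t)]
      exact mul_le_one₀ (pow_le_one₀ (gcdf_nonneg _ _) (gcdf_le_one _ _))
        (pow_nonneg (one_sub_gcdf_nonneg _ _) _)
        (pow_le_one₀ (one_sub_gcdf_nonneg _ _) (one_sub_gcdf_le _ _))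
  have hnn : 0 ≤ C * ∫ t, gcdf 1 t ^ 3 * (1 - gcdf 1 t) ^ (n - 1) ∂(gaussianReal 0 1) :=
    mul_nonneg hC0 (integral_nonneg hg0)
  have h := union_bound (mu (n + 1)) (ι := Fin (n + 1) × Fin (n + 1) × Fin (n + 1))
      (fun x => {ω | x.1 ≠ x.2.1 ∧ x.1 ≠ x.2.2 ∧ x.2.1 ≠ x.2.2 ∧
      (∀ k, goeMatrix (n + 1) ω.1 ω.2 x.1 x.1 ≤ goeMatrix (n + 1) ω.1 ω.2 k k) ∧
      goeMatrix (n + 1) ω.1 ω.2 x.1 x.1 ≤ -m ∧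
      goeMatrix (n + 1) ω.1 ω.2 x.2.1 x.2.2 ≤ goeMatrix (n + 1) ω.1 ω.2 x.1 x.1 ∧
      goeMatrix (n + 1) ω.1 ω.2 x.2.1 x.2.1 ≤ goeMatrix (n + 1) ω.1 ω.2 x.1 x.1 +
        2 / goeMatrix (n + 1) ω.1 ω.2 x.1 x.1 ^ 2})
      (C * ∫ t, gcdf 1 t ^ 3 * (1 - gcdf 1 t) ^ (n - 1) ∂(gaussianReal 0 1)) ?_
  · refine (measureReal_mono ?_).trans (h.trans (le_of_eq ?_))
    · rintro ω ⟨l, i, j, h⟩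
      exact ⟨(l, i, j), h⟩
    · simp only [Fintype.card_prod, Fintype.card_fin]; push_cast; ring
  · rintro ⟨l, i, j⟩
    by_cases hd : l ≠ i ∧ i ≠ j
    swap
    · refine le_trans (le_of_eq ?_) hnn
      rw [← measureReal_empty (μ := mu (n + 1))]
      congr 1
      ext ω
      simp only [mem_ofPred_eq, mem_empty_iff_false, iff_false]
      rintro ⟨h1, -, h2, -⟩
      exact hd ⟨h1, h2⟩
    obtain ⟨hli, hij⟩ := hd
    obtain ⟨k0, hk0⟩ := Fin.exists_succAbove_eq hli.symm
    have hb := boxx n l (Iic (-m)) measurableSet_Iic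
      (fun t k => if k = k0 then Icc t (t + 2 / t ^ 2) else Ici t)
      (fun t p => if p = pr i j hij then Iic t else univ)
      (fun k => by
        split_ifs
        · refine MeasurableSet.inter meas_Ici (measurableSet_le measurable_snd ?_)
          fun_prop
        · exact meas_Ici) (fun p => by
        split_ifs
        · exact meas_Iic
        · simp) (fun t => C * (gcdf 1 t ^ 3 * (1 - gcdf 1 t) ^ (n - 1)))
      (fun t => mul_nonneg hC0 (hg0 t))
      (hgi.const_mul C).integrableOn
      (by
        intro t ht
        have e1 : ∏ p : Pr (n + 1), (gaussianReal 0 (1 / 2)).real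
              (if p = pr i j hij then Iic t else univ) = gcdf (1 / 2) t := by
          have : ∀ p : Pr (n + 1), (gaussianReal 0 (1 / 2)).real
              (if p = pr i j hij then Iic t else univ) =
            if p = pr i j hij then gcdf (1 / 2) t else 1 := by
            intro p; split_ifs
            · rfl
            · simp
          simp_rw [this]
          rw [Finset.prod_ite_eq']; simp
        have e2 : ∏ k : Fin n, (gaussianReal 0 1).real
              (if k = k0 then Icc t (t + 2 / t ^ 2) else Ici t) =
              (gaussianReal 0 1).real (Icc t (t + 2 / t ^ 2)) * (1 - gcdf 1 t) ^ (n - 1) := by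
          rw [← Finset.mul_prod_erase _ _ (Finset.mem_univ k0), if_pos rfl]
          congr 1
          rw [Finset.prod_congr rfl (g := fun _ => 1 - gcdf 1 t)]
          · simp [Finset.card_erase_of_mem]
          · intro k hk
            rw [if_neg (Finset.ne_of_mem_erase hk), real_Ici one_ne_zero]
        rw [e1, e2]
        have := mul_le_mul_of_nonneg_right (hC t ht)
          (pow_nonneg (one_sub_gcdf_nonneg 1 t) (n - 1))
        calc _ = _ := by ring
          _ ≤ _ := this
          _ = _ := by ring)
    refine (measureReal_mono ?_).trans (hb.trans ?_)
    · rintro ω ⟨-, -, -, h1, h2, h3, h4⟩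
      simp only at h1 h2 h3 h4
      rw [goe_off _ _ _ _ hij] at h3
      simp only [goe_diag] at h1 h2 h3 h4
      refine ⟨h2, fun k => ?_, fun p => ?_⟩
      · split_ifs with hk
        · rw [hk, hk0]
          exact ⟨h1 i, h4⟩
        · exact h1 _
      · split_ifs with hp
        · subst hp; exact h3
        · trivial
    · rw [← integral_const_mul]
      exact setIntegral_le_integral (hgi.const_mul C)
        (Eventually.of_forall fun t => mul_nonneg hC0 (hg0 t))

end GoeAux

namespace GoeAux
open Set Topology
open scoped NNReal ENNReal

/-- probability of a minimizer with support of size two -/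
noncomputable def ptwo (n : ℕ) : ℝ :=
  (mu n).real {ω | ∃ x, IsMinim (goeMatrix n ω.1 ω.2) x ∧ {i | 0 < x i}.ncard = 2}

lemma ptwo_upper (n : ℕ) (m C : ℝ) (hm : 1 ≤ m) (hC0 : 0 ≤ C) (hC : ∀ t ≤ -m,
      (gaussianReal 0 1).real (Icc t (t + 2 / t ^ 2)) * gcdf (1 / 2) t ≤ C * gcdf 1 t ^ 3) :
    ptwo (n + 1) ≤ (1 - gcdf 1 (-m)) ^ (n + 1) +
      (((n : ℝ) + 1) ^ 2 * (∫ t, (1 - gcdf 1 t) ^ n * gcdf (1 / 2) t ∂(gaussianReal 0 1)) +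
      (((n : ℝ) + 1) ^ 2 * (Real.exp (- (13 / 8) * m ^ 2)) +
      (((n : ℝ) + 1) ^ 2 * (Real.exp (- (3 / 2) * m ^ 2 - m * (1 / √(m + 1)))) +
      ((n : ℝ) + 1) ^ 3 * (C * ∫ t, gcdf 1 t ^ 3 * (1 - gcdf 1 t) ^ (n - 1)
        ∂(gaussianReal 0 1))))) := by
  have hm0 : 0 ≤ m := by linarith
  have h4 := bound_P4 (n := n + 1) m
  have h2 := bound_P2 n
  have g1 := bound_G1 (n := n + 1) m hm0
  have g2 := bound_G2 (n := n + 1) m (1 / √(m + 1)) hm0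
  have h3 := bound_P3 n m C (by linarith) hC0 hC
  push_cast at g1 g2
  refine (measureReal_mono ?_).trans ((measureReal_union_le _ _).trans
    (add_le_add h4 ((measureReal_union_le _ _).trans (add_le_add h2
      ((measureReal_union_le _ _).trans (add_le_add g1
        ((measureReal_union_le _ _).trans (add_le_add g2 h3))))))))
  rintro ω ⟨x, hx, hc⟩
  by_cases h0 : ∀ k, -m ≤ goeMatrix (n + 1) ω.1 ω.2 k k
  · left; exact h0
  right
  push Not at h0
  exact size_two_cases (goe_symm ω.1 ω.2) hx hc m hm h0

lemma ptwo_lower (n : ℕ) (m : ℝ) (hm : 0 ≤ m) :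
    1 ≤ ((n : ℝ) + 1) *
        (∫ t, (1 - gcdf 1 t) ^ n * (1 - gcdf (1 / 2) t) ^ n ∂(gaussianReal 0 1)) +
      (ptwo (n + 1) + ((1 - gcdf 1 (-m)) ^ (n + 1) + (((n : ℝ) + 1) ^ 4 * Real.exp (- 3 * m ^ 2) +
      ((n : ℝ) + 1) ^ 3 * (2 * Real.exp (- (5 / 2) * m ^ 2))))) := by
  have h1 := bound_E1 n
  have h3 := bound_three (n := n + 1) m hm
  push_cast at h3
  have hu : (mu (n + 1)).real univ = 1 := probReal_univ
  have h2 : (mu (n + 1)).real {ω | ∃ x, IsMinim (goeMatrix (n + 1) ω.1 ω.2) x ∧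
    {i | 0 < x i}.ncard = 2} ≤ ptwo (n + 1) := le_rfl
  refine hu.symm.le.trans ?_
  refine (measureReal_mono ?_ (measure_ne_top _ _)).trans ((measureReal_union_le _ _).trans
    (add_le_add h1 ((measureReal_union_le _ _).trans (add_le_add h2 h3))))
  intro ω _
  obtain ⟨x, hx⟩ := exists_min (Nat.succ_pos n) (goeMatrix (n + 1) ω.1 ω.2)
  have hp := supp_pos hx
  by_cases c1 : {i | 0 < x i}.ncard = 1
  · left; exact size_one (goe_symm ω.1 ω.2) hx c1
  right
  by_cases c2 : {i | 0 < x i}.ncard = 2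
  · left; exact ⟨x, hx, c2⟩
  · have h3 : 3 ≤ {i | 0 < x i}.ncard := by omega
    right; exact ⟨x, hx, h3⟩

lemma int_pow (a b c d : ℕ) : Integrable (fun t => gcdf 1 t ^ a * (1 - gcdf 1 t) ^ b *
    (gcdf (1 / 2) t ^ c * (1 - gcdf (1 / 2) t) ^ d)) (gaussianReal 0 1) := by
  refine int_bdd _ ?_ 1 ?_
  · have := cont1; have := cont2; fun_prop
  · intro t
    have hp : ∀ (v : ℝ≥0) (a : ℕ), 0 ≤ gcdf v t ^ a ∧ gcdf v t ^ a ≤ 1 := fun v a =>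
      ⟨pow_nonneg (gcdf_nonneg _ _) _, pow_le_one₀ (gcdf_nonneg _ _) (gcdf_le_one _ _)⟩
    have hq : ∀ (v : ℝ≥0) (a : ℕ), 0 ≤ (1 - gcdf v t) ^ a ∧ (1 - gcdf v t) ^ a ≤ 1 := fun v a =>
      ⟨pow_nonneg (one_sub_gcdf_nonneg _ _) _,
        pow_le_one₀ (one_sub_gcdf_nonneg _ _) (one_sub_gcdf_le _ _)⟩
    rw [abs_of_nonneg (mul_nonneg (mul_nonneg (hp _ _).1 (hq _ _).1)
      (mul_nonneg (hp _ _).1 (hq _ _).1))]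
    exact mul_le_one₀ (mul_le_one₀ (hp _ _).2 (hq _ _).1 (hq _ _).2)
      (mul_nonneg (hp _ _).1 (hq _ _).1) (mul_le_one₀ (hp _ _).2 (hq _ _).1 (hq _ _).2)

lemma gint0 (n : ℕ) : ∫ t, (1 - gcdf 1 t) ^ n ∂(gaussianReal 0 1) = 1 / ((n : ℝ) + 1) := by
  rw [integral_comp_gcdf (fun u => (1 - u) ^ n) (by fun_prop), poly_int]

lemma gint2 (n : ℕ) : ∫ t, gcdf 1 t ^ 2 * (1 - gcdf 1 t) ^ n ∂(gaussianReal 0 1) =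
    2 / (((n : ℝ) + 1) * (n + 2) * (n + 3)) := by
  rw [integral_comp_gcdf (fun u => u ^ 2 * (1 - u) ^ n) (by fun_prop), poly_int2]

lemma gint3 (n : ℕ) : ∫ t, gcdf 1 t ^ 3 * (1 - gcdf 1 t) ^ n ∂(gaussianReal 0 1) =
    6 / (((n : ℝ) + 1) * (n + 2) * (n + 3) * (n + 4)) := by
  rw [integral_comp_gcdf (fun u => u ^ 3 * (1 - u) ^ n) (by fun_prop), poly_int3]

lemma main_upper (n : ℕ) (m M r : ℝ) (hm : 0 ≤ m) (hmM : m ≤ M) (hr : 0 ≤ r)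
    (h : ∀ t ≤ -m, gcdf (1 / 2) t ≤ r * (-t) * gcdf 1 t ^ 2) :
    ∫ t, (1 - gcdf 1 t) ^ n * gcdf (1 / 2) t ∂(gaussianReal 0 1) ≤
      gcdf (1 / 2) (-M) * gcdf 1 (-M) + (r * M * (2 / (((n : ℝ) + 1) * (n + 2) * (n + 3))) +
        (1 - gcdf 1 (-m)) ^ n) := by
  have i1 : Integrable (fun t => (1 - gcdf 1 t) ^ n * gcdf (1 / 2) t) (gaussianReal 0 1) := by
    simpa using int_pow 0 n 1 0
  have i2 : Integrable (fun t => gcdf 1 t ^ 2 * (1 - gcdf 1 t) ^ n) (gaussianReal 0 1) := by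
    simpa using int_pow 2 n 0 0
  have i3 : Integrable ((Iic (-M)).indicator fun _ => gcdf (1 / 2) (-M)) (gaussianReal 0 1) :=
    (integrable_const _).indicator measurableSet_Iic
  have key : ∀ t, (1 - gcdf 1 t) ^ n * gcdf (1 / 2) t ≤
      (Iic (-M)).indicator (fun _ => gcdf (1 / 2) (-M)) t +
      (r * M * (gcdf 1 t ^ 2 * (1 - gcdf 1 t) ^ n) + (1 - gcdf 1 (-m)) ^ n) := by
    intro t
    have q0 : 0 ≤ (1 - gcdf 1 t) ^ n := pow_nonneg (one_sub_gcdf_nonneg _ _) _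
    have q1 : (1 - gcdf 1 t) ^ n ≤ 1 := pow_le_one₀ (one_sub_gcdf_nonneg _ _) (one_sub_gcdf_le _ _)
    have q2 : 0 ≤ (1 - gcdf 1 (-m)) ^ n := pow_nonneg (one_sub_gcdf_nonneg _ _) _
    have q3 : 0 ≤ r * M * (gcdf 1 t ^ 2 * (1 - gcdf 1 t) ^ n) :=
      mul_nonneg (mul_nonneg hr (by linarith)) (mul_nonneg (sq_nonneg _) q0)
    have q4 : 0 ≤ (Iic (-M)).indicator (fun _ => gcdf (1 / 2) (-M)) t :=
      indicator_nonneg (fun _ _ => gcdf_nonneg _ _) t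
    by_cases t1 : t ≤ -M
    · rw [indicator_of_mem (show t ∈ Iic (-M) from t1)]
      have := gcdf_mono (1 / 2) t1
      have h0 := gcdf_nonneg (1 / 2) t
      nlinarith
    · by_cases t2 : t ≤ -m
      · have h1 := h t t2
        push Not at t1
        have : r * (-t) * gcdf 1 t ^ 2 ≤ r * M * gcdf 1 t ^ 2 := by
          gcongr; linarith
        have := mul_le_mul_of_nonneg_left (h1.trans this) q0
        nlinarith
      · push Not at t2
        have : (1 - gcdf 1 t) ^ n ≤ (1 - gcdf 1 (-m)) ^ n :=
          pow_le_pow_left₀ (one_sub_gcdf_nonneg _ _) (by linarith [gcdf_mono 1 t2.le]) _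
        have h0 := gcdf_nonneg (1 / 2) t
        have h1 := gcdf_le_one (1 / 2) t
        nlinarith
  have i4 : Integrable (fun t => r * M * (gcdf 1 t ^ 2 * (1 - gcdf 1 t) ^ n) +
      (1 - gcdf 1 (-m)) ^ n) (gaussianReal 0 1) := (i2.const_mul _).add (integrable_const _)
  refine (integral_mono i1 (i3.add i4) key).trans (le_of_eq ?_)
  simp only [Pi.add_apply]
  rw [integral_add i3 i4,
    integral_add (i2.const_mul _) (integrable_const _), integral_const_mul, gint2,
    integral_indicator measurableSet_Iic]
  simp [gcdf, mul_comm]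

lemma one_sub_pow_ge (p : ℝ) (n : ℕ) (h0 : 0 ≤ p) (h1 : n * p ≤ 1) (hp : p ≤ 1) :
    n * p * (1 - n * p) ≤ 1 - (1 - p) ^ n := by
  have e1 : (1 - p) ^ n ≤ Real.exp (-(n * p)) := by
    have : 1 - p ≤ Real.exp (-p) := by linarith [Real.add_one_le_exp (-p)]
    refine (pow_le_pow_left₀ (by linarith) this n).trans (le_of_eq ?_)
    rw [← Real.exp_nat_mul]; congr 1; ring
  have hx0 : 0 ≤ n * p := by positivity
  have := Real.abs_exp_sub_one_sub_id_le (x := -(n * p)) (by rw [abs_neg, abs_of_nonneg hx0]; exact h1)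
  have := (abs_le.1 this).2
  nlinarith

lemma main_lower (n : ℕ) (m r : ℝ) (hm : 0 ≤ m) (hr : 0 ≤ r)
    (h : ∀ t ≤ -m, r * (-t) * gcdf 1 t ^ 2 ≤ gcdf (1 / 2) t)
    (hs : n * gcdf (1 / 2) (-m) ≤ 1) :
    n * (1 - n * gcdf (1 / 2) (-m)) * (r * m) * (2 / ((n + 1) * (n + 2) * (n + 3)) -
        (1 - gcdf 1 (-m)) ^ n) ≤ 1 / (n + 1) -
    ∫ t, (1 - gcdf 1 t) ^ n * (1 - gcdf (1 / 2) t) ^ n ∂(gaussianReal 0 1) := by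
  have i1 : Integrable (fun t => (1 - gcdf 1 t) ^ n * (1 - gcdf (1 / 2) t) ^ n)
    (gaussianReal 0 1) := by
    simpa using int_pow 0 n 0 n
  have i0 : Integrable (fun t => (1 - gcdf 1 t) ^ n) (gaussianReal 0 1) := by
    simpa using int_pow 0 n 0 0
  have i2 : Integrable (fun t => gcdf 1 t ^ 2 * (1 - gcdf 1 t) ^ n) (gaussianReal 0 1) := by
    simpa using int_pow 2 n 0 0
  have hc0 : 0 ≤ (n : ℝ) * (1 - n * gcdf (1 / 2) (-m)) :=
    mul_nonneg (Nat.cast_nonneg n) (by linarith)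
  have hc : 0 ≤ (n : ℝ) * (1 - n * gcdf (1 / 2) (-m)) * (r * m) :=
    mul_nonneg hc0 (mul_nonneg hr hm)
  have key : ∀ t, n * (1 - n * gcdf (1 / 2) (-m)) * (r * m) * (gcdf 1 t ^ 2 * (1 - gcdf 1 t) ^ n -
      (1 - gcdf 1 (-m)) ^ n) ≤
      (1 - gcdf 1 t) ^ n - (1 - gcdf 1 t) ^ n * (1 - gcdf (1 / 2) t) ^ n := by
    intro t
    have q0 : 0 ≤ (1 - gcdf 1 t) ^ n := pow_nonneg (one_sub_gcdf_nonneg _ _) _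
    have q2 : 0 ≤ (1 - gcdf 1 (-m)) ^ n := pow_nonneg (one_sub_gcdf_nonneg _ _) _
    by_cases ht : t ≤ -m
    · have hmono := gcdf_mono (1 / 2) ht
      have hnn := gcdf_nonneg (1 / 2) t
      have hn0 : (0 : ℝ) ≤ n := Nat.cast_nonneg n
      have hn1 : (n : ℝ) * gcdf (1 / 2) t ≤ n * gcdf (1 / 2) (-m) :=
        mul_le_mul_of_nonneg_left hmono hn0
      have e1 := one_sub_pow_ge (gcdf (1 / 2) t) n hnn (hn1.trans hs) (gcdf_le_one _ _)
      have e2 : r * m * gcdf 1 t ^ 2 ≤ gcdf (1 / 2) t := by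
        refine le_trans ?_ (h t ht)
        gcongr; linarith
      have e3 : n * (1 - n * gcdf (1 / 2) (-m)) * (r * m * gcdf 1 t ^ 2) ≤
          1 - (1 - gcdf (1 / 2) t) ^ n := by
        refine le_trans (mul_le_mul_of_nonneg_left e2 hc0) (le_trans ?_ e1)
        have : (n : ℝ) * gcdf (1 / 2) t * (1 - n * gcdf (1 / 2) (-m)) ≤
          n * gcdf (1 / 2) t * (1 - n * gcdf (1 / 2) t) :=
          mul_le_mul_of_nonneg_left (by linarith) (mul_nonneg hn0 hnn)
        linarith
      have e4 := mul_le_mul_of_nonneg_right e3 q0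
      have e5 := mul_nonneg hc q2
      linarith
    · push Not at ht
      have e1 : (1 - gcdf 1 t) ^ n ≤ (1 - gcdf 1 (-m)) ^ n :=
          pow_le_pow_left₀ (one_sub_gcdf_nonneg _ _) (by linarith [gcdf_mono 1 ht.le]) _
      have e2 : gcdf 1 t ^ 2 * (1 - gcdf 1 t) ^ n ≤ (1 - gcdf 1 t) ^ n :=
        mul_le_of_le_one_left q0 (pow_le_one₀ (gcdf_nonneg _ _) (gcdf_le_one _ _))
      have e3 := mul_nonpos_of_nonneg_of_nonpos hc (sub_nonpos.2 (e2.trans e1))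
      have e4 : (1 - gcdf 1 t) ^ n * (1 - gcdf (1 / 2) t) ^ n ≤ (1 - gcdf 1 t) ^ n :=
        mul_le_of_le_one_right q0 (pow_le_one₀ (one_sub_gcdf_nonneg _ _) (one_sub_gcdf_le _ _))
      linarith
  have := integral_mono ((i2.sub (integrable_const _)).const_mul _) (i0.sub i1) key
  simp only [Pi.sub_apply] at this
  rw [integral_const_mul, integral_sub i2 (integrable_const _), integral_sub i0 i1, gint0, gint2]
    at this
  simpa using this

end GoeAux

namespace GoeAux
open Set Topology
open scoped NNReal ENNReal

lemma tail (v : ℝ≥0) (a s : ℝ) (ha : 0 ≤ a) :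
    gcdf v (-s) ≤ Real.exp (-a * s + v * a ^ 2 / 2) := by
  have h := measure_le_le_exp_mul_mgf (μ := gaussianReal 0 v) (X := id) (-s) (t := -a)
    (by linarith) (by simpa using integrable_exp_mul_gaussianReal (-a))
  rw [mgf_id_gaussianReal, ← Real.exp_add] at h
  have e : {ω : ℝ | id ω ≤ -s} = Iic (-s) := rfl
  rw [e] at h
  refine h.trans (le_of_eq ?_)
  congr 1
  ring

lemma tail1 (s : ℝ) (hs : 0 ≤ s) : gcdf 1 (-s) ≤ Real.exp (-s ^ 2 / 2) := by
  refine (tail 1 s s hs).trans (le_of_eq ?_)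
  congr 1
  push_cast; ring

lemma tail2 (s : ℝ) (hs : 0 ≤ s) : gcdf (1 / 2) (-s) ≤ Real.exp (-s ^ 2) := by
  refine (tail (1 / 2) (2 * s) s (by linarith)).trans (le_of_eq ?_)
  congr 1
  push_cast; ring

lemma pdf1 (t : ℝ) : gaussianPDFReal 0 1 t = (√(2 * Real.pi))⁻¹ * Real.exp (-t ^ 2 / 2) := by
  simp [gaussianPDFReal]

lemma pdf2 (t : ℝ) : gaussianPDFReal 0 (1 / 2) t = (√Real.pi)⁻¹ * Real.exp (-t ^ 2) := by
  simp [gaussianPDFReal]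
  field_simp

lemma ratio : Tendsto (fun t => gcdf (1 / 2) t / ((-t) * gcdf 1 t ^ 2)) atBot (𝓝 (√Real.pi)) := by
  have h1 := mills (v := 1) one_ne_zero
  have h2 := mills (v := 1 / 2) half_ne
  have h := (h2.div (h1.pow 2) (by norm_num)).const_mul (√Real.pi)
  simp only [one_pow, div_one, mul_one] at h
  refine h.congr' ?_
  filter_upwards [eventually_lt_atBot 0] with t ht
  have p1 := (gcdf_pos (v := 1) one_ne_zero t).ne'
  have hpi := Real.pi_pos
  have hs : √Real.pi ≠ 0 := (Real.sqrt_pos.2 hpi).ne'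
  have hs2 : √Real.pi ^ 2 = Real.pi := Real.sq_sqrt hpi.le
  have hs3 : √(2 * Real.pi) ^ 2 = 2 * Real.pi := Real.sq_sqrt (by linarith)
  have hs4 : √(2 * Real.pi) ≠ 0 := (Real.sqrt_pos.2 (by linarith)).ne'
  have he : Real.exp (-t ^ 2 / 2) ^ 2 = Real.exp (-t ^ 2) := by
    rw [← Real.exp_nat_mul]; congr 1; push_cast; ring
  have he0 := (Real.exp_pos (-t ^ 2 / 2)).ne'
  simp only [Pi.div_apply, pdf1, pdf2, ← he]
  push_cast
  field_simp
  rw [hs3]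
  field_simp
  rw [hs2]
  ring

lemma pdf_le : ∀ᶠ t in atBot, gaussianPDFReal 0 1 t ≤ 2 * (-t) * gcdf 1 t := by
  have h1 := mills (v := 1) one_ne_zero
  filter_upwards [h1.eventually (lt_mem_nhds (show (1 / 2 : ℝ) < 1 by norm_num)),
    eventually_lt_atBot 0] with t ht h0
  have hp := gaussianPDFReal_pos 0 1 t one_ne_zero
  have : 0 < (1 : ℝ≥0) * gaussianPDFReal 0 1 t / (-t) := by
    have : 0 < -t := by linarith
    push_cast; positivity
  rw [lt_div_iff₀ this] at ht
  push_cast at ht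
  have h3 : 1 / 2 * (1 * gaussianPDFReal 0 1 t / -t) * (-t) = gaussianPDFReal 0 1 t / 2 := by
    have : t ≠ 0 := h0.ne
    field_simp
  have := mul_lt_mul_of_pos_right ht (show 0 < -t by linarith)
  rw [h3] at this
  linarith

lemma cdf_ge : ∀ᶠ m in atTop, Real.exp (-m ^ 2 / 2) / m ^ 2 ≤ gcdf 1 (-m) := by
  have h := tendsto_neg_atTop_atBot.eventually pdf_le
  filter_upwards [h, eventually_ge_atTop (2 * √(2 * Real.pi)), eventually_gt_atTop 0]
    with m h1 h2 h3
  rw [pdf1, neg_sq, neg_neg] at h1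
  have hs : 0 < √(2 * Real.pi) := Real.sqrt_pos.2 (by have := Real.pi_pos; linarith)
  rw [div_le_iff₀ (by positivity)]
  rw [inv_mul_le_iff₀ hs] at h1
  refine h1.trans ?_
  have := gcdf_nonneg 1 (-m)
  have : √(2 * Real.pi) * (2 * m * gcdf 1 (-m)) = (2 * √(2 * Real.pi)) * (m * gcdf 1 (-m)) := by ring
  rw [this]
  have : gcdf 1 (-m) * m ^ 2 = m * (m * gcdf 1 (-m)) := by ring
  rw [this]
  gcongr

lemma Icc_le (t : ℝ) (ht : t ≤ -1) : (gaussianReal 0 1).real (Icc t (t + 2 / t ^ 2)) ≤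
    2 / t ^ 2 * (Real.exp 2 * gaussianPDFReal 0 1 t) := by
  have ht2 : 0 < t ^ 2 := by nlinarith
  have hd : 0 ≤ 2 / t ^ 2 := by positivity
  rw [real_eq_integral one_ne_zero]
  have hc : ∀ s ∈ Icc t (t + 2 / t ^ 2), gaussianPDFReal 0 1 s ≤
      Real.exp 2 * gaussianPDFReal 0 1 t := by
    rintro s ⟨h1, h2⟩
    rw [pdf1, pdf1, mul_left_comm, ← Real.exp_add]
    gcongr
    have e1 : (-t) * (s - t) ≤ 2 := by
      have : (-t) * (s - t) ≤ (-t) * (2 / t ^ 2) := by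
        apply mul_le_mul_of_nonneg_left <;> linarith
      refine this.trans ?_
      have : (-t) * (2 / t ^ 2) = 2 / (-t) := by
        have : t ≠ 0 := by linarith
        field_simp
      rw [this, div_le_iff₀ (by linarith)]
      linarith
    nlinarith [sq_nonneg (s - t)]
  have := setIntegral_mono_on (μ := volume) (s := Icc t (t + 2 / t ^ 2))
    (f := fun s => gaussianPDFReal 0 1 s) (g := fun _ => Real.exp 2 * gaussianPDFReal 0 1 t)
    ((continuous_pdf 1).integrableOn_Icc) (continuous_const.integrableOn_Icc)
    measurableSet_Icc hc
  refine this.trans (le_of_eq ?_)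
  rw [setIntegral_const, Real.volume_real_Icc_of_le (by linarith), smul_eq_mul]
  ring

lemma P3const : ∀ᶠ t in atBot, (gaussianReal 0 1).real (Icc t (t + 2 / t ^ 2)) * gcdf (1 / 2) t ≤
    8 * Real.exp 2 * gcdf 1 t ^ 3 := by
  have hpi : √Real.pi < 2 := by
    rw [Real.sqrt_lt' (by norm_num)]
    linarith [Real.pi_lt_four]
  filter_upwards [pdf_le, ratio.eventually (gt_mem_nhds hpi), eventually_le_atBot (-1)]
    with t h1 h2 h3
  have p1 := gcdf_pos (v := 1) one_ne_zero t
  have ht : 0 < -t := by linarith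
  have ht2 : 0 < t ^ 2 := by nlinarith
  rw [div_lt_iff₀ (by positivity)] at h2
  have h4 := Icc_le t h3
  have p2 := gcdf_nonneg (1 / 2) t
  have p3 := (gaussianPDFReal_pos 0 1 t one_ne_zero).le
  calc _ ≤ 2 / t ^ 2 * (Real.exp 2 * (2 * (-t) * gcdf 1 t)) * (2 * (-t * gcdf 1 t ^ 2)) := by
        gcongr
        exact h4.trans (by gcongr)
    _ = _ := by
      have : t ≠ 0 := by linarith
      field_simp
      ring

end GoeAux

namespace GoeAux
open Set Topology
open scoped NNReal ENNReal

/-- logarithm of the dimension -/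
noncomputable def Lf (n : ℕ) : ℝ := Real.log ((n : ℝ) + 1)
/-- truncation level -/
noncomputable def mf (n : ℕ) : ℝ := √(2 * Lf n - 6 * Real.log (Lf n))
/-- small error -/
noncomputable def ep (n : ℕ) : ℝ := Real.exp (18 * Real.log (Lf n) - √(√(Lf n)) / 4)

lemma N_tendsto : Tendsto (fun n : ℕ => (n : ℝ) + 1) atTop atTop :=
  tendsto_atTop_add_const_right _ _ tendsto_natCast_atTop_atTop

lemma Lf_tendsto : Tendsto Lf atTop atTop := Real.tendsto_log_atTop.comp N_tendsto

lemma exp_Lf (n : ℕ) : Real.exp (Lf n) = (n : ℝ) + 1 := Real.exp_log (by positivity)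

lemma log_div_tendsto : Tendsto (fun x => Real.log x / x) atTop (𝓝 0) :=
  Real.isLittleO_log_id_atTop.tendsto_div_nhds_zero

lemma mf_ratio : Tendsto (fun n => mf n / √(Lf n)) atTop (𝓝 (√2)) := by
  have h1 : Tendsto (fun x : ℝ => √(2 - 6 * (Real.log x / x))) atTop (𝓝 (√2)) := by
    have := ((log_div_tendsto.const_mul 6).const_sub 2).sqrt
    simpa using this
  refine (h1.comp Lf_tendsto).congr' ?_
  filter_upwards [Lf_tendsto.eventually_gt_atTop 0] with n hn
  simp only [Function.comp, mf]
  rw [← Real.sqrt_div' _ hn.le]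
  congr 1
  field_simp

lemma ep_tendsto : Tendsto ep atTop (𝓝 0) := by
  have h1 : Tendsto (fun x : ℝ => √(√x) / 4) atTop atTop :=
    (Real.tendsto_sqrt_atTop.comp Real.tendsto_sqrt_atTop).atTop_div_const (by norm_num)
  have h2 := ((Real.tendsto_pow_mul_exp_neg_atTop_nhds_zero 72).comp (h1.comp Lf_tendsto)).const_mul
    ((4 : ℝ) ^ 72)
  rw [mul_zero] at h2
  refine h2.congr' ?_
  filter_upwards [Lf_tendsto.eventually_gt_atTop 0] with n hn
  simp only [Function.comp, ep]
  rw [← mul_assoc, ← mul_pow, mul_div_cancel₀ _ (by norm_num), sub_eq_add_neg, Real.exp_add]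
  congr 1
  have e : 18 * Real.log (Lf n) = ((18 : ℕ) : ℝ) * Real.log (Lf n) := by norm_num
  rw [e, Real.exp_nat_mul, Real.exp_log hn]
  have : √(√(Lf n)) ^ 4 = Lf n := by
    have : √(√(Lf n)) ^ 4 = (√(√(Lf n)) ^ 2) ^ 2 := by ring
    rw [this, Real.sq_sqrt (Real.sqrt_nonneg _), Real.sq_sqrt hn.le]
  conv_rhs => rw [← this]
  ring

/-- basic inequalities at level `n` -/
structure Good (n : ℕ) : Prop where
  n1 : 1 ≤ n
  L13 : 13 ≤ Lf n
  ell : 0 ≤ Real.log (Lf n)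
  msq : mf n ^ 2 = 2 * Lf n - 6 * Real.log (Lf n)
  mlow : Lf n ≤ mf n ^ 2
  mhigh : mf n ^ 2 ≤ 2 * Lf n
  s1 : 1 ≤ √(√(Lf n))
  sm : √(√(Lf n)) ^ 2 ≤ mf n
  s4 : √(√(Lf n)) ^ 4 = Lf n
  cdf : Real.exp (-mf n ^ 2 / 2) / mf n ^ 2 ≤ gcdf 1 (-mf n)

lemma mf_tendsto : Tendsto mf atTop atTop := by
  have h : Tendsto (fun n => √(Lf n)) atTop atTop := Real.tendsto_sqrt_atTop.comp Lf_tendsto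
  have := Tendsto.pos_mul_atTop (by positivity : (0 : ℝ) < √2) mf_ratio h
  refine this.congr' ?_
  filter_upwards [Lf_tendsto.eventually_gt_atTop 0] with n hn
  have : √(Lf n) ≠ 0 := (Real.sqrt_pos.2 hn).ne'
  field_simp

lemma good : ∀ᶠ n in atTop, Good n := by
  have h6 := log_div_tendsto.comp Lf_tendsto
  filter_upwards [eventually_ge_atTop 1, Lf_tendsto.eventually_ge_atTop 13,
    h6.eventually (gt_mem_nhds (show (0 : ℝ) < 1 / 6 by norm_num)), mf_tendsto.eventually cdf_ge]
    with n h1 h2 h3 h4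
  have hl : 0 ≤ Real.log (Lf n) := Real.log_nonneg (by linarith)
  have h3' : 6 * Real.log (Lf n) ≤ Lf n := by
    simp only [Function.comp] at h3
    rw [div_lt_iff₀ (by linarith)] at h3
    linarith
  have msq : mf n ^ 2 = 2 * Lf n - 6 * Real.log (Lf n) := Real.sq_sqrt (by linarith)
  have hs : √(√(Lf n)) ^ 2 = √(Lf n) := Real.sq_sqrt (Real.sqrt_nonneg _)
  refine ⟨h1, h2, hl, msq, by linarith, by linarith, ?_, ?_, ?_, h4⟩
  · rw [Real.one_le_sqrt, Real.one_le_sqrt]; linarith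
  · rw [hs]
    exact Real.sqrt_le_sqrt (by linarith)
  · have : √(√(Lf n)) ^ 4 = (√(√(Lf n)) ^ 2) ^ 2 := by ring
    rw [this, hs, Real.sq_sqrt (by linarith)]

lemma Good.m1 {n : ℕ} (g : Good n) : 1 ≤ mf n := by nlinarith [g.sm, g.s1]

lemma Good.sL {n : ℕ} (g : Good n) : √(√(Lf n)) ≤ Lf n := by
  have h := g.s1
  have h4 := g.s4
  have : √(√(Lf n)) ^ 1 ≤ √(√(Lf n)) ^ 4 := pow_le_pow_right₀ h (by norm_num)
  rw [pow_one] at this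
  linarith

lemma Good.Npow {n : ℕ} (_ : Good n) (k : ℕ) : ((n : ℝ) + 1) ^ k = Real.exp (k * Lf n) := by
  rw [← exp_Lf, ← Real.exp_nat_mul]

lemma Good.t1 {n : ℕ} (g : Good n) : ((n : ℝ) + 1) ^ 3 * (gcdf (1 / 2) (-(mf n + 1)) * gcdf 1 (-(mf n + 1))) ≤ ep n := by
  have hm := g.m1
  have a := tail1 (mf n + 1) (by linarith)
  have b := tail2 (mf n + 1) (by linarith)
  have : gcdf (1 / 2) (-(mf n + 1)) * gcdf 1 (-(mf n + 1)) ≤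
      Real.exp (-(mf n + 1) ^ 2) * Real.exp (-(mf n + 1) ^ 2 / 2) :=
    mul_le_mul b a (gcdf_nonneg _ _) (Real.exp_nonneg _)
  refine (mul_le_mul_of_nonneg_left this (by positivity)).trans ?_
  rw [g.Npow, ← Real.exp_add, ← Real.exp_add, ep]
  apply Real.exp_le_exp.2
  push_cast
  have := g.msq
  have := g.ell
  have := g.sm
  have := g.s1
  nlinarith

lemma Good.t2 {n : ℕ} (g : Good n) : ((n : ℝ) + 1) ^ 3 * Real.exp (-(13 / 8) * mf n ^ 2) ≤ ep n := by
  rw [g.Npow, ← Real.exp_add, ep]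
  apply Real.exp_le_exp.2
  push_cast
  have := g.msq
  have := g.ell
  have := g.sL
  linarith

lemma Good.t3 {n : ℕ} (g : Good n) : ((n : ℝ) + 1) ^ 3 *
    Real.exp (-(3 / 2) * mf n ^ 2 - mf n * (1 / √(mf n + 1))) ≤ ep n := by
  rw [g.Npow, ← Real.exp_add, ep]
  apply Real.exp_le_exp.2
  push_cast
  have := g.msq
  have := g.ell
  have hm := g.m1
  have h1 : √(mf n + 1) ≤ 2 * √(mf n) := by
    rw [Real.sqrt_le_left (by positivity), mul_pow, Real.sq_sqrt (by linarith)]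
    linarith
  have h2 : √(√(Lf n)) ≤ √(mf n) := Real.le_sqrt_of_sq_le g.sm
  have h3 : √(√(Lf n)) / 4 ≤ mf n * (1 / √(mf n + 1)) := by
    rw [mul_one_div, le_div_iff₀ (Real.sqrt_pos.2 (by linarith))]
    have h4 : mf n = √(mf n) * √(mf n) := (Real.mul_self_sqrt (by linarith)).symm
    have h5 : √(√(Lf n)) * √(mf n + 1) ≤ √(mf n) * (2 * √(mf n)) :=
      mul_le_mul h2 h1 (Real.sqrt_nonneg _) (Real.sqrt_nonneg _)
    nlinarith
  linarith

lemma Good.t4 {n : ℕ} (g : Good n) : ((n : ℝ) + 1) ^ 5 * Real.exp (-3 * mf n ^ 2) ≤ ep n := by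
  rw [g.Npow, ← Real.exp_add, ep]
  apply Real.exp_le_exp.2
  push_cast
  have := g.msq
  have := g.ell
  have := g.sL
  have := g.L13
  linarith

lemma Good.t5 {n : ℕ} (g : Good n) : ((n : ℝ) + 1) ^ 4 * Real.exp (-(5 / 2) * mf n ^ 2) ≤ ep n := by
  rw [g.Npow, ← Real.exp_add, ep]
  apply Real.exp_le_exp.2
  push_cast
  have := g.msq
  have := g.ell
  have := g.sL
  have := g.L13
  linarith

lemma Good.t6 {n : ℕ} (g : Good n) : (n : ℝ) * gcdf (1 / 2) (-mf n) ≤ ep n := by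
  have hm := g.m1
  have b := tail2 (mf n) (by linarith)
  have h0 := gcdf_nonneg (1 / 2) (-mf n)
  have : (n : ℝ) * gcdf (1 / 2) (-mf n) ≤ ((n : ℝ) + 1) * Real.exp (-mf n ^ 2) := by
    apply mul_le_mul (by linarith) b h0 (by positivity)
  refine this.trans ?_
  rw [← exp_Lf, ← Real.exp_add, ep]
  apply Real.exp_le_exp.2
  have := g.msq
  have := g.ell
  have := g.sL
  have := g.L13
  linarith

lemma Good.t7 {n : ℕ} (g : Good n) : ((n : ℝ) + 1) ^ 3 * (1 - gcdf 1 (-mf n)) ^ n ≤ ep n := by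
  have hm := g.m1
  have hL := g.L13
  have hn : (1 : ℝ) ≤ n := by exact_mod_cast g.n1
  have e1 : (1 - gcdf 1 (-mf n)) ^ n ≤ Real.exp (-(n * gcdf 1 (-mf n))) := by
    have : 1 - gcdf 1 (-mf n) ≤ Real.exp (-gcdf 1 (-mf n)) := by
      linarith [Real.add_one_le_exp (-gcdf 1 (-mf n))]
    refine (pow_le_pow_left₀ (one_sub_gcdf_nonneg _ _) this n).trans (le_of_eq ?_)
    rw [← Real.exp_nat_mul]; congr 1; ring
  have e2 : Lf n ^ 2 / 4 ≤ n * gcdf 1 (-mf n) := by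
    have h1 : Real.exp (-mf n ^ 2 / 2) = Lf n ^ 3 / ((n : ℝ) + 1) := by
      have : -mf n ^ 2 / 2 = ((3 : ℕ) : ℝ) * Real.log (Lf n) - Lf n := by
        push_cast; linarith [g.msq]
      rw [this, Real.exp_sub, Real.exp_nat_mul, Real.exp_log (by linarith), exp_Lf]
    have h2 := g.cdf
    rw [h1] at h2
    have h3 : Lf n ^ 2 / (2 * ((n : ℝ) + 1)) ≤ Lf n ^ 3 / ((n : ℝ) + 1) / mf n ^ 2 := by
      rw [div_div, div_le_div_iff₀ (by positivity) (by positivity)]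
      have : Lf n ^ 2 * (((n : ℝ) + 1) * mf n ^ 2) ≤ Lf n ^ 2 * (((n : ℝ) + 1) * (2 * Lf n)) := by
        have := g.mhigh
        gcongr
      linarith
    have h4 := mul_le_mul_of_nonneg_left (h3.trans h2) (Nat.cast_nonneg (α := ℝ) n)
    refine le_trans ?_ h4
    rw [← mul_div_assoc, div_le_div_iff₀ (by norm_num) (by positivity)]
    nlinarith [sq_nonneg (Lf n)]
  refine (mul_le_mul_of_nonneg_left e1 (by positivity)).trans ?_
  rw [g.Npow, ← Real.exp_add, ep]
  apply Real.exp_le_exp.2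
  push_cast
  have := g.ell
  have := g.sL
  nlinarith

end GoeAux

namespace GoeAux
open Set Topology
open scoped NNReal ENNReal

lemma atBot_eventually {p : ℝ → Prop} (h : ∀ᶠ t in atBot, p t) :
    ∀ᶠ n in atTop, ∀ t ≤ -mf n, p t := by
  obtain ⟨a, ha⟩ := eventually_atBot.1 h
  filter_upwards [mf_tendsto.eventually_ge_atTop (-a)] with n hn t ht
  exact ha t (by linarith)

set_option maxHeartbeats 1000000 in
lemma upper_ev (r : ℝ) (hr : √Real.pi < r) : ∀ᶠ n : ℕ in atTop,
    ((n : ℝ) + 1) / √(Lf n) * ptwo (n + 1) ≤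
      5 * ep n + 2 * r * (mf n / √(Lf n)) + (2 * r + 96 * Real.exp 2) * (√(Lf n))⁻¹ := by
  have hr0 : 0 ≤ r := (Real.sqrt_nonneg _).trans hr.le
  have hR : ∀ᶠ t in atBot, gcdf (1 / 2) t ≤ r * (-t) * gcdf 1 t ^ 2 := by
    filter_upwards [ratio.eventually (gt_mem_nhds hr), eventually_lt_atBot 0] with t h1 h2
    have p1 := gcdf_pos (v := 1) one_ne_zero t
    have : 0 < -t := by linarith
    rw [div_lt_iff₀ (by positivity)] at h1
    linarith
  filter_upwards [good, atBot_eventually hR, atBot_eventually P3const] with n g h1 h2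
  have hm := g.m1
  have hL := g.L13
  have hn : (1 : ℝ) ≤ n := by exact_mod_cast g.n1
  have hu := ptwo_upper n (mf n) (8 * Real.exp 2) hm (by positivity) h2
  have hM := main_upper n (mf n) (mf n + 1) r (by linarith) (by linarith) hr0 h1
  have hcast : ((n - 1 : ℕ) : ℝ) = (n : ℝ) - 1 := by
    rw [Nat.cast_sub g.n1]; simp
  rw [gint3, hcast] at hu
  set N : ℝ := (n : ℝ) + 1 with hN
  set q := (1 - gcdf 1 (-mf n)) ^ n with hq
  have q0 : 0 ≤ q := pow_nonneg (one_sub_gcdf_nonneg _ _) _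
  have q1 : (1 - gcdf 1 (-mf n)) ^ (n + 1) ≤ q :=
    pow_le_pow_of_le_one (one_sub_gcdf_nonneg _ _) (one_sub_gcdf_le _ _) (Nat.le_succ n)
  have hN2 : 2 ≤ N := by linarith
  have t1 := g.t1
  have t2 := g.t2
  have t3 := g.t3
  have t7 := g.t7
  rw [← hN] at t1 t2 t3 t7
  have t8 : N * q ≤ ep n := by
    refine le_trans ?_ t7
    gcongr
    nlinarith [sq_nonneg N]
  have c1 : N ^ 3 * (r * (mf n + 1) * (2 / (N * (n + 2) * (n + 3)))) ≤ 2 * r * (mf n + 1) := by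
    have : N ^ 3 * (2 / (N * ((n : ℝ) + 2) * (n + 3))) ≤ 2 := by
      rw [mul_div_assoc', div_le_iff₀ (by positivity)]
      have e1 : N ≤ (n : ℝ) + 2 := by linarith
      have e2 : N ≤ (n : ℝ) + 3 := by linarith
      have : N * N * N ≤ N * ((n : ℝ) + 2) * (n + 3) := by gcongr
      nlinarith
    have h0 : 0 ≤ r * (mf n + 1) := mul_nonneg hr0 (by linarith)
    nlinarith [mul_le_mul_of_nonneg_left this h0]
  have c2 : N ^ 4 * (8 * Real.exp 2 * (6 / (((n : ℝ) - 1 + 1) * ((n : ℝ) - 1 + 2) *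
      ((n : ℝ) - 1 + 3) * ((n : ℝ) - 1 + 4)))) ≤ 96 * Real.exp 2 := by
    have e : ((n : ℝ) - 1 + 1) * ((n : ℝ) - 1 + 2) * ((n : ℝ) - 1 + 3) * ((n : ℝ) - 1 + 4) =
      n * N * ((n : ℝ) + 2) * (n + 3) := by rw [hN]; ring
    rw [e]
    have : N ^ 4 * (6 / (n * N * ((n : ℝ) + 2) * (n + 3))) ≤ 12 := by
      rw [mul_div_assoc', div_le_iff₀ (by positivity)]
      have e0 : N ≤ 2 * (n : ℝ) := by linarith
      have e1 : N ≤ (n : ℝ) + 2 := by linarith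
      have e2 : N ≤ (n : ℝ) + 3 := by linarith
      have : N * N * N * N ≤ 2 * n * N * ((n : ℝ) + 2) * (n + 3) := by gcongr
      nlinarith
    nlinarith [mul_le_mul_of_nonneg_left this (Real.exp_nonneg 2)]
  have key : N * ptwo (n + 1) ≤ 5 * ep n + 2 * r * (mf n + 1) + 96 * Real.exp 2 := by
    have hN0 : 0 ≤ N := by linarith
    have a1 := mul_le_mul_of_nonneg_left hu hN0
    have a2 := mul_le_mul_of_nonneg_left hM (pow_nonneg hN0 3)
    have a3 := mul_le_mul_of_nonneg_left q1 hN0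
    linarith
  have hs1 : 1 ≤ √(Lf n) := by rw [Real.one_le_sqrt]; linarith
  have hs0 : 0 < √(Lf n) := by linarith
  have hep : 0 ≤ ep n := Real.exp_nonneg _
  have : ((n : ℝ) + 1) / √(Lf n) * ptwo (n + 1) = N * ptwo (n + 1) / √(Lf n) := by ring
  rw [← hN] at this
  rw [this, div_le_iff₀ hs0]
  refine key.trans ?_
  have : (5 * ep n + 2 * r * (mf n / √(Lf n)) + (2 * r + 96 * Real.exp 2) * (√(Lf n))⁻¹) * √(Lf n) =
    5 * ep n * √(Lf n) + 2 * r * mf n + (2 * r + 96 * Real.exp 2) := by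
    field_simp
  rw [this]
  nlinarith [mul_le_mul_of_nonneg_left hs1 hep]

lemma lower_ev (r : ℝ) (hr0 : 0 ≤ r) (hr : r < √Real.pi) : ∀ᶠ n : ℕ in atTop,
    (1 - n * gcdf (1 / 2) (-mf n)) * (r * (mf n / √(Lf n))) *
      (2 * ((n : ℝ) / (n + 2)) * ((n + 1) / (n + 3)) -
        ((n : ℝ) + 1) ^ 2 * n * (1 - gcdf 1 (-mf n)) ^ n) - 4 * ep n ≤
    ((n : ℝ) + 1) / √(Lf n) * ptwo (n + 1) := by
  have hR : ∀ᶠ t in atBot, r * (-t) * gcdf 1 t ^ 2 ≤ gcdf (1 / 2) t := by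
    filter_upwards [ratio.eventually (lt_mem_nhds hr), eventually_lt_atBot 0] with t h1 h2
    have p1 := gcdf_pos (v := 1) one_ne_zero t
    have : 0 < -t := by linarith
    rw [lt_div_iff₀ (by positivity)] at h1
    linarith
  filter_upwards [good, atBot_eventually hR, ep_tendsto.eventually (gt_mem_nhds zero_lt_one)]
    with n g h1 hep1
  have hm := g.m1
  have hL := g.L13
  have hn : (1 : ℝ) ≤ n := by exact_mod_cast g.n1
  have hu := ptwo_lower n (mf n) (by linarith)
  have t6 := g.t6
  have hM := main_lower n (mf n) r (by linarith) hr0 h1 (by linarith)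
  set N : ℝ := (n : ℝ) + 1 with hN
  set q := (1 - gcdf 1 (-mf n)) ^ n with hq
  set I := ∫ t, (1 - gcdf 1 t) ^ n * (1 - gcdf (1 / 2) t) ^ n ∂(gaussianReal 0 1) with hI
  set b := 1 - n * gcdf (1 / 2) (-mf n) with hb
  have q0 : 0 ≤ q := pow_nonneg (one_sub_gcdf_nonneg _ _) _
  have q1 : (1 - gcdf 1 (-mf n)) ^ (n + 1) ≤ q :=
    pow_le_pow_of_le_one (one_sub_gcdf_nonneg _ _) (one_sub_gcdf_le _ _) (Nat.le_succ n)
  have hN2 : 2 ≤ N := by linarith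
  have t4 := g.t4
  have t5 := g.t5
  have t7 := g.t7
  rw [← hN] at t4 t5 t7
  have t8 : N * q ≤ ep n := by
    refine le_trans ?_ t7
    gcongr
    nlinarith [sq_nonneg N]
  have key : N * (N * (1 / N - I)) - 4 * ep n ≤ N * ptwo (n + 1) := by
    have hN0 : 0 ≤ N := by linarith
    have a1 := mul_le_mul_of_nonneg_left hu hN0
    have a3 := mul_le_mul_of_nonneg_left q1 hN0
    have a4 : N * (1 / N - I) = 1 - N * I := by field_simp
    rw [a4]
    linarith
  have key2 : b * (r * mf n) * (2 * ((n : ℝ) / (n + 2)) * (N / (n + 3)) - N ^ 2 * n * q) ≤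
      N * (N * (1 / N - I)) := by
    have := mul_le_mul_of_nonneg_left hM (show 0 ≤ N * N by positivity)
    calc _ = N * N * (n * b * (r * mf n) * (2 / (N * (n + 2) * (n + 3)) - q)) := by
          field_simp
      _ ≤ _ := this
      _ = _ := by ring
  have hs1 : 1 ≤ √(Lf n) := by rw [Real.one_le_sqrt]; linarith
  have hs0 : 0 < √(Lf n) := by linarith
  have hep : 0 ≤ ep n := Real.exp_nonneg _
  have : N / √(Lf n) * ptwo (n + 1) = N * ptwo (n + 1) / √(Lf n) := by ring
  rw [this, le_div_iff₀ hs0]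
  refine le_trans ?_ (le_trans (sub_le_sub_right key2 _) key)
  have : (b * (r * (mf n / √(Lf n))) * (2 * ((n : ℝ) / (n + 2)) * (N / (n + 3)) - N ^ 2 * n * q)
      - 4 * ep n) * √(Lf n) =
    b * (r * mf n) * (2 * ((n : ℝ) / (n + 2)) * (N / (n + 3)) - N ^ 2 * n * q)
      - 4 * ep n * √(Lf n) := by
    field_simp
  rw [this]
  nlinarith [mul_le_mul_of_nonneg_left hs1 hep]

lemma upper_lim (r : ℝ) : Tendsto (fun n : ℕ =>
    5 * ep n + 2 * r * (mf n / √(Lf n)) + (2 * r + 96 * Real.exp 2) * (√(Lf n))⁻¹) atTop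
    (𝓝 (2 * √2 * r)) := by
  have h1 : Tendsto (fun n => (√(Lf n))⁻¹) atTop (𝓝 0) :=
    (Real.tendsto_sqrt_atTop.comp Lf_tendsto).inv_tendsto_atTop
  have := ((ep_tendsto.const_mul 5).add (mf_ratio.const_mul (2 * r))).add
    (h1.const_mul (2 * r + 96 * Real.exp 2))
  convert this using 2
  ring

lemma frac_lim (a b : ℝ) : Tendsto (fun n : ℕ => ((n : ℝ) + a) / (n + b)) atTop (𝓝 1) := by
  have h : Tendsto (fun n : ℕ => (n : ℝ) + b) atTop atTop :=
    tendsto_atTop_add_const_right _ _ tendsto_natCast_atTop_atTop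
  have h2 := (h.inv_tendsto_atTop.const_mul (a - b)).const_add 1
  rw [mul_zero, add_zero] at h2
  refine h2.congr' ?_
  filter_upwards [h.eventually_gt_atTop 0] with n hn
  simp only [Pi.inv_apply]
  field_simp
  ring

lemma lower_lim (r : ℝ) : Tendsto (fun n : ℕ =>
    (1 - n * gcdf (1 / 2) (-mf n)) * (r * (mf n / √(Lf n))) *
      (2 * ((n : ℝ) / (n + 2)) * ((n + 1) / (n + 3)) -
        ((n : ℝ) + 1) ^ 2 * n * (1 - gcdf 1 (-mf n)) ^ n) - 4 * ep n) atTop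
    (𝓝 (2 * √2 * r)) := by
  have h1 : Tendsto (fun n : ℕ => (n : ℝ) * gcdf (1 / 2) (-mf n)) atTop (𝓝 0) := by
    refine squeeze_zero' (Eventually.of_forall fun n => mul_nonneg (Nat.cast_nonneg n)
      (gcdf_nonneg _ _)) ?_ ep_tendsto
    filter_upwards [good] with n g using g.t6
  have h2 : Tendsto (fun n : ℕ => ((n : ℝ) + 1) ^ 2 * n * (1 - gcdf 1 (-mf n)) ^ n) atTop
      (𝓝 0) := by
    refine squeeze_zero' (Eventually.of_forall fun n => mul_nonneg (by positivity)
      (pow_nonneg (one_sub_gcdf_nonneg _ _) _)) ?_ ep_tendsto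
    filter_upwards [good] with n g
    refine le_trans ?_ g.t7
    have := pow_nonneg (one_sub_gcdf_nonneg 1 (-mf n)) n
    have : ((n : ℝ) + 1) ^ 2 * n ≤ ((n : ℝ) + 1) ^ 3 := by nlinarith [sq_nonneg ((n : ℝ) + 1)]
    gcongr
  have h3 := frac_lim 0 2
  have h4 := frac_lim 1 3
  simp only [add_zero] at h3
  have := (((h1.const_sub 1).mul (mf_ratio.const_mul r)).mul
    (((h3.const_mul 2).mul h4).sub h2)).sub (ep_tendsto.const_mul 4)
  convert this using 2
  ring

lemma final_lim : Tendsto (fun n : ℕ => ((n : ℝ) + 1) / √(Lf n) * ptwo (n + 1)) atTop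
    (𝓝 (2 * √(2 * Real.pi))) := by
  have hlim : 2 * √(2 * Real.pi) = 2 * √2 * √Real.pi := by
    rw [Real.sqrt_mul (by norm_num)]; ring
  have h2 : 0 < 2 * √2 := by positivity
  have hpi : 0 < √Real.pi := Real.sqrt_pos.2 Real.pi_pos
  rw [hlim]
  refine tendsto_order.2 ⟨fun a ha => ?_, fun a ha => ?_⟩
  · have ha' : max (a / (2 * √2)) 0 < √Real.pi := by
      refine max_lt ?_ hpi
      rw [div_lt_iff₀ h2]; linarith
    obtain ⟨r, hr1, hr2⟩ := exists_between ha'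
    have hr0 : 0 ≤ r := (le_max_right _ _).trans hr1.le
    have har : a < 2 * √2 * r := by
      have := (le_max_left _ _).trans_lt hr1
      rw [div_lt_iff₀ h2] at this; linarith
    filter_upwards [lower_ev r hr0 hr2, (lower_lim r).eventually (lt_mem_nhds har)] with n e1 e2
    exact e2.trans_le e1
  · have ha' : √Real.pi < a / (2 * √2) := by
      rw [lt_div_iff₀ h2]; linarith
    obtain ⟨r, hr1, hr2⟩ := exists_between ha'
    have har : 2 * √2 * r < a := by
      rw [lt_div_iff₀ h2] at hr2; linarith
    filter_upwards [upper_ev r hr1, (upper_lim r).eventually (gt_mem_nhds har)] with n e1 e2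
    exact e1.trans_lt e2

end GoeAux

/-- Under the GOE model, the probability that some global minimizer of
`x ↦ xᵀQx` over the standard simplex has support of cardinality exactly 2
satisfies `(n/√(log n)) · μ_n(event) → 2√(2π)`. -/
theorem goe_support_two_probability_asymptotics :
    Tendsto (fun n : ℕ =>
        ((n : ℝ) / Real.sqrt (Real.log n)) *
          (goeMeasure n {Q | ∃ x ∈ stdSimplex ℝ (Fin n),
              (∀ y ∈ stdSimplex ℝ (Fin n), x ⬝ᵥ Q.mulVec x ≤ y ⬝ᵥ Q.mulVec y) ∧
              {i | 0 < x i}.ncard = 2}).toReal)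
      atTop (nhds (2 * Real.sqrt (2 * Real.pi))) := by
  rw [← tendsto_add_atTop_iff_nat 1]
  refine GoeAux.final_lim.congr fun n => ?_
  rw [GoeAux.goeMeasure_apply]
  unfold GoeAux.ptwo GoeAux.Lf
  push_cast
  congr 2
  ext ω
  simp only [Set.mem_ofPred_eq, GoeAux.IsMinim, and_assoc]
end

section
/- Fix a real number a ≥ 1. Let Z₁, …, Z_n be i.i.d. standard normal N(0,1) random variables and let Y be an N(0, 1/a²) random variable independent of (Z₁,…,Z_n). Then lim_{n→∞} n^{a²} (log n)^{-(a²-1)/2} · P(Y ≤ min_{1≤i≤n} Z_i) = (4π)^{(a²-1)/2} Γ(a²+1) / a. Moreover there is a constant C_a < ∞ such that P(Y ≤ min_{1≤i≤n} Z_i) ≤ C_a · n^{-a²} (log n)^{(a²-1)/2} for all n ≥ 2. -/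
open MeasureTheory ProbabilityTheory Filter

/-- The probability `P(Y ≤ min_{1≤i≤n} Z_i)` where `Y ~ N(0,1/a²)` is
independent of the i.i.d. standard normals `Z₁,…,Z_n`, realized on the
product space `ℝ × (Fin n → ℝ)` with law `N(0,1/a²) ⊗ N(0,1)^{⊗n}`. -/
noncomputable def probNormalBelowMin (a : ℝ) (n : ℕ) : ℝ :=
  (((gaussianReal 0 (Real.toNNReal (1 / a ^ 2))).prod
      (Measure.pi fun _ : Fin n => gaussianReal 0 1))
    {ω : ℝ × (Fin n → ℝ) | ω.1 ≤ ⨅ i : Fin n, ω.2 i}).toReal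

noncomputable def nbmPhi (y : ℝ) : ℝ := cdf (gaussianReal 0 1) y

noncomputable def nbmphi (y : ℝ) : ℝ := gaussianPDFReal 0 1 y

lemma nbmphi_eq (y : ℝ) : nbmphi y = (√(2 * Real.pi))⁻¹ * Real.exp (-y ^ 2 / 2) := by
  simp [nbmphi, gaussianPDFReal]

lemma nbmphi_pos (y : ℝ) : 0 < nbmphi y := by
  rw [nbmphi_eq]; positivity

lemma nbmPhi_eq (y : ℝ) : nbmPhi y = ∫ x in Set.Iic y, nbmphi x := by
  rw [nbmPhi, cdf_eq_real, Measure.real, gaussianReal_apply_eq_integral _ one_ne_zero,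
    ENNReal.toReal_ofReal]
  · rfl
  · exact integral_nonneg fun x => gaussianPDFReal_nonneg _ _ _

lemma nbmphi_cont : Continuous nbmphi := by
  have : nbmphi = fun y => (√(2 * Real.pi))⁻¹ * Real.exp (-y ^ 2 / 2) := funext nbmphi_eq
  rw [this]; fun_prop

lemma nbmPhi_hasDeriv (y : ℝ) : HasDerivAt nbmPhi (nbmphi y) y := by
  have hi : Integrable nbmphi := integrable_gaussianPDFReal 0 1
  have h : nbmPhi = fun z => nbmPhi 0 + ∫ x in (0:ℝ)..z, nbmphi x := by
    funext z
    rw [← intervalIntegral.integral_Iic_sub_Iic hi.integrableOn hi.integrableOn,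
      nbmPhi_eq z, nbmPhi_eq 0]
    ring
  rw [h]
  refine HasDerivAt.const_add _ ?_
  exact nbmphi_cont.integral_hasStrictDerivAt 0 y |>.hasDerivAt

lemma nbmPhi_strictMono : StrictMono nbmPhi :=
  strictMono_of_hasDerivAt_pos nbmPhi_hasDeriv nbmphi_pos

lemma nbmPhi_cont : Continuous nbmPhi :=
  continuous_iff_continuousAt.2 fun y => (nbmPhi_hasDeriv y).continuousAt

lemma nbmPhi_pos (y : ℝ) : 0 < nbmPhi y :=
  lt_of_le_of_lt (cdf_nonneg _ _) (nbmPhi_strictMono (sub_one_lt y))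

lemma nbmPhi_lt_one (y : ℝ) : nbmPhi y < 1 :=
  lt_of_lt_of_le (nbmPhi_strictMono (lt_add_one y)) (cdf_le_one _ _)

lemma nbmPhi_atBot : Tendsto nbmPhi atBot (nhds 0) := tendsto_cdf_atBot _
lemma nbmPhi_atTop : Tendsto nbmPhi atTop (nhds 1) := tendsto_cdf_atTop _

lemma nbmPhi_surj {u : ℝ} (h0 : 0 < u) (h1 : u < 1) : ∃ y, nbmPhi y = u := by
  obtain ⟨y, hy⟩ := (nbmPhi_atBot.eventually_lt_const h0).exists
  obtain ⟨z, hz⟩ := (nbmPhi_atTop.eventually_const_lt h1).exists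
  exact mem_range_of_exists_le_of_exists_ge nbmPhi_cont ⟨y, hy.le⟩ ⟨z, hz.le⟩

/-- Mills ratio. -/
lemma nbm_mills : Tendsto (fun y => nbmPhi y / (-(nbmphi y) / y)) atBot (nhds 1) := by
  have hd : ∀ y, HasDerivAt nbmphi (-y * nbmphi y) y := by
    intro y
    have h : nbmphi = fun y => (√(2 * Real.pi))⁻¹ * Real.exp (-y ^ 2 / 2) := funext nbmphi_eq
    rw [h]
    have := (((hasDerivAt_pow 2 y).neg.div_const 2).exp).const_mul ((√(2 * Real.pi))⁻¹)
    convert! this using 1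
    simp; ring
  have hne : ∀ᶠ y : ℝ in atBot, y < 0 := eventually_lt_atBot 0
  refine HasDerivAt.lhopital_zero_atBot (f' := nbmphi)
    (g' := fun y => nbmphi y * (1 + 1 / y ^ 2)) (Eventually.of_forall nbmPhi_hasDeriv) ?_ ?_
    nbmPhi_atBot ?_ ?_
  · filter_upwards [hne] with y hy
    have := ((hd y).neg.div (hasDerivAt_id y) hy.ne)
    convert! this using 1
    have hy0 := hy.ne
    simp only [id, Pi.neg_apply]; field_simp; ring
  · filter_upwards [hne] with y hy
    have := nbmphi_pos y
    positivity
  · have h1 : Tendsto (fun y : ℝ => y⁻¹) atBot (nhds 0) := tendsto_inv_atBot_zero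
    have h2 : Tendsto (fun y : ℝ => (√(2 * Real.pi))⁻¹ * |y⁻¹|) atBot (nhds 0) := by
      simpa using h1.abs.const_mul ((√(2 * Real.pi))⁻¹)
    refine squeeze_zero_norm (fun y => ?_) h2
    rw [norm_div, norm_neg, Real.norm_of_nonneg (nbmphi_pos y).le, div_eq_mul_inv, ← norm_inv,
      Real.norm_eq_abs]
    gcongr
    rw [nbmphi_eq]
    have : Real.exp (-y ^ 2 / 2) ≤ 1 := Real.exp_le_one_iff.2 (by nlinarith [sq_nonneg y])
    exact mul_le_of_le_one_right (by positivity) this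
  · have h1 : Tendsto (fun y : ℝ => y⁻¹) atBot (nhds 0) := tendsto_inv_atBot_zero
    have h2 : Tendsto (fun y : ℝ => (1 + y⁻¹ ^ 2)⁻¹) atBot (nhds 1) := by
      have := ((h1.pow 2).const_add 1).inv₀ (by norm_num)
      simpa using this
    refine h2.congr fun y => ?_
    have := (nbmphi_pos y).ne'
    rw [← div_div, div_self this]
    simp

lemma nbm_log : Tendsto (fun y => -Real.log (nbmPhi y) / y ^ 2) atBot (nhds (1 / 2)) := by
  have h1 : Tendsto (fun y : ℝ => y⁻¹) atBot (nhds 0) := tendsto_inv_atBot_zero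
  have h1' : Tendsto (fun y : ℝ => y⁻¹ ^ 2) atBot (nhds 0) := by simpa using h1.pow 2
  have hl : Tendsto (fun y : ℝ => Real.log y * y⁻¹ ^ 2) atBot (nhds 0) := by
    have h := (isLittleO_log_rpow_atTop (r := 2) two_pos).tendsto_div_nhds_zero
    have h' := h.comp tendsto_neg_atBot_atTop
    refine h'.congr fun y => ?_
    simp [div_eq_mul_inv]
  have hr := (nbm_mills.log one_ne_zero)
  rw [Real.log_one] at hr
  have hsum := (((hr.neg.const_add (Real.log (√(2 * Real.pi)))).mul h1').add hl).add_const (1 / 2)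
  rw [mul_zero, zero_add, zero_add] at hsum
  refine hsum.congr' ?_
  filter_upwards [eventually_lt_atBot (0 : ℝ)] with y hy
  have hp := nbmphi_pos y
  have hP := nbmPhi_pos y
  have e : Real.log (nbmPhi y / (-(nbmphi y) / y)) =
      Real.log (nbmPhi y) + Real.log √(2 * Real.pi) + y ^ 2 / 2 + Real.log y := by
    rw [Real.log_div hP.ne' (div_ne_zero (neg_ne_zero.2 hp.ne') hy.ne),
      Real.log_div (neg_ne_zero.2 hp.ne') hy.ne, Real.log_neg_eq_log, nbmphi_eq,
      Real.log_mul (by positivity) (by positivity), Real.log_exp, Real.log_inv]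
    ring
  rw [e]
  have := hy.ne
  field_simp
  ring

lemma nbm_R : Tendsto (fun y => Real.exp (-y ^ 2) / (nbmPhi y ^ 2 * (-Real.log (nbmPhi y))))
    atBot (nhds (4 * Real.pi)) := by
  have h := ((nbm_mills.pow 2).mul nbm_log).inv₀ (by norm_num) |>.const_mul (2 * Real.pi)
  have e : 2 * Real.pi * (1 ^ 2 * (1 / 2))⁻¹ = 4 * Real.pi := by norm_num; ring
  rw [e] at h
  refine h.congr' ?_
  filter_upwards [eventually_lt_atBot (0 : ℝ)] with y hy
  have hP := nbmPhi_pos y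
  have hl : Real.log (nbmPhi y) < 0 := Real.log_neg hP (nbmPhi_lt_one y)
  have e2 : Real.exp (-y ^ 2) = 2 * Real.pi * nbmphi y ^ 2 := by
    rw [nbmphi_eq, mul_pow, inv_pow, Real.sq_sqrt (by positivity), ← Real.exp_nat_mul]
    rw [show ((2 : ℕ) : ℝ) * (-y ^ 2 / 2) = -y ^ 2 by push_cast; ring]
    field_simp
  rw [e2]
  have := (nbmphi_pos y).ne'
  have := hy.ne
  have := hl.ne
  have := hP.ne'
  field_simp

/-- the inverse -/
noncomputable def nbmPsi : ℝ → ℝ := Function.invFun nbmPhi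

lemma nbmPsi_left (y : ℝ) : nbmPsi (nbmPhi y) = y :=
  Function.leftInverse_invFun nbmPhi_strictMono.injective y

lemma nbmPsi_right {u : ℝ} (h0 : 0 < u) (h1 : u < 1) : nbmPhi (nbmPsi u) = u :=
  Function.invFun_eq (nbmPhi_surj h0 h1)

lemma nbmPsi_mono : MonotoneOn nbmPsi (Set.Ioo 0 1) := by
  intro u hu v hv h
  rw [← nbmPhi_strictMono.le_iff_le, nbmPsi_right hu.1 hu.2, nbmPsi_right hv.1 hv.2]
  exact h

lemma nbmPsi_tendsto : Tendsto nbmPsi (nhdsWithin 0 (Set.Ioi 0)) atBot := by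
  rw [tendsto_atBot]
  intro b
  filter_upwards [Ioo_mem_nhdsGT (nbmPhi_pos b)] with u hu
  rw [← nbmPhi_strictMono.le_iff_le, nbmPsi_right hu.1 (hu.2.trans (nbmPhi_lt_one b))]
  exact hu.2.le

noncomputable def nbmK (u : ℝ) : ℝ := Real.exp (-nbmPsi u ^ 2)

lemma nbmK_asymp : Tendsto (fun u => nbmK u / (u ^ 2 * (-Real.log u)))
    (nhdsWithin 0 (Set.Ioi 0)) (nhds (4 * Real.pi)) := by
  refine (nbm_R.comp nbmPsi_tendsto).congr' ?_
  filter_upwards [Ioo_mem_nhdsGT one_pos] with u hu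
  simp only [Function.comp, nbmPsi_right hu.1 hu.2, nbmK]

lemma nbmK_bound : ∃ C : ℝ, 0 < C ∧ ∀ u, 0 < u → u < 1 → nbmK u ≤ C * (u ^ 2 * (1 - Real.log u)) := by
  have h := nbmK_asymp.eventually_lt_const (show 4 * Real.pi < 4 * Real.pi + 1 by linarith)
  obtain ⟨v, hv, hb⟩ := (mem_nhdsGT_iff_exists_Ioo_subset).1 h
  have hv : 0 < v := hv
  refine ⟨4 * Real.pi + 1 + 1 / v ^ 2, by positivity, fun u h0 h1 => ?_⟩
  have hl : Real.log u < 0 := Real.log_neg h0 h1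
  have hu2 : 0 < u ^ 2 := by positivity
  have hpi := Real.pi_pos
  have hv2 : 0 < 1 / v ^ 2 := by positivity
  by_cases huv : u < v
  · have := hb ⟨h0, huv⟩
    simp only [Set.mem_ofPred_eq] at this
    rw [div_lt_iff₀ (mul_pos hu2 (neg_pos.2 hl))] at this
    refine this.le.trans ?_
    have : u ^ 2 * -Real.log u ≤ u ^ 2 * (1 - Real.log u) := by nlinarith
    have h3 : 0 < u ^ 2 * -Real.log u := mul_pos hu2 (neg_pos.2 hl)
    exact mul_le_mul (by linarith) this h3.le (by positivity)
  · push Not at huv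
    have hK : nbmK u ≤ 1 := Real.exp_le_one_iff.2 (by nlinarith [sq_nonneg (nbmPsi u)])
    have h2 : 1 ≤ 1 / v ^ 2 * u ^ 2 := by
      rw [one_div, inv_mul_eq_div, one_le_div (by positivity)]
      gcongr
    calc nbmK u ≤ 1 := hK
      _ ≤ 1 / v ^ 2 * u ^ 2 := h2
      _ ≤ (4 * Real.pi + 1 + 1 / v ^ 2) * (u ^ 2 * (1 - Real.log u)) := by
        gcongr
        · linarith
        · nlinarith

lemma nbm_prob_eq (a : ℝ) (ha : 1 ≤ a) (n : ℕ) (hn : n ≠ 0) :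
    probNormalBelowMin a n =
      ∫ y, gaussianPDFReal 0 (Real.toNNReal (1 / a ^ 2)) y * (1 - nbmPhi y) ^ n := by
  have hv : Real.toNNReal (1 / a ^ 2) ≠ 0 := by
    have : 0 < 1 / a ^ 2 := by positivity
    exact (Real.toNNReal_pos.2 this).ne'
  have : Nonempty (Fin n) := ⟨⟨0, Nat.pos_of_ne_zero hn⟩⟩
  have hset : {ω : ℝ × (Fin n → ℝ) | ω.1 ≤ ⨅ i : Fin n, ω.2 i} =
      ⋂ i : Fin n, {ω : ℝ × (Fin n → ℝ) | ω.1 ≤ ω.2 i} := by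
    ext ω
    rw [Set.mem_iInter]
    exact le_ciInf_iff (a := ω.1) (f := fun i => ω.2 i) (Set.finite_range _).bddBelow
  have hmeas : MeasurableSet {ω : ℝ × (Fin n → ℝ) | ω.1 ≤ ⨅ i : Fin n, ω.2 i} := by
    rw [hset]
    refine MeasurableSet.iInter fun i => measurableSet_le measurable_fst ?_
    exact (measurable_pi_apply i).comp measurable_snd
  have hsec : ∀ y : ℝ, (Measure.pi fun _ : Fin n => gaussianReal 0 1)
      (Prod.mk y ⁻¹' {ω : ℝ × (Fin n → ℝ) | ω.1 ≤ ⨅ i : Fin n, ω.2 i}) =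
      (gaussianReal 0 1 (Set.Ici y)) ^ n := by
    intro y
    have : (Prod.mk y ⁻¹' {ω : ℝ × (Fin n → ℝ) | ω.1 ≤ ⨅ i : Fin n, ω.2 i}) =
        Set.univ.pi fun _ : Fin n => Set.Ici y := by
      rw [hset]; ext z; simp [Pi.le_def]
    rw [this, Measure.pi_pi]
    simp
  have hIci : ∀ y : ℝ, (gaussianReal 0 1 (Set.Ici y)).toReal = 1 - nbmPhi y := by
    intro y
    have := nullSingletonClass_gaussianReal (μ := 0) (v := 1) one_ne_zero
    rw [nbmPhi, cdf_eq_real, ← probReal_compl_eq_one_sub measurableSet_Iic, Set.compl_Iic,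
      Measure.real]
    congr 1
    exact (measure_congr Ioi_ae_eq_Ici).symm
  rw [probNormalBelowMin, Measure.prod_apply hmeas]
  simp_rw [hsec]
  rw [← integral_toReal, integral_gaussianReal_eq_integral_smul hv]
  · simp only [ENNReal.toReal_pow, hIci, smul_eq_mul]
  · have : Antitone fun y : ℝ => (gaussianReal 0 1 (Set.Ici y)) ^ n := by
      intro x y h
      exact pow_le_pow_left₀ zero_le (measure_mono (Set.Ici_subset_Ici.2 h)) n
    exact this.measurable.aemeasurable
  · exact Eventually.of_forall fun y => ENNReal.pow_lt_top (measure_lt_top _ _)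

lemma nbm_pdf (a : ℝ) (ha : 1 ≤ a) (y : ℝ) :
    gaussianPDFReal 0 (Real.toNNReal (1 / a ^ 2)) y =
      a * nbmphi y * (Real.exp (-y ^ 2)) ^ ((a ^ 2 - 1) / 2) := by
  have ha0 : 0 < a := by linarith
  rw [nbmphi_eq, gaussianPDFReal, Real.coe_toNNReal _ (by positivity), ← Real.exp_mul, ← mul_assoc,
    mul_assoc (a * _), ← Real.exp_add]
  congr 1
  · rw [mul_one_div, Real.sqrt_div (by positivity), Real.sqrt_sq ha0.le]
    field_simp
  · congr 1
    field_simp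
    ring

noncomputable def nbmF (a : ℝ) (n : ℕ) (s : ℝ) : ℝ :=
  a * (1 - s / n) ^ n * ((n : ℝ) ^ 2 / Real.log n * nbmK (s / n)) ^ ((a ^ 2 - 1) / 2)

lemma nbm_image (n : ℕ) (hn : n ≠ 0) :
    (fun y => (n : ℝ) * nbmPhi y) '' Set.univ = Set.Ioo 0 (n : ℝ) := by
  have hn0 : (0 : ℝ) < n := by positivity
  ext s
  simp only [Set.image_univ, Set.mem_range, Set.mem_Ioo]
  constructor
  · rintro ⟨y, rfl⟩
    exact ⟨mul_pos hn0 (nbmPhi_pos y), mul_lt_of_lt_one_right hn0 (nbmPhi_lt_one y)⟩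
  · rintro ⟨h0, h1⟩
    obtain ⟨y, hy⟩ := nbmPhi_surj (u := s / n) (by positivity) ((div_lt_one hn0).2 h1)
    exact ⟨y, by rw [hy]; field_simp⟩

lemma nbm_scaled (a : ℝ) (ha : 1 ≤ a) (n : ℕ) (hn : 2 ≤ n) :
    (n : ℝ) ^ (a ^ 2) * (Real.log n) ^ (-((a ^ 2 - 1) / 2)) * probNormalBelowMin a n =
      ∫ s in Set.Ioi 0, (Set.Ioo 0 (n : ℝ)).indicator (nbmF a n) s := by
  have hn0 : (0 : ℝ) < n := by positivity
  have hl : 0 < Real.log n := Real.log_pos (by exact_mod_cast hn)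
  rw [setIntegral_indicator measurableSet_Ioo,
    Set.inter_eq_right.2 (Set.Ioo_subset_Ioi_self), ← nbm_image n (by omega),
    integral_image_eq_integral_abs_deriv_smul (f' := fun y => n * nbmphi y) MeasurableSet.univ
      (fun y _ => ((nbmPhi_hasDeriv y).const_mul _).hasDerivWithinAt)
      (fun x _ y _ h => nbmPhi_strictMono.injective (mul_left_cancel₀ hn0.ne' h)),
    setIntegral_univ, nbm_prob_eq a ha n (by omega), ← integral_const_mul]
  congr 1
  funext y
  have hp := nbmphi_pos y
  rw [nbm_pdf a ha, nbmF, mul_div_cancel_left₀ _ hn0.ne', nbmK, nbmPsi_left,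
    abs_of_pos (mul_pos hn0 hp), smul_eq_mul, Real.mul_rpow (by positivity) (by positivity),
    Real.div_rpow (by positivity) hl.le, Real.rpow_neg hl.le, ← Real.rpow_natCast_mul hn0.le,
    show (a ^ 2 : ℝ) = 1 + ((2 : ℕ) : ℝ) * ((a ^ 2 - 1) / 2) by push_cast; ring,
    Real.rpow_add hn0, Real.rpow_one]
  push_cast
  ring_nf

lemma nbm_pointwise (a : ℝ) (ha : 1 ≤ a) (s : ℝ) (hs : 0 < s) :
    Tendsto (fun n : ℕ => (Set.Ioo 0 (n : ℝ)).indicator (nbmF a n) s) atTop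
      (nhds (a * Real.exp (-s) * (s ^ 2 * (4 * Real.pi)) ^ ((a ^ 2 - 1) / 2))) := by
  have hc : 0 ≤ (a ^ 2 - 1) / 2 := by nlinarith
  have hnat : Tendsto (fun n : ℕ => (n : ℝ)) atTop atTop := tendsto_natCast_atTop_atTop
  have h1 : Tendsto (fun n : ℕ => (1 - s / n) ^ n) atTop (nhds (Real.exp (-s))) := by
    refine (Real.tendsto_one_add_div_pow_exp (-s)).congr fun n => ?_
    rw [neg_div, sub_eq_add_neg]
  have h2 : Tendsto (fun n : ℕ => s / (n : ℝ)) atTop (nhdsWithin 0 (Set.Ioi 0)) := by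
    refine tendsto_nhdsWithin_iff.2 ⟨hnat.const_div_atTop s, ?_⟩
    filter_upwards [eventually_gt_atTop 0] with n hn
    have : (0 : ℝ) < n := by positivity
    exact div_pos hs this
  have h3 := nbmK_asymp.comp h2
  have h4 : Tendsto (fun n : ℕ => s ^ 2 * (1 - Real.log s * (Real.log n)⁻¹)) atTop
      (nhds (s ^ 2)) := by
    have := ((((Real.tendsto_log_atTop.comp hnat).inv_tendsto_atTop).const_mul
      (Real.log s)).const_sub 1).const_mul (s ^ 2)
    simpa using this
  have h5 := (h4.mul h3).rpow_const (p := (a ^ 2 - 1) / 2) (Or.inr hc)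
  refine ((h1.const_mul a).mul h5).congr' ?_
  filter_upwards [eventually_ge_atTop 2, hnat.eventually_gt_atTop s] with n hn hns
  have hn0 : (0 : ℝ) < n := by positivity
  have hl : 0 < Real.log n := Real.log_pos (by exact_mod_cast hn)
  rw [Set.indicator_of_mem (show s ∈ Set.Ioo 0 (n : ℝ) from ⟨hs, hns⟩), nbmF]
  congr 2
  have hlt : Real.log s - Real.log n < 0 := sub_neg.2 (Real.log_lt_log hs hns)
  simp only [Function.comp]
  rw [Real.log_div hs.ne' hn0.ne']
  have h6 : -(Real.log s - Real.log n) ≠ 0 := by linarith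
  have h7 : s ^ 2 * (1 - Real.log s * (Real.log n)⁻¹) =
      s ^ 2 * (-(Real.log s - Real.log n)) / Real.log n := by field_simp; ring
  rw [h7]
  generalize -(Real.log s - Real.log n) = L at *
  field_simp

lemma nbm_dom (a : ℝ) (ha : 1 ≤ a) : ∃ A : ℝ, 0 ≤ A ∧ ∀ n : ℕ, 2 ≤ n → ∀ s : ℝ,
    ‖(Set.Ioo 0 (n : ℝ)).indicator (nbmF a n) s‖ ≤ A * Real.exp (-(1 / 2) * s) := by
  obtain ⟨C, hC, hK⟩ := nbmK_bound
  have ha0 : 0 < a := by linarith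
  set c := (a ^ 2 - 1) / 2 with hcdef
  have hc : 0 ≤ c := by rw [hcdef]; nlinarith
  have hl2 : 0 < Real.log 2 := Real.log_pos one_lt_two
  set δ : ℝ := 1 / (4 * (c + 1)) with hδ
  have hδ0 : 0 < δ := by positivity
  have hδ1 : δ ≤ 1 := by
    rw [hδ, div_le_one (by positivity)]; linarith
  have hδc : 2 * δ * c ≤ 1 / 2 := by
    rw [hδ]; field_simp; linarith
  set D : ℝ := C * (1 + 1 / Real.log 2) with hD
  have hD0 : 0 < D := by positivity
  refine ⟨a * (D * (1 / δ) ^ 2) ^ c, by positivity, fun n hn s => ?_⟩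
  by_cases hs : s ∈ Set.Ioo 0 (n : ℝ)
  swap
  · rw [Set.indicator_of_notMem hs, norm_zero]; positivity
  rw [Set.indicator_of_mem hs]
  obtain ⟨h0, h1⟩ := hs
  have hn0 : (0 : ℝ) < n := by positivity
  have hl : Real.log 2 ≤ Real.log n := Real.log_le_log two_pos (by exact_mod_cast hn)
  have hl0 : 0 < Real.log n := hl2.trans_le hl
  have hKp : 0 < nbmK (s / n) := Real.exp_pos _
  have hsn : 0 ≤ 1 - s / n := by rw [sub_nonneg, div_le_one hn0]; exact h1.le
  have e1 : (n : ℝ) ^ 2 / Real.log n * nbmK (s / n) ≤ D * (1 + s) ^ 2 := by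
    have hk := hK (s / n) (by positivity) ((div_lt_one hn0).2 h1)
    rw [Real.log_div h0.ne' hn0.ne'] at hk
    have hlogs : -Real.log s ≤ 1 / s - 1 := by
      have := Real.log_le_sub_one_of_pos (x := 1 / s) (by positivity)
      rwa [one_div, Real.log_inv, ← one_div] at this
    calc (n : ℝ) ^ 2 / Real.log n * nbmK (s / n)
        ≤ (n : ℝ) ^ 2 / Real.log n * (C * ((s / n) ^ 2 * (1 - (Real.log s - Real.log n)))) := by
          gcongr
      _ = C * (s ^ 2 * (1 + (1 - Real.log s) / Real.log n)) := by
          field_simp; ring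
      _ ≤ C * (s ^ 2 * (1 + (1 / s) / Real.log 2)) := by
          have : (1 - Real.log s) / Real.log n ≤ (1 / s) / Real.log 2 :=
            (div_le_div_of_nonneg_right (by linarith) hl0.le).trans
              (div_le_div_of_nonneg_left (by positivity) hl2 hl)
          gcongr
      _ = C * (s ^ 2 + s * (1 / Real.log 2)) := by field_simp
      _ ≤ C * ((1 + s) ^ 2 + (1 + s) ^ 2 * (1 / Real.log 2)) := by
          gcongr
          · linarith
          · nlinarith
      _ = D * (1 + s) ^ 2 := by rw [hD]; ring
  have e2 : 1 + s ≤ 1 / δ * Real.exp (δ * s) := by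
    have := Real.add_one_le_exp (δ * s)
    rw [one_div, inv_mul_eq_div, le_div_iff₀ hδ0]
    nlinarith
  have e3 : ((n : ℝ) ^ 2 / Real.log n * nbmK (s / n)) ^ c ≤
      (D * (1 / δ) ^ 2) ^ c * Real.exp (s / 2) := by
    calc ((n : ℝ) ^ 2 / Real.log n * nbmK (s / n)) ^ c
        ≤ (D * (1 / δ * Real.exp (δ * s)) ^ 2) ^ c := by
          refine Real.rpow_le_rpow (by positivity) (e1.trans ?_) hc
          gcongr
      _ = (D * (1 / δ) ^ 2 * Real.exp (2 * δ * s)) ^ c := by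
          have hexp : Real.exp (2 * δ * s) = Real.exp (δ * s) ^ 2 := by
            rw [← Real.exp_nat_mul]; push_cast; ring_nf
          rw [hexp, mul_pow, ← mul_assoc]
      _ = (D * (1 / δ) ^ 2) ^ c * Real.exp (2 * δ * s * c) := by
          rw [Real.mul_rpow (by positivity) (by positivity), ← Real.exp_mul]
      _ ≤ _ := by
          gcongr
          nlinarith
  have e4 := Real.one_sub_div_pow_le_exp_neg h1.le
  rw [nbmF, Real.norm_of_nonneg (by positivity)]
  calc _ ≤ a * Real.exp (-s) * ((D * (1 / δ) ^ 2) ^ c * Real.exp (s / 2)) := by gcongr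
    _ = _ := by
      rw [show -(1 / 2) * s = -s + s / 2 by ring, Real.exp_add]; ring

lemma nbm_meas (a : ℝ) (n : ℕ) (hn : 2 ≤ n) :
    AEStronglyMeasurable ((Set.Ioo 0 (n : ℝ)).indicator (nbmF a n))
      (volume.restrict (Set.Ioi 0)) := by
  have hn0 : (0 : ℝ) < n := by positivity
  refine AEStronglyMeasurable.restrict ?_
  rw [aestronglyMeasurable_indicator_iff measurableSet_Ioo]
  have hm : MonotoneOn (fun s : ℝ => nbmPsi (s / n)) (Set.Ioo 0 (n : ℝ)) := by
    intro s hs t ht h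
    refine nbmPsi_mono ⟨div_pos hs.1 hn0, (div_lt_one hn0).2 hs.2⟩
      ⟨div_pos ht.1 hn0, (div_lt_one hn0).2 ht.2⟩ ?_
    gcongr
  have := aemeasurable_restrict_of_monotoneOn (μ := volume) measurableSet_Ioo hm
  refine AEMeasurable.aestronglyMeasurable ?_
  unfold nbmF nbmK
  fun_prop

lemma nbm_tendsto (a : ℝ) (ha : 1 ≤ a) :
    Tendsto (fun n : ℕ =>
        (n : ℝ) ^ (a ^ 2) * (Real.log n) ^ (-((a ^ 2 - 1) / 2)) *
          probNormalBelowMin a n)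
      atTop
      (nhds ((4 * Real.pi) ^ ((a ^ 2 - 1) / 2) * Real.Gamma (a ^ 2 + 1) / a)) := by
  have ha0 : 0 < a := by linarith
  obtain ⟨A, hA, hdom⟩ := nbm_dom a ha
  have key := tendsto_integral_filter_of_dominated_convergence
    (μ := volume.restrict (Set.Ioi (0 : ℝ))) (l := atTop)
    (F := fun n : ℕ => (Set.Ioo 0 (n : ℝ)).indicator (nbmF a n))
    (f := fun s => a * Real.exp (-s) * (s ^ 2 * (4 * Real.pi)) ^ ((a ^ 2 - 1) / 2))
    (fun s => A * Real.exp (-(1 / 2) * s))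
    (by filter_upwards [eventually_ge_atTop 2] with n hn using nbm_meas a n hn)
    (by filter_upwards [eventually_ge_atTop 2] with n hn using
          Eventually.of_forall (hdom n hn))
    ((exp_neg_integrableOn_Ioi 0 (by norm_num : (0 : ℝ) < 1 / 2)).const_mul A)
    (by
      filter_upwards [ae_restrict_mem measurableSet_Ioi] with s hs
      exact nbm_pointwise a ha s hs)
  have hval : ∫ s in Set.Ioi (0 : ℝ),
      a * Real.exp (-s) * (s ^ 2 * (4 * Real.pi)) ^ ((a ^ 2 - 1) / 2) =
      (4 * Real.pi) ^ ((a ^ 2 - 1) / 2) * Real.Gamma (a ^ 2 + 1) / a := by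
    rw [Real.Gamma_add_one (by positivity), Real.Gamma_eq_integral (by positivity)]
    have : (4 * Real.pi) ^ ((a ^ 2 - 1) / 2) *
        (a ^ 2 * ∫ x in Set.Ioi (0 : ℝ), Real.exp (-x) * x ^ (a ^ 2 - 1)) / a =
        (a * (4 * Real.pi) ^ ((a ^ 2 - 1) / 2)) *
          ∫ x in Set.Ioi (0 : ℝ), Real.exp (-x) * x ^ (a ^ 2 - 1) := by
      field_simp
    rw [this, ← integral_const_mul]
    refine setIntegral_congr_fun measurableSet_Ioi fun s hs => ?_
    have hs : 0 < s := hs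
    rw [Real.mul_rpow (by positivity) (by positivity), ← Real.rpow_natCast_mul hs.le,
      show ((2 : ℕ) : ℝ) * ((a ^ 2 - 1) / 2) = a ^ 2 - 1 by push_cast; ring]
    ring
  rw [hval] at key
  refine key.congr' ?_
  filter_upwards [eventually_ge_atTop 2] with n hn
  exact (nbm_scaled a ha n hn).symm

/-- Normal variable versus the minimum: for fixed `a ≥ 1`,
`n^{a²}(log n)^{-(a²-1)/2} P(Y_a ≤ M_n) → (4π)^{(a²-1)/2}Γ(a²+1)/a`, together
with the matching upper bound for all `n ≥ 2`. -/
theorem normal_below_minimum_asymptotics (a : ℝ) (ha : 1 ≤ a) :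
    Tendsto (fun n : ℕ =>
        (n : ℝ) ^ (a ^ 2) * (Real.log n) ^ (-((a ^ 2 - 1) / 2)) *
          probNormalBelowMin a n)
      atTop
      (nhds ((4 * Real.pi) ^ ((a ^ 2 - 1) / 2) * Real.Gamma (a ^ 2 + 1) / a)) ∧
    ∃ C : ℝ, ∀ n : ℕ, 2 ≤ n →
      probNormalBelowMin a n ≤
        C * (n : ℝ) ^ (-(a ^ 2)) * (Real.log n) ^ ((a ^ 2 - 1) / 2) := by

  refine ⟨nbm_tendsto a ha, ?_⟩
  obtain ⟨C, hC⟩ := (nbm_tendsto a ha).bddAbove_range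
  refine ⟨C, fun n hn => ?_⟩
  have h := hC ⟨n, rfl⟩
  have hn0 : (0 : ℝ) < n := by positivity
  have hl : 0 < Real.log n := Real.log_pos (by exact_mod_cast hn)
  simp only [Real.rpow_neg hl.le] at h
  rw [Real.rpow_neg hn0.le]
  have p1 : 0 < (n : ℝ) ^ (a ^ 2) := by positivity
  have p2 : 0 < (Real.log n) ^ ((a ^ 2 - 1) / 2) := by positivity
  generalize (n : ℝ) ^ (a ^ 2) = x at *
  generalize (Real.log n) ^ ((a ^ 2 - 1) / 2) = z at *
  calc probNormalBelowMin a n = (x * z⁻¹ * probNormalBelowMin a n) * x⁻¹ * z := by field_simp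
    _ ≤ _ := by gcongr
end

section
/- Define Ψ(u) := Φ(√2·Φ⁻¹(u)) for u ∈ (0,1). Then lim_{n→∞} (n²/√(log n)) · n ∫₀¹ (1−u)^{n−1} Ψ(u) du = 2√(2π). Moreover there is a constant C < ∞ such that n ∫₀¹ (1−u)^{n−1} Ψ(u)² du ≤ C (log n)/n⁴ for all sufficiently large n. -/
open Filter Set

/-- The standard normal cumulative distribution function
`Φ(t) = ∫_{-∞}^t e^{-z²/2}/√(2π) dz`. -/
noncomputable def stdNormalCDF (t : ℝ) : ℝ :=
  ∫ z in Set.Iic t, Real.exp (-z ^ 2 / 2) / Real.sqrt (2 * Real.pi)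

/-- The inverse function `Φ⁻¹ : (0,1) → ℝ` of the standard normal CDF. -/
noncomputable def stdNormalCDFInv : ℝ → ℝ :=
  Function.invFun stdNormalCDF

/-- The GOE off-diagonal tail-transfer function `Ψ(u) = Φ(√2·Φ⁻¹(u))`. -/
noncomputable def PsiGOE (u : ℝ) : ℝ :=
  stdNormalCDF (Real.sqrt 2 * stdNormalCDFInv u)

open MeasureTheory ProbabilityTheory Topology

/-- The standard normal density. -/
noncomputable def phiAux (z : ℝ) : ℝ := Real.exp (-z ^ 2 / 2) / Real.sqrt (2 * Real.pi)

lemma phiAux_eq : phiAux = gaussianPDFReal 0 1 := by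
  funext z
  simp [phiAux, gaussianPDFReal, div_eq_mul_inv, mul_comm]

lemma phiAux_pos (z : ℝ) : 0 < phiAux z := by
  unfold phiAux; positivity

lemma phiAux_continuous : Continuous phiAux := by
  unfold phiAux; fun_prop

lemma phiAux_integrable : Integrable phiAux := by
  rw [phiAux_eq]; exact integrable_gaussianPDFReal 0 1

lemma cdf_aux : stdNormalCDF = cdf (gaussianReal 0 1) := by
  funext t
  rw [cdf_eq_real, measureReal_def, gaussianReal_apply_eq_integral 0 one_ne_zero,
    ENNReal.toReal_ofReal, ← phiAux_eq]
  · rfl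
  · exact integral_nonneg (fun x => gaussianPDFReal_nonneg _ _ _)

lemma cdf_hasDerivAt (t : ℝ) : HasDerivAt stdNormalCDF (phiAux t) t := by
  have h : stdNormalCDF = fun t => stdNormalCDF 0 + ∫ z in (0:ℝ)..t, phiAux z := by
    funext t
    rw [← intervalIntegral.integral_Iic_sub_Iic phiAux_integrable.integrableOn
      phiAux_integrable.integrableOn]
    simp [stdNormalCDF, phiAux]
  rw [h]
  exact (intervalIntegral.integral_hasDerivAt_right (phiAux_continuous.intervalIntegrable _ _)
    (phiAux_continuous.stronglyMeasurableAtFilter _ _) phiAux_continuous.continuousAt).const_add _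

lemma cdf_strictMono : StrictMono stdNormalCDF := by
  apply strictMono_of_deriv_pos
  intro x
  rw [(cdf_hasDerivAt x).deriv]
  exact phiAux_pos x

lemma cdf_cont : Continuous stdNormalCDF :=
  continuous_iff_continuousAt.2 fun x => (cdf_hasDerivAt x).continuousAt

lemma cdf_bot : Tendsto stdNormalCDF atBot (𝓝 0) := by
  rw [cdf_aux]; exact tendsto_cdf_atBot _

lemma cdf_top : Tendsto stdNormalCDF atTop (𝓝 1) := by
  rw [cdf_aux]; exact tendsto_cdf_atTop _

lemma cdf_nn (t : ℝ) : 0 ≤ stdNormalCDF t := by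
  rw [cdf_aux]; exact cdf_nonneg _ _

lemma cdf_le1 (t : ℝ) : stdNormalCDF t ≤ 1 := by
  rw [cdf_aux]; exact cdf_le_one _ _

lemma cdf_pos (t : ℝ) : 0 < stdNormalCDF t :=
  (cdf_nn (t - 1)).trans_lt (cdf_strictMono (by linarith))

lemma cdf_lt1 (t : ℝ) : stdNormalCDF t < 1 :=
  (cdf_strictMono (by linarith : t < t + 1)).trans_le (cdf_le1 _)

lemma cdf_inv {u : ℝ} (hu : u ∈ Ioo (0:ℝ) 1) : stdNormalCDF (stdNormalCDFInv u) = u := by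
  apply Function.invFun_eq
  obtain ⟨a, ha⟩ := (cdf_bot.eventually (gt_mem_nhds hu.1)).exists
  obtain ⟨b, hb⟩ := (cdf_top.eventually (lt_mem_nhds hu.2)).exists
  exact mem_range_of_exists_le_of_exists_ge cdf_cont ⟨a, ha.le⟩ ⟨b, hb.le⟩

lemma inv_mono : MonotoneOn stdNormalCDFInv (Ioo (0:ℝ) 1) := by
  intro u hu v hv h
  rw [← cdf_strictMono.le_iff_le, cdf_inv hu, cdf_inv hv]
  exact h

lemma psi_mono : MonotoneOn PsiGOE (Ioo (0:ℝ) 1) := by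
  intro u hu v hv h
  apply cdf_strictMono.monotone
  exact mul_le_mul_of_nonneg_left (inv_mono hu hv h) (Real.sqrt_nonneg 2)

lemma inv_bot : Tendsto stdNormalCDFInv (𝓝[>] 0) atBot := by
  rw [tendsto_atBot]
  intro M
  filter_upwards [Ioo_mem_nhdsGT (cdf_pos M)] with u hu
  rw [← cdf_strictMono.le_iff_le, cdf_inv ⟨hu.1, hu.2.trans (cdf_lt1 M)⟩]
  exact hu.2.le

/-- Mills ratio. -/
lemma mills : Tendsto (fun t => stdNormalCDF t / (phiAux t / (-t))) atBot (𝓝 1) := by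
  have hphi : ∀ t, HasDerivAt phiAux (-t * phiAux t) t := by
    intro t
    have h1 : HasDerivAt (fun z : ℝ => -z ^ 2 / 2) (-t) t := by
      exact (((hasDerivAt_pow 2 t).neg).div_const 2).congr_deriv (by norm_num; ring)
    exact ((h1.exp).div_const (Real.sqrt (2 * Real.pi))).congr_deriv (by unfold phiAux; ring)
  apply HasDerivAt.lhopital_zero_atBot (f' := phiAux) (g' := fun t => phiAux t * (1 + (t^2)⁻¹))
  · exact Eventually.of_forall cdf_hasDerivAt
  · filter_upwards [eventually_lt_atBot 0] with t ht
    have h0 : -t ≠ 0 := by linarith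
    have h1 : t ≠ 0 := ht.ne
    refine ((hphi t).fun_div (hasDerivAt_neg t) h0).congr_deriv ?_
    field_simp
    ring
  · exact Eventually.of_forall fun t => (mul_pos (phiAux_pos t) (by positivity)).ne'
  · exact cdf_bot
  · have h2 : Tendsto (fun t : ℝ => (-t)⁻¹) atBot (𝓝 0) :=
      tendsto_inv_atTop_zero.comp tendsto_neg_atBot_atTop
    apply squeeze_zero' _ _ h2
    · filter_upwards [eventually_lt_atBot 0] with t ht
      exact div_nonneg (phiAux_pos t).le (by linarith)
    · filter_upwards [eventually_lt_atBot 0] with t ht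
      rw [div_eq_mul_inv]
      apply mul_le_of_le_one_left (inv_nonneg.2 (by linarith))
      unfold phiAux
      rw [div_le_one (by positivity)]
      calc Real.exp (-t^2/2) ≤ 1 := Real.exp_le_one_iff.2 (by nlinarith [sq_nonneg t])
        _ ≤ _ := Real.one_le_sqrt.2 (by nlinarith [Real.pi_gt_three])
  · have : Tendsto (fun t : ℝ => (1 + (t^2)⁻¹)⁻¹) atBot (𝓝 ((1 + 0)⁻¹)) := by
      apply Tendsto.inv₀ _ (by norm_num)
      apply tendsto_const_nhds.add
      apply tendsto_inv_atTop_zero.comp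
      have : Tendsto (fun t : ℝ => (-t)^2) atBot atTop :=
        (tendsto_pow_atTop two_ne_zero).comp tendsto_neg_atBot_atTop
      simpa using this
    simp only [add_zero, inv_one] at this
    refine this.congr fun t => ?_
    have := phiAux_pos t
    rw [div_mul_eq_div_div, div_self this.ne', one_div]

/-- log asymptotics -/
lemma log_asymp : Tendsto (fun t => Real.log (1 / stdNormalCDF t) / (-t)^2) atBot (𝓝 (1/2)) := by
  have hn : Tendsto (fun t : ℝ => -t) atBot atTop := tendsto_neg_atBot_atTop
  have hinv2 : Tendsto (fun t : ℝ => ((-t)^2)⁻¹) atBot (𝓝 0) :=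
    tendsto_inv_atTop_zero.comp ((tendsto_pow_atTop two_ne_zero).comp hn)
  have hl : Tendsto (fun t : ℝ => Real.log (-t) / (-t)^2) atBot (𝓝 0) := by
    have := (isLittleO_log_rpow_atTop (r := 2) (by norm_num)).tendsto_div_nhds_zero.comp hn
    simpa [Function.comp_def] using this
  have h1 : Tendsto (fun t => Real.log (stdNormalCDF t / (phiAux t / (-t)))) atBot (𝓝 0) := by
    simpa using mills.log one_ne_zero
  have := (((h1.mul hinv2).neg).add hl).add
    ((hinv2.const_mul (Real.log (Real.sqrt (2 * Real.pi)))).add_const (1/2))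
  simp only [mul_zero, neg_zero, zero_add] at this
  refine this.congr' ?_
  filter_upwards [eventually_lt_atBot 0] with t ht
  have ht' : 0 < -t := by linarith
  have hc := cdf_pos t
  have hp := phiAux_pos t
  rw [Real.log_div hc.ne' (by positivity), Real.log_div hp.ne' ht'.ne', one_div (stdNormalCDF t), Real.log_inv]
  have : Real.log (phiAux t) = -t^2/2 - Real.log (Real.sqrt (2 * Real.pi)) := by
    unfold phiAux
    rw [Real.log_div (Real.exp_pos _).ne' (by positivity), Real.log_exp]
  rw [this]
  have : t ≠ 0 := ht.ne
  field_simp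
  ring

lemma psi_asymp_t : Tendsto (fun t => stdNormalCDF (Real.sqrt 2 * t) /
    (stdNormalCDF t ^ 2 * Real.sqrt (Real.log (1 / stdNormalCDF t)))) atBot
    (𝓝 (Real.sqrt (2 * Real.pi))) := by
  have h2 : 0 < Real.sqrt 2 := by positivity
  have hm2 := mills.comp (tendsto_id.const_mul_atBot h2 : Tendsto (fun t : ℝ => Real.sqrt 2 * t) atBot atBot)
  have hs := (log_asymp.sqrt).inv₀ (by positivity)
  have := ((hm2.div (mills.pow 2) (by norm_num)).mul hs).mul_const
    (Real.sqrt (2 * Real.pi) / Real.sqrt 2)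
  have e : (1 / 1 ^ 2 * (Real.sqrt (1/2))⁻¹) * (Real.sqrt (2 * Real.pi) / Real.sqrt 2)
      = Real.sqrt (2 * Real.pi) := by
    rw [one_div (2:ℝ), Real.sqrt_inv, inv_inv]
    field_simp
  rw [e] at this
  refine this.congr' ?_
  filter_upwards [eventually_lt_atBot 0] with t ht
  have ht' : 0 < -t := by linarith
  have hc := cdf_pos t
  have hp := phiAux_pos t
  have hq := phiAux_pos (Real.sqrt 2 * t)
  have hL : 0 < Real.log (1 / stdNormalCDF t) := by
    apply Real.log_pos
    rw [lt_div_iff₀ hc, one_mul]; exact cdf_lt1 t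
  have hsL := Real.sqrt_pos.2 hL
  have hrel : phiAux (Real.sqrt 2 * t) = Real.sqrt (2 * Real.pi) * phiAux t ^ 2 := by
    unfold phiAux
    rw [div_pow, ← Real.exp_nat_mul, mul_pow, Real.sq_sqrt (by norm_num)]
    have : Real.sqrt (2 * Real.pi) ≠ 0 := by positivity
    field_simp
    congr 1
    push_cast; ring
  simp only [Function.comp, Pi.div_apply]
  rw [hrel, Real.sqrt_div hL.le, Real.sqrt_sq ht'.le]
  have h3 : Real.sqrt (2 * Real.pi) ≠ 0 := by positivity
  have : t ≠ 0 := ht.ne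
  field_simp

lemma psi_asymp : Tendsto (fun u => PsiGOE u / (u ^ 2 * Real.sqrt (Real.log (1 / u)))) (𝓝[>] 0)
    (𝓝 (Real.sqrt (2 * Real.pi))) := by
  refine (psi_asymp_t.comp inv_bot).congr' ?_
  filter_upwards [Ioo_mem_nhdsGT one_pos] with u hu
  simp only [Function.comp, cdf_inv hu, PsiGOE]

lemma psi_bound : ∃ C : ℝ, 0 < C ∧ ∀ u ∈ Ioo (0:ℝ) 1,
    PsiGOE u ≤ C * (u ^ 2 * Real.sqrt (1 + Real.log (1 / u))) := by
  have h := psi_asymp.eventually (gt_mem_nhds (lt_add_one _))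
  obtain ⟨d, hd, hd'⟩ := (mem_nhdsGT_iff_exists_Ioo_subset).1 h
  have hd : 0 < d := hd
  set L := Real.sqrt (2 * Real.pi) + 1 with hLdef
  have hL : 0 < L := by positivity
  refine ⟨L + (d^2)⁻¹, by positivity, fun u hu => ?_⟩
  have hl : 0 < Real.log (1 / u) := by
    apply Real.log_pos
    rw [lt_div_iff₀ hu.1, one_mul]; exact hu.2
  have hu0 := hu.1
  have hs1 : 1 ≤ Real.sqrt (1 + Real.log (1/u)) := Real.one_le_sqrt.2 (by linarith)
  rcases lt_or_ge u d with hud | hud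
  · have : PsiGOE u / (u ^ 2 * Real.sqrt (Real.log (1 / u))) < L := hd' ⟨hu0, hud⟩
    have hsl := Real.sqrt_pos.2 hl
    rw [div_lt_iff₀ (by positivity)] at this
    refine this.le.trans ?_
    have : Real.sqrt (Real.log (1/u)) ≤ Real.sqrt (1 + Real.log (1/u)) :=
      Real.sqrt_le_sqrt (by linarith)
    gcongr
    have : 0 < (d^2)⁻¹ := by positivity
    linarith
  · refine (cdf_le1 _).trans ?_
    calc (1:ℝ) = (d^2)⁻¹ * (d^2 * 1) := by field_simp
      _ ≤ _ := by
        gcongr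
        linarith

lemma scale_bound {n t C : ℝ} (hC : 0 < C) (hn : 1 ≤ Real.log n) (hn0 : 0 < n) (ht : 0 < t)
    (htn : t < n) :
    n ^ 2 / Real.sqrt (Real.log n) * (C * ((t / n) ^ 2 * Real.sqrt (1 + Real.log (1 / (t / n)))))
      ≤ C * 512 * Real.exp (t / 8) := by
  have hln : 0 < Real.log n := by linarith
  have hs := Real.sqrt_pos.2 hln
  have e1 : Real.log (1 / (t / n)) = Real.log n - Real.log t := by
    rw [one_div_div, Real.log_div hn0.ne' ht.ne']
  have hlt : - Real.log t ≤ 1 / t := by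
    have := Real.log_le_sub_one_of_pos (inv_pos.2 ht)
    rw [Real.log_inv] at this
    rw [one_div]; linarith
  have h1 : Real.sqrt (1 + Real.log (1 / (t / n))) ≤ Real.sqrt (Real.log n) * (2 + 1 / t) := by
    have ht1 : 0 < 1 / t := by positivity
    rw [← Real.sqrt_sq (show (0:ℝ) ≤ 2 + 1 / t by positivity), ← Real.sqrt_mul hln.le]
    apply Real.sqrt_le_sqrt
    rw [e1]
    nlinarith [mul_nonneg (sub_nonneg.2 hn) ht1.le, mul_pos hln (mul_pos ht1 ht1)]
  have h2 : 1 + t ≤ 16 * Real.exp (t / 16) := by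
    have := Real.add_one_le_exp (t / 16)
    linarith
  have h3 : Real.exp (t / 8) = Real.exp (t / 16) ^ 2 := by
    rw [← Real.exp_nat_mul]; congr 1; push_cast; ring
  calc _ ≤ n ^ 2 / Real.sqrt (Real.log n) *
        (C * ((t / n) ^ 2 * (Real.sqrt (Real.log n) * (2 + 1 / t)))) := by gcongr
    _ = C * (2 * t ^ 2 + t) := by field_simp
    _ ≤ C * (2 * (1 + t) ^ 2) := by gcongr; nlinarith
    _ ≤ C * (2 * (16 * Real.exp (t / 16)) ^ 2) := by gcongr
    _ = _ := by rw [h3]; ring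

lemma scale_lim {t : ℝ} (ht : 0 < t) :
    Tendsto (fun n : ℕ => (n : ℝ) ^ 2 / Real.sqrt (Real.log n) * PsiGOE (t / n)) atTop
      (𝓝 (Real.sqrt (2 * Real.pi) * t ^ 2)) := by
  have hn : Tendsto (fun n : ℕ => (n : ℝ)) atTop atTop := tendsto_natCast_atTop_atTop
  have hl : Tendsto (fun n : ℕ => Real.log (n : ℝ)) atTop atTop := Real.tendsto_log_atTop.comp hn
  have hu : Tendsto (fun n : ℕ => t / (n : ℝ)) atTop (𝓝[>] 0) := by
    rw [tendsto_nhdsWithin_iff]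
    refine ⟨tendsto_const_nhds.div_atTop hn, ?_⟩
    filter_upwards [hn.eventually_gt_atTop 0] with n hn0
    exact div_pos ht hn0
  have h1 := psi_asymp.comp hu
  have h2 : Tendsto (fun n : ℕ => Real.sqrt (1 - Real.log t / Real.log (n : ℝ))) atTop (𝓝 1) := by
    have : Tendsto (fun n : ℕ => 1 - Real.log t / Real.log (n : ℝ)) atTop (𝓝 (1 - 0)) :=
      tendsto_const_nhds.sub (tendsto_const_nhds.div_atTop hl)
    simpa using this.sqrt
  have := (h1.mul_const (t ^ 2)).mul h2
  rw [mul_one] at this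
  refine this.congr' ?_
  filter_upwards [hn.eventually_gt_atTop t, hl.eventually_gt_atTop 0] with n hnt hln
  have hn0 : (0:ℝ) < n := ht.trans hnt
  have e1 : Real.log (1 / (t / n)) = Real.log n - Real.log t := by
    rw [one_div_div, Real.log_div hn0.ne' ht.ne']
  have e2 : 1 - Real.log t / Real.log n = (Real.log n - Real.log t) / Real.log n := by
    field_simp
  have hpos : 0 < Real.log n - Real.log t := by
    have := Real.log_lt_log ht hnt
    linarith
  have hs := Real.sqrt_pos.2 hpos
  have hs2 := Real.sqrt_pos.2 hln
  simp only [Function.comp]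
  rw [e1, e2, Real.sqrt_div hpos.le]
  field_simp

lemma pow_lim (t : ℝ) :
    Tendsto (fun n : ℕ => (1 - t / (n : ℝ)) ^ (n - 1)) atTop (𝓝 (Real.exp (-t))) := by
  have hn : Tendsto (fun n : ℕ => (n : ℝ)) atTop atTop := tendsto_natCast_atTop_atTop
  have h1 := Real.tendsto_one_add_div_pow_exp (-t)
  have h2 : Tendsto (fun n : ℕ => 1 - t / (n : ℝ)) atTop (𝓝 (1 - 0)) :=
    tendsto_const_nhds.sub (tendsto_const_nhds.div_atTop hn)
  rw [sub_zero] at h2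
  have h3 := h1.div h2 one_ne_zero
  rw [div_one] at h3
  refine h3.congr' ?_
  filter_upwards [hn.eventually_gt_atTop t, eventually_ge_atTop 1] with n hnt h1n
  have hn0 : (0:ℝ) < n := by exact_mod_cast h1n
  have hne : 1 - t / (n:ℝ) ≠ 0 := by
    have : t / n < 1 := (div_lt_one hn0).2 hnt
    linarith
  obtain ⟨m, rfl⟩ : ∃ m, n = m + 1 := ⟨n - 1, by omega⟩
  simp only [Pi.div_apply, Nat.add_sub_cancel]
  rw [neg_div, ← sub_eq_add_neg, pow_succ, mul_div_cancel_right₀ _ hne]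

lemma main_lim (k : ℕ) (hk : k ≤ 2) :
    Tendsto (fun n : ℕ => ((n : ℝ) ^ 2 / Real.sqrt (Real.log n)) ^ k *
      ((n : ℝ) * ∫ u in Set.Ioo (0 : ℝ) 1, (1 - u) ^ (n - 1) * PsiGOE u ^ k)) atTop
      (𝓝 (∫ t in Set.Ioi (0:ℝ), Real.exp (-t) * (Real.sqrt (2 * Real.pi) * t ^ 2) ^ k)) := by
  have hn : Tendsto (fun n : ℕ => (n : ℝ)) atTop atTop := tendsto_natCast_atTop_atTop
  have hl : Tendsto (fun n : ℕ => Real.log (n : ℝ)) atTop atTop := Real.tendsto_log_atTop.comp hn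
  obtain ⟨C, hC, hCb⟩ := psi_bound
  obtain ⟨P, hPm, hPe⟩ := psi_mono.exists_monotone_extension
    ⟨0, by rintro _ ⟨u, -, rfl⟩; exact cdf_nn _⟩ ⟨1, by rintro _ ⟨u, -, rfl⟩; exact cdf_le1 _⟩
  have hPmeas : Measurable P := hPm.measurable
  let G : ℕ → ℝ → ℝ := fun n => (Ioo (0:ℝ) 1).indicator (fun u => (1 - u) ^ (n - 1) * P u ^ k)
  have hGmeas : ∀ n, Measurable (G n) := fun n =>
    Measurable.indicator (by fun_prop) measurableSet_Ioo
  let F : ℕ → ℝ → ℝ := fun n t => ((n : ℝ) ^ 2 / Real.sqrt (Real.log n)) ^ k * G n (t / n)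
  have hFint : ∀ n : ℕ, ∫ t, F n t = ((n : ℝ) ^ 2 / Real.sqrt (Real.log n)) ^ k *
      ((n : ℝ) * ∫ u in Set.Ioo (0 : ℝ) 1, (1 - u) ^ (n - 1) * PsiGOE u ^ k) := by
    intro n
    simp only [F]
    rw [integral_const_mul, Measure.integral_comp_div (G n) (n:ℝ)]
    simp only [G]
    rw [integral_indicator measurableSet_Ioo, smul_eq_mul, abs_of_nonneg (Nat.cast_nonneg n)]
    congr 2
    refine setIntegral_congr_fun measurableSet_Ioo fun u hu => ?_
    simp only [hPe hu]
  rw [← integral_indicator measurableSet_Ioi]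
  simp_rw [← hFint]
  refine tendsto_integral_filter_of_dominated_convergence
    ((Ioi (0:ℝ)).indicator fun t => (C * 512) ^ k * Real.exp (-(1/4) * t)) ?_ ?_ ?_ ?_
  · exact Eventually.of_forall fun n =>
      (((hGmeas n).comp (measurable_id.div_const _)).const_mul _).aestronglyMeasurable
  · filter_upwards [hl.eventually_ge_atTop 1, eventually_ge_atTop 2] with n hln hn2
    refine Eventually.of_forall fun t => ?_
    have hn2' : (2:ℝ) ≤ n := by exact_mod_cast hn2
    have hn0 : (0:ℝ) < n := by linarith
    by_cases htn : t / (n:ℝ) ∈ Ioo (0:ℝ) 1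
    · have ht : 0 < t := by
        have := mul_pos htn.1 hn0
        rwa [div_mul_cancel₀ _ hn0.ne'] at this
      have htn' : t < n := (div_lt_one hn0).1 htn.2
      have hpsi0 : 0 ≤ PsiGOE (t / n) := cdf_nn _
      have h1t : 0 ≤ 1 - t / (n:ℝ) := by linarith [htn.2]
      have hFe : F n t = (1 - t / n) ^ (n - 1) *
          ((n : ℝ) ^ 2 / Real.sqrt (Real.log n) * PsiGOE (t / n)) ^ k := by
        simp only [F, G]
        rw [indicator_of_mem htn, ← hPe htn]
        ring
      have hA0 : 0 ≤ (n : ℝ) ^ 2 / Real.sqrt (Real.log n) := by positivity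
      have hA : (n : ℝ) ^ 2 / Real.sqrt (Real.log n) * PsiGOE (t / n) ≤
          C * 512 * Real.exp (t / 8) :=
        (mul_le_mul_of_nonneg_left (hCb _ htn) hA0).trans (scale_bound hC hln hn0 ht htn')
      have hB : (1 - t / (n:ℝ)) ^ (n - 1) ≤ Real.exp (-t / 2) := by
        calc (1 - t / (n:ℝ)) ^ (n - 1) ≤ Real.exp (-(t / n)) ^ (n - 1) := by
              gcongr
              have := Real.add_one_le_exp (-(t / (n:ℝ)))
              linarith
          _ = Real.exp (((n - 1 : ℕ) : ℝ) * (-(t / n))) := by rw [← Real.exp_nat_mul]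
          _ ≤ _ := by
              apply Real.exp_le_exp.2
              rw [Nat.cast_sub (by omega), Nat.cast_one]
              have : (n - 1 : ℝ) * -(t / n) = -t + t / n := by field_simp; ring
              rw [this]
              have : t / n ≤ t / 2 := by gcongr
              linarith
      rw [indicator_of_mem (show t ∈ Ioi (0:ℝ) from ht), Real.norm_of_nonneg (by rw [hFe]; positivity), hFe]
      calc _ ≤ Real.exp (-t / 2) * (C * 512 * Real.exp (t / 8)) ^ k := by gcongr
        _ = (C * 512) ^ k * Real.exp (-t / 2 + k * (t / 8)) := by
            rw [mul_pow, ← Real.exp_nat_mul, Real.exp_add]; ring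
        _ ≤ _ := by
            gcongr
            have : (k:ℝ) ≤ 2 := by exact_mod_cast hk
            nlinarith
    · simp only [F, G]
      rw [indicator_of_notMem htn, mul_zero, norm_zero]
      exact indicator_nonneg (fun t _ => by positivity) _
  · rw [integrable_indicator_iff measurableSet_Ioi]
    exact (integrableOn_exp_mul_Ioi (by norm_num) 0).const_mul _
  · refine Eventually.of_forall fun t => ?_
    rcases le_or_gt t 0 with ht | ht
    · rw [indicator_of_notMem (by simpa using ht)]
      refine tendsto_const_nhds.congr fun n => ?_
      simp only [F, G]
      rw [indicator_of_notMem, mul_zero]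
      intro h
      exact absurd h.1 (not_lt.2 (div_nonpos_of_nonpos_of_nonneg ht (Nat.cast_nonneg n)))
    · rw [indicator_of_mem (show t ∈ Ioi (0:ℝ) from ht)]
      refine ((pow_lim t).mul ((scale_lim ht).pow k)).congr' ?_
      filter_upwards [hn.eventually_gt_atTop t] with n hnt
      have hn0 : (0:ℝ) < n := ht.trans hnt
      have htn : t / (n:ℝ) ∈ Ioo (0:ℝ) 1 := ⟨by positivity, (div_lt_one hn0).2 hnt⟩
      simp only [F, G]
      rw [indicator_of_mem htn, ← hPe htn]
      ring

/-- Moments of the minimum-diagonal pair probability: with `U ~ Beta(1,n)`,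
`(n²/√(log n)) E[Ψ(U)] → 2√(2π)` and `E[Ψ(U)²] ≤ C(log n)/n⁴` eventually. -/
theorem minimum_diagonal_pair_probability_moments :
    Tendsto (fun n : ℕ =>
        ((n : ℝ) ^ 2 / Real.sqrt (Real.log n)) *
          ((n : ℝ) * ∫ u in Set.Ioo (0 : ℝ) 1, (1 - u) ^ (n - 1) * PsiGOE u))
      atTop (nhds (2 * Real.sqrt (2 * Real.pi))) ∧
    ∃ C : ℝ, ∀ᶠ n : ℕ in atTop,
      (n : ℝ) * (∫ u in Set.Ioo (0 : ℝ) 1, (1 - u) ^ (n - 1) * PsiGOE u ^ 2) ≤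
        C * Real.log n / (n : ℝ) ^ 4 := by
  constructor
  · have h := main_lim 1 (by norm_num)
    simp only [pow_one] at h
    convert h using 2
    have e : ∫ t in Set.Ioi (0:ℝ), Real.exp (-t) * (Real.sqrt (2 * Real.pi) * t ^ 2)
        = Real.sqrt (2 * Real.pi) * ∫ t in Set.Ioi (0:ℝ), Real.exp (-t) * t ^ ((3:ℝ) - 1) := by
      rw [← integral_const_mul]
      refine setIntegral_congr_fun measurableSet_Ioi fun t ht => ?_
      have : t ^ ((3:ℝ) - 1) = t ^ 2 := by
        rw [← Real.rpow_natCast]; norm_num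
      simp only [this]
      ring
    rw [e, ← Real.Gamma_eq_integral (by norm_num)]
    have : Real.Gamma 3 = 2 := by
      have := Real.Gamma_nat_eq_factorial 2
      norm_num at this
      simpa using this
    rw [this]; ring
  · have h := main_lim 2 le_rfl
    set L := ∫ t in Set.Ioi (0:ℝ), Real.exp (-t) * (Real.sqrt (2 * Real.pi) * t ^ 2) ^ 2
    refine ⟨L + 1, ?_⟩
    have hl : Tendsto (fun n : ℕ => Real.log (n : ℝ)) atTop atTop :=
      Real.tendsto_log_atTop.comp tendsto_natCast_atTop_atTop
    filter_upwards [h.eventually (gt_mem_nhds (lt_add_one L)), hl.eventually_gt_atTop 0,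
      eventually_gt_atTop 0] with n hn hln hn0
    have hn0' : (0:ℝ) < n := by exact_mod_cast hn0
    rw [div_pow, Real.sq_sqrt hln.le, ← pow_mul, div_mul_eq_mul_div, div_lt_iff₀ hln] at hn
    rw [le_div_iff₀ (by positivity)]
    norm_num at hn ⊢
    linarith
end
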